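/- Let f : B → ℝⁿ \ {0} be a K-quasiregular mapping such that |∇ ln|f(x)|| dx is a Carleson measure on B with constant Γ. Then for every 0 < k ≤ 1/2, all x ∈ B and all y, z ∈ B(x, k(1−|x|)), one has |f(y)|/|f(z)| ≤ C, where C depends only on n, K, k and Γ. -/

import Mathlib

open MeasureTheory Metric Set Filter
open scoped ENNReal NNReal Topology Classical

noncomputable section

abbrev Vec (n : ℕ) := EuclideanSpace ℝ (Fin n)

/-- The open unit ball in `ℝⁿ`. -/
def unitBall (n : ℕ) : Set (Vec n) := Metric.ball 0 1

/-- The unit sphere `S^{n-1}` in `ℝⁿ`. -/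
def unitSphere (n : ℕ) : Set (Vec n) := Metric.sphere 0 1

/-- Surface measure on the unit sphere, modelled by `(n-1)`-dimensional
Hausdorff measure restricted to the sphere. -/
def sphMeasure (n : ℕ) : Measure (Vec n) := (μH[(n : ℝ) - 1]).restrict (unitSphere n)

/-- `f` is `K`-quasiregular on the unit ball. -/
def IsQR (n : ℕ) (K : ℝ) (f : Vec n → Vec n) : Prop :=
  ContinuousOn f (unitBall n) ∧
  (∀ x ∈ unitBall n, DifferentiableAt ℝ f x) ∧
  (∀ᵐ x ∂(volume.restrict (unitBall n)),
    ‖fderiv ℝ f x‖ ^ n ≤ K * (fderiv ℝ f x).det)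

/-- The conformal automorphism `T_x` of the unit ball (with `T_0 = id`). -/
def mobiusT (n : ℕ) (x : Vec n) (y : Vec n) : Vec n :=
  if x = 0 then y
  else (‖x‖ ^ 2 * ‖y - (‖x‖ ^ 2)⁻¹ • x‖ ^ 2)⁻¹ •
    ((1 - ‖x‖ ^ 2) • (y - x) - ‖y - x‖ ^ 2 • x)

/-- The Miniowitz class (Min) with constants `C₀, α`. -/
def InMiniowitz (n : ℕ) (C₀ α : ℝ) (f : Vec n → Vec n) : Prop :=
  ∀ x ∈ unitBall n, ∀ y ∈ unitBall n,
    C₀⁻¹ * ((1 - ‖y‖) / (1 + ‖y‖)) ^ α ≤ ‖f (mobiusT n (-x) y)‖ / ‖f (mobiusT n (-x) 0)‖ ∧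
    ‖f (mobiusT n (-x) y)‖ / ‖f (mobiusT n (-x) 0)‖ ≤ C₀ * ((1 + ‖y‖) / (1 - ‖y‖)) ^ α

/-- The multiplicity condition (M) with exponent `a` and constant `C₁`. -/
def MultCond (n : ℕ) (a C₁ : ℝ) (f : Vec n → Vec n) : Prop :=
  ∀ x ∈ unitBall n, ∀ r : ℝ, 0 < r → r < 1 → ∀ y : Vec n,
    (({z ∈ Metric.ball (0 : Vec n) r | f (mobiusT n (-x) z) = y}).encard : ℝ≥0∞) ≤
      ENNReal.ofReal (C₁ / (1 - r) ^ a)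

/-- The non-tangential region `Γ(ω)` with aperture parameter `κ`. -/
def ntRegion (n : ℕ) (κ : ℝ) (ω : Vec n) : Set (Vec n) :=
  {x ∈ unitBall n | ‖x - ω‖ < (1 + κ) * (1 - ‖x‖)}

/-- The non-tangential maximal function `f*`. -/
def ntMax (n : ℕ) (κ : ℝ) (f : Vec n → Vec n) (ω : Vec n) : ℝ≥0∞ :=
  ⨆ x ∈ ntRegion n κ ω, ENNReal.ofReal ‖f x‖

/-- `f` has the non-tangential limit `L` at `ω`. -/
def HasNTLimit (n : ℕ) (κ : ℝ) (f : Vec n → Vec n) (ω L : Vec n) : Prop :=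
  Filter.Tendsto f (𝓝[ntRegion n κ ω] ω) (𝓝 L)

/-- The `p`-th mean of `f` on the sphere of radius `r`. -/
def hardyMean (n : ℕ) (p : ℝ) (f : Vec n → Vec n) (r : ℝ) : ℝ≥0∞ :=
  (sphMeasure n (unitSphere n))⁻¹ *
    ∫⁻ ω, ENNReal.ofReal (‖f (r • ω)‖ ^ p) ∂(sphMeasure n)

/-- The Hardy `H^p` norm of `f` on the unit ball. -/
def hardyNorm (n : ℕ) (p : ℝ) (f : Vec n → Vec n) : ℝ≥0∞ :=
  (⨆ r ∈ Set.Ioo (0 : ℝ) 1, hardyMean n p f r) ^ (1 / p)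

/-- `f` belongs to the Hardy space `H^p`. -/
def MemHp (n : ℕ) (p : ℝ) (f : Vec n → Vec n) : Prop := hardyNorm n p f < ⊤

/-- The `L^p(σ)` norm of a boundary function on the unit sphere. -/
def lpSphere (n : ℕ) (p : ℝ) (g : Vec n → Vec n) : ℝ≥0∞ :=
  (∫⁻ ω, ENNReal.ofReal (‖g ω‖ ^ p) ∂(sphMeasure n)) ^ (1 / p)

/-- The `L^p(σ)` norm of the non-tangential maximal function `f*`. -/
def ntMaxLp (n : ℕ) (κ p : ℝ) (f : Vec n → Vec n) : ℝ≥0∞ :=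
  (∫⁻ ω, (ntMax n κ f ω) ^ p ∂(sphMeasure n)) ^ (1 / p)

/-- `μ` is a Carleson measure on the unit ball with constant `c`. -/
def IsCarleson (n : ℕ) (c : ℝ) (μ : Measure (Vec n)) : Prop :=
  ∀ ω ∈ unitSphere n, ∀ r : ℝ, 0 < r →
    μ (unitBall n ∩ Metric.ball ω r) ≤ ENNReal.ofReal c * ENNReal.ofReal r ^ ((n : ℝ) - 1)

/-- `μ` is an `α`-Carleson measure on the unit ball with constant `γ`. -/
def IsAlphaCarleson (n : ℕ) (α γ : ℝ) (μ : Measure (Vec n)) : Prop :=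
  ∀ ω ∈ unitSphere n, ∀ r : ℝ, 0 < r →
    μ (unitBall n ∩ Metric.ball ω r) ≤
      ENNReal.ofReal γ * ENNReal.ofReal r ^ (α * ((n : ℝ) - 1))

open scoped Convolution in
theorem hasFDerivAt_normed_convolution {E V : Type*} [NormedAddCommGroup E] [NormedSpace ℝ E]
    [FiniteDimensional ℝ E] [MeasurableSpace E] [BorelSpace E] {μ : Measure E}
    [μ.IsAddHaarMeasure] [NormedAddCommGroup V]
    [NormedSpace ℝ V] [CompleteSpace V] (φ : ContDiffBump (0 : E)) {F : E → V}
    (hF : Differentiable ℝ F) (hi : Integrable (fderiv ℝ F) μ) (x : E) :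
    HasFDerivAt (φ.normed μ ⋆[ContinuousLinearMap.lsmul ℝ ℝ, μ] F)
      ((φ.normed μ ⋆[ContinuousLinearMap.lsmul ℝ ℝ, μ] fderiv ℝ F) x) x := by
  have hφc : HasCompactSupport (φ.normed μ) := φ.hasCompactSupport_normed
  have hφs : ContDiff ℝ 1 (φ.normed μ) := φ.contDiff_normed
  have h := hφc.hasFDerivAt_convolution_left (ContinuousLinearMap.lsmul ℝ ℝ) hφs
    (hF.continuous.locallyIntegrable (μ := μ)) x
  convert h using 1
  refine ContinuousLinearMap.ext fun v => ?_
  set ψ : E → ℝ := φ.normed μ with hψ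
  have hFx : ∀ t, HasFDerivAt (fun t => F (x - t)) (-(fderiv ℝ F (x - t))) t := by
    intro t
    have := (hF (x - t)).hasFDerivAt.comp t ((hasFDerivAt_id t).const_sub x)
    simpa [Function.comp_def] using this
  have hi' : Integrable (fun t => fderiv ℝ F (x - t)) μ := hi.comp_sub_left x
  have hψ' : Continuous (fderiv ℝ ψ) := hφs.continuous_fderiv one_ne_zero
  have hψ'c : HasCompactSupport (fderiv ℝ ψ) := hφc.fderiv ℝ
  have hFc : Continuous fun t => F (x - t) := hF.continuous.comp (by fun_prop)
  have h_int : Integrable (fun t => ψ t • fderiv ℝ F (x - t)) μ := by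
    obtain ⟨C, hC⟩ := hφc.exists_bound_of_continuous hφs.continuous
    exact hi'.bdd_smul C hφs.continuous.aestronglyMeasurable (Eventually.of_forall hC)
  have h_int2 : Integrable (fun t => (ContinuousLinearMap.precompL (E)
      (ContinuousLinearMap.lsmul ℝ ℝ : ℝ →L[ℝ] V →L[ℝ] V)) (fderiv ℝ ψ t) (F (x - t))) μ := by
    apply Continuous.integrable_of_hasCompactSupport
    · exact ((ContinuousLinearMap.precompL E _).continuous.comp hψ').clm_apply hFc
    · exact hψ'c.mono' (fun t ht => subset_closure (by
        contrapose! ht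
        simp only [Function.mem_support, not_not] at ht
        simp [ht]))
  have key := integral_smul_fderiv_eq_neg_fderiv_smul_of_integrable (μ := μ)
    (f := ψ) (g := fun t => F (x - t)) (v := v)
    (by
      apply Continuous.integrable_of_hasCompactSupport
      · exact (hψ'.clm_apply continuous_const).smul hFc
      · exact hψ'c.mono' (fun t ht => subset_closure (by
          contrapose! ht
          simp only [Function.mem_support, not_not] at ht
          simp [ht])))
    (by
      simp_rw [fun t => (hFx t).fderiv]
      have := (h_int.apply_continuousLinearMap v).neg
      simpa using this)
    (by
      apply Continuous.integrable_of_hasCompactSupport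
      · exact hφs.continuous.smul hFc
      · exact hφc.smul_right)
    (fun t _ => hφs.differentiable one_ne_zero t)
    (fun t _ => (hFx t).differentiableAt)
  simp_rw [fun t => (hFx t).fderiv] at key
  rw [convolution_def, convolution_def]
  rw [ContinuousLinearMap.integral_apply h_int2,
    ContinuousLinearMap.integral_apply (by exact h_int)]
  simpa [integral_neg] using key

theorem pow_add_mul_pow_sub_le {a g : ℝ} (ha : 0 ≤ a) (hg : 0 ≤ g) {p : ℕ} (hp : 1 ≤ p) :
    a ^ p + p * a ^ (p - 1) * (g - a) ≤ g ^ p := by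
  obtain ⟨q, rfl⟩ := Nat.exists_eq_add_of_le' hp
  rcases ha.eq_or_lt with rfl | ha
  · rcases q with _ | q <;> simp [pow_nonneg hg]
  · have h := one_add_mul_le_pow (a := g / a - 1) (by have := div_nonneg hg ha.le; linarith) (q + 1)
    have h2 : g ^ (q + 1) = a ^ (q + 1) * (1 + (g / a - 1)) ^ (q + 1) := by
      rw [← mul_pow]; congr 1; field_simp; ring
    rw [h2]
    calc _ = a ^ (q + 1) * (1 + ((q + 1 : ℕ) : ℝ) * (g / a - 1)) := by
          simp only [Nat.add_sub_cancel]; field_simp; ring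
      _ ≤ _ := by gcongr

open scoped Convolution in
theorem norm_normed_convolution_pow_le {E V : Type*} [NormedAddCommGroup E] [NormedSpace ℝ E]
    [FiniteDimensional ℝ E] [MeasurableSpace E] [BorelSpace E] {μ : Measure E}
    [μ.IsAddHaarMeasure] [NormedAddCommGroup V]
    [NormedSpace ℝ V] [CompleteSpace V] (φ : ContDiffBump (0 : E)) {g : E → V}
    {p : ℕ} (hp : 1 ≤ p) (hg : Integrable g μ) (hgp : Integrable (fun x => ‖g x‖ ^ p) μ) (x : E) :
    ‖(φ.normed μ ⋆[ContinuousLinearMap.lsmul ℝ ℝ, μ] g) x‖ ^ p ≤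
      (φ.normed μ ⋆[ContinuousLinearMap.lsmul ℝ ℝ, μ] fun y => ‖g y‖ ^ p) x := by
  have hφc : HasCompactSupport (φ.normed μ) := φ.hasCompactSupport_normed
  have hφs : ContDiff ℝ 1 (φ.normed μ) := φ.contDiff_normed
  obtain ⟨C, hC⟩ := hφc.exists_bound_of_continuous hφs.continuous
  have hb : ∀ {h : E → ℝ}, Integrable h μ →
      Integrable (fun t => φ.normed μ t * h (x - t)) μ := fun {h} hh =>
    (hh.comp_sub_left x).bdd_mul hφs.continuous.aestronglyMeasurable (Eventually.of_forall hC)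
  set ψ : E → ℝ := φ.normed μ with hψ
  have hψ0 : ∀ t, 0 ≤ ψ t := φ.nonneg_normed
  have hψi : Integrable ψ μ := hφs.continuous.integrable_of_hasCompactSupport hφc
  have hψ1 : ∫ t, ψ t ∂μ = 1 := φ.integral_normed
  set a := ∫ t, ψ t * ‖g (x - t)‖ ∂μ with ha
  have ha0 : 0 ≤ a := integral_nonneg fun t => mul_nonneg (hψ0 t) (norm_nonneg _)
  have h1 : ‖(ψ ⋆[ContinuousLinearMap.lsmul ℝ ℝ, μ] g) x‖ ≤ a := by
    rw [convolution_def]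
    refine (norm_integral_le_integral_norm _).trans (le_of_eq ?_)
    simp [norm_smul, abs_of_nonneg (hψ0 _), ha]
  refine (pow_le_pow_left₀ (norm_nonneg _) h1 p).trans ?_
  have hi1 : Integrable (fun t => ψ t * ‖g (x - t)‖) μ := hb hg.norm
  have hi2 : Integrable (fun t => ψ t * ‖g (x - t)‖ ^ p) μ := hb hgp
  have h2 : ∫ t, (ψ t * a ^ p + p * a ^ (p - 1) * (ψ t * ‖g (x - t)‖ - ψ t * a)) ∂μ ≤
      ∫ t, ψ t * ‖g (x - t)‖ ^ p ∂μ := by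
    refine integral_mono ((hψi.mul_const _).add ((hi1.sub (hψi.mul_const _)).const_mul _)) hi2 ?_
    intro t
    have := mul_le_mul_of_nonneg_left
      (pow_add_mul_pow_sub_le ha0 (norm_nonneg (g (x - t))) hp) (hψ0 t)
    simp only
    linarith
  rw [integral_add (hψi.mul_const _) (by exact (hi1.sub (hψi.mul_const _)).const_mul _),
    integral_const_mul, integral_sub hi1 (hψi.mul_const _), integral_mul_const, integral_mul_const,
    hψ1, ← ha] at h2
  rw [convolution_def]
  simpa using h2

theorem integrable_of_integrable_norm_pow {E V : Type*} [NormedAddCommGroup E] [NormedSpace ℝ E]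
    [FiniteDimensional ℝ E] [MeasurableSpace E] [BorelSpace E] {μ : Measure E}
    [μ.IsAddHaarMeasure] [NormedAddCommGroup V]
    {g : E → V} (hg : AEStronglyMeasurable g μ) (hc : HasCompactSupport g) {p : ℕ} (hp : 1 ≤ p)
    (hgp : Integrable (fun x => ‖g x‖ ^ p) μ) : Integrable g μ := by
  have hK : Integrable ((tsupport g).indicator fun _ => (1 : ℝ)) μ :=
    (integrable_indicator_iff (isClosed_tsupport g).measurableSet).2
      (integrableOn_const hc.measure_lt_top.ne)
  refine (hK.add hgp).mono' hg (Eventually.of_forall fun x => ?_)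
  by_cases hx : x ∈ tsupport g
  · simp only [Pi.add_apply, indicator_of_mem hx]
    rcases le_total ‖g x‖ 1 with h | h
    · have := pow_nonneg (norm_nonneg (g x)) p
      linarith
    · have := le_self_pow₀ h (by omega : p ≠ 0)
      linarith
  · rw [image_eq_zero_of_notMem_tsupport hx]
    simp [indicator_of_notMem hx]

open scoped Convolution in
/-- Mollification of a compactly supported, everywhere differentiable map whose derivative lies in
`L^p`: the derivatives converge a.e. and are dominated by a sequence with convergent integrals. -/
theorem exists_smooth_approx {E V : Type*} [NormedAddCommGroup E] [NormedSpace ℝ E]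
    [FiniteDimensional ℝ E] [MeasurableSpace E] [BorelSpace E] {μ : Measure E}
    [μ.IsAddHaarMeasure] [NormedAddCommGroup V]
    [NormedSpace ℝ V] [FiniteDimensional ℝ V] {F : E → V}
    (hF : Differentiable ℝ F) (hc : HasCompactSupport F) {p : ℕ} (hp : 1 ≤ p)
    (hi : Integrable (fun x => ‖fderiv ℝ F x‖ ^ p) μ) :
    ∃ (Fs : ℕ → E → V) (G : ℕ → E → ℝ),
      (∀ k, ContDiff ℝ 1 (Fs k)) ∧ (∀ k, HasCompactSupport (Fs k)) ∧
      (∀ x, Tendsto (fun k => Fs k x) atTop (𝓝 (F x))) ∧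
      (∀ᵐ x ∂μ, Tendsto (fun k => fderiv ℝ (Fs k) x) atTop (𝓝 (fderiv ℝ F x))) ∧
      (∀ k x, ‖fderiv ℝ (Fs k) x‖ ^ p ≤ G k x) ∧
      (∀ k, Integrable (G k) μ) ∧
      (∀ᵐ x ∂μ, Tendsto (fun k => G k x) atTop (𝓝 (‖fderiv ℝ F x‖ ^ p))) ∧
      (∀ k, ∫ x, G k x ∂μ = ∫ x, ‖fderiv ℝ F x‖ ^ p ∂μ) := by
  have hcV : CompleteSpace V := FiniteDimensional.complete ℝ V
  have hmeas : AEStronglyMeasurable (fderiv ℝ F) μ := by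
    borelize V
    borelize (E →L[ℝ] V)
    exact (measurable_fderiv ℝ F).aestronglyMeasurable
  have hD : Integrable (fderiv ℝ F) μ :=
    integrable_of_integrable_norm_pow hmeas (hc.fderiv ℝ) hp hi
  let φ : ℕ → ContDiffBump (0 : E) := fun k =>
    ⟨1 / ((k : ℝ) + 1), 2 * (1 / ((k : ℝ) + 1)), by positivity, by
      have : (0 : ℝ) < 1 / ((k : ℝ) + 1) := by positivity
      linarith⟩
  have hφ : Tendsto (fun k => (φ k).rOut) atTop (𝓝 0) := by
    have := (tendsto_one_div_add_atTop_nhds_zero_nat (𝕜 := ℝ)).const_mul 2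
    rw [mul_zero] at this
    exact this
  have hφ' : ∀ᶠ k in atTop, (φ k).rOut ≤ 2 * (φ k).rIn := Eventually.of_forall fun k => le_rfl
  have hφs : ∀ k, ContDiff ℝ 1 ((φ k).normed μ) :=
    fun k => (φ k).contDiff_normed
  have hφc : ∀ k, HasCompactSupport ((φ k).normed μ) :=
    fun k => (φ k).hasCompactSupport_normed
  refine ⟨fun k => (φ k).normed μ ⋆[ContinuousLinearMap.lsmul ℝ ℝ, μ] F,
    fun k => (φ k).normed μ ⋆[ContinuousLinearMap.lsmul ℝ ℝ, μ] fun y => ‖fderiv ℝ F y‖ ^ p,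
    ?_, ?_, ?_, ?_, ?_, ?_, ?_, ?_⟩
  · exact fun k => (hφc k).contDiff_convolution_left _ (hφs k) hF.continuous.locallyIntegrable
  · exact fun k => HasCompactSupport.convolution _ (hφc k) hc
  · exact fun x => ContDiffBump.convolution_tendsto_right_of_continuous hφ hF.continuous x
  · filter_upwards [ContDiffBump.ae_convolution_tendsto_right_of_locallyIntegrable hφ hφ'
      hD.locallyIntegrable] with x hx
    refine hx.congr fun k => ?_
    exact ((hasFDerivAt_normed_convolution (φ k) hF hD x).fderiv).symm
  · intro k x
    rw [(hasFDerivAt_normed_convolution (φ k) hF hD x).fderiv]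
    exact norm_normed_convolution_pow_le (φ k) hp hD hi x
  · exact fun k =>
      ((hφs k).continuous.integrable_of_hasCompactSupport (hφc k)).integrable_convolution _ hi
  · exact ContDiffBump.ae_convolution_tendsto_right_of_locallyIntegrable hφ hφ'
      hi.locallyIntegrable
  · intro k
    rw [integral_convolution _ ((hφs k).continuous.integrable_of_hasCompactSupport (hφc k)) hi]
    simp [(φ k).integral_normed]

theorem coeff_weight_sum_eq_det {E : Type*} [NormedAddCommGroup E] [NormedSpace ℝ E]
    [FiniteDimensional ℝ E] {v : ℕ → ℝ} (hv : Function.Injective v) (A : E →L[ℝ] E) :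
    A.det = ∑ i ∈ Finset.range (Module.finrank ℝ E + 1),
      (∏ j ∈ (Finset.range (Module.finrank ℝ E + 1)).erase i, (v i - v j))⁻¹ *
        (ContinuousLinearMap.id ℝ E + v i • A).det := by
  let b := Module.finBasis ℝ E
  set M := LinearMap.toMatrix b b (A : E →ₗ[ℝ] E) with hM
  let P : Polynomial ℝ := Matrix.det ((Polynomial.X : Polynomial ℝ) • M.map Polynomial.C +
    (1 : Matrix (Fin (Module.finrank ℝ E)) (Fin (Module.finrank ℝ E)) ℝ).map Polynomial.C)
  have hdeg : P.degree < ((Finset.range (Module.finrank ℝ E + 1)).card : WithBot ℕ) := by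
    have := Polynomial.natDegree_det_X_add_C_le M 1
    rw [Fintype.card_fin] at this
    refine (Polynomial.degree_le_of_natDegree_le this).trans_lt ?_
    rw [Finset.card_range]
    exact_mod_cast Nat.lt_succ_self _
  have hcoef := Lagrange.coeff_eq_sum (s := Finset.range (Module.finrank ℝ E + 1)) (v := v)
    hv.injOn hdeg
  have h1 : P.coeff ((Finset.range (Module.finrank ℝ E + 1)).card - 1) = M.det := by
    rw [Finset.card_range, Nat.add_sub_cancel]
    have := Polynomial.coeff_det_X_add_C_card M 1
    rwa [Fintype.card_fin] at this
  have h2 : A.det = M.det := (LinearMap.det_toMatrix b _).symm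
  have h3 : ∀ t, P.eval t = (ContinuousLinearMap.id ℝ E + t • A).det := by
    intro t
    have : (ContinuousLinearMap.id ℝ E + t • A).det = Matrix.det (1 + t • M) := by
      rw [ContinuousLinearMap.det, ← LinearMap.det_toMatrix b]
      congr 1
      rw [ContinuousLinearMap.toLinearMap_add, ContinuousLinearMap.toLinearMap_smul, map_add,
        map_smul]
      congr 1
      exact LinearMap.toMatrix_id b
    rw [this, ← Polynomial.coe_evalRingHom, RingHom.map_det]
    congr 1
    ext i j
    simp [Matrix.map_apply, Matrix.one_apply, add_comm]
    split_ifs <;> simp [mul_comm]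
  rw [h2, ← h1, hcoef]
  refine Finset.sum_congr rfl fun i _ => ?_
  rw [h3, div_eq_inv_mul]

theorem image_id_add_smul_eq {E : Type*} [NormedAddCommGroup E] [NormedSpace ℝ E]
    [CompleteSpace E] {F : E → E} {L : ℝ≥0} (hL : LipschitzWith L F) {t : ℝ}
    (ht : |t| * L < 1) {S : Set E} (hS : ∀ x ∉ S, F x = 0) :
    Function.Injective (fun x => x + t • F x) ∧ (fun x => x + t • F x) '' S = S := by
  have hinj : Function.Injective (fun x => x + t • F x) := by
    intro x y hxy
    by_contra hne
    have h1 : x - y = t • (F y - F x) := by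
      have : x + t • F x = y + t • F y := hxy
      rw [smul_sub, sub_eq_sub_iff_add_eq_add, this, add_comm]
    have h2 : ‖x - y‖ ≤ |t| * (L * ‖x - y‖) := by
      calc ‖x - y‖ = |t| * ‖F y - F x‖ := by rw [h1, norm_smul, Real.norm_eq_abs]
        _ ≤ _ := by
          gcongr
          rw [norm_sub_rev]
          exact hL.norm_sub_le x y
    have h3 : 0 < ‖x - y‖ := norm_pos_iff.2 (sub_ne_zero.2 hne)
    nlinarith
  have hsurj : Function.Surjective (fun x => x + t • F x) := by
    intro y
    have hc : ContractingWith ⟨|t| * L, by positivity⟩ (fun x => y - t • F x) := by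
      refine ⟨by exact_mod_cast ht, LipschitzWith.of_dist_le_mul fun a b => ?_⟩
      rw [dist_eq_norm, dist_eq_norm]
      have : y - t • F a - (y - t • F b) = t • (F b - F a) := by rw [smul_sub]; abel
      rw [this, norm_smul, Real.norm_eq_abs, norm_sub_rev]
      have := hL.norm_sub_le a b
      calc |t| * ‖F a - F b‖ ≤ |t| * (L * ‖a - b‖) := by gcongr
        _ = |t| * L * ‖a - b‖ := by ring
    refine ⟨hc.fixedPoint, ?_⟩
    have := hc.fixedPoint_isFixedPt
    simp only [Function.IsFixedPt] at this
    exact eq_sub_iff_add_eq.1 this.symm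
  refine ⟨hinj, ?_⟩
  have hid : ∀ x ∉ S, x + t • F x = x := fun x hx => by rw [hS x hx, smul_zero, add_zero]
  ext y
  constructor
  · rintro ⟨x, hx, rfl⟩
    by_contra hy
    have := hid _ hy
    exact hy (by rw [hinj this]; exact hx)
  · intro hy
    obtain ⟨x, rfl⟩ := hsurj y
    refine ⟨x, ?_, rfl⟩
    by_contra hx
    have := hid x hx
    simp only at hy
    rw [this] at hy
    exact hx hy

/-- The Jacobian determinant of a compactly supported `C¹` map has vanishing integral. -/
theorem integral_det_fderiv_eq_zero_of_contDiff {E : Type*} [NormedAddCommGroup E]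
    [NormedSpace ℝ E] [FiniteDimensional ℝ E] [MeasurableSpace E] [BorelSpace E] {μ : Measure E}
    [μ.IsAddHaarMeasure] (hE : 1 ≤ Module.finrank ℝ E) {F : E → E} (hF : ContDiff ℝ 1 F)
    (hc : HasCompactSupport F) : ∫ x, (fderiv ℝ F x).det ∂μ = 0 := by
  have hcE : CompleteSpace E := FiniteDimensional.complete ℝ E
  obtain ⟨L, hL⟩ := hF.lipschitzWith_of_hasCompactSupport hc one_ne_zero
  obtain ⟨R, hR⟩ := hc.isCompact.isBounded.subset_closedBall (0 : E)
  set S := closedBall (0 : E) R with hSdef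
  have hS : ∀ x ∉ S, F x = 0 := fun x hx => image_eq_zero_of_notMem_tsupport fun h => hx (hR h)
  have hSd : ∀ x ∉ S, (fderiv ℝ F x).det = 0 := by
    intro x hx
    have : fderiv ℝ F x = 0 := by
      by_contra h
      exact hx (hR (support_fderiv_subset ℝ h))
    rw [this, ContinuousLinearMap.det, ContinuousLinearMap.toLinearMap_zero, LinearMap.det_zero]
    exact zero_pow (by omega)
  have hdet : ∀ᶠ B in 𝓝 (ContinuousLinearMap.id ℝ E), 0 < B.det := by
    have h : Continuous fun B : E →L[ℝ] E => B.det := ContinuousLinearMap.continuous_det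
    refine (h.tendsto _).eventually_const_lt ?_
    simp [ContinuousLinearMap.det]
  obtain ⟨δ, hδ, hδB⟩ := Metric.eventually_nhds_iff.1 hdet
  have hD : ∀ x, ‖fderiv ℝ F x‖ ≤ L := fun x => norm_fderiv_le_of_lipschitz ℝ hL
  have hvol : ∀ t : ℝ, |t| * (L + 1) < min δ 1 →
      ∫ x in S, (ContinuousLinearMap.id ℝ E + t • fderiv ℝ F x).det ∂μ = μ.real S := by
    intro t ht
    have hL0 : (0 : ℝ) ≤ L := L.2
    have ht1 : |t| * L < 1 := by
      have := ht.trans_le (min_le_right _ _)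
      nlinarith [abs_nonneg t]
    have ht2 : |t| * L < δ := by
      have := ht.trans_le (min_le_left _ _)
      nlinarith [abs_nonneg t]
    obtain ⟨hinj, himg⟩ := image_id_add_smul_eq hL ht1 hS
    have hpos : ∀ x, 0 < (ContinuousLinearMap.id ℝ E + t • fderiv ℝ F x).det := by
      intro x
      apply hδB
      rw [dist_eq_norm, add_sub_cancel_left, norm_smul, Real.norm_eq_abs]
      exact (mul_le_mul_of_nonneg_left (hD x) (abs_nonneg t)).trans_lt ht2
    have hcv := integral_image_eq_integral_abs_det_fderiv_smul μ
      (f := fun x => x + t • F x) (s := S)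
      (f' := fun x => ContinuousLinearMap.id ℝ E + t • fderiv ℝ F x) measurableSet_closedBall
      (fun x _ => ((hasFDerivAt_id x).add
        ((hF.differentiable one_ne_zero x).hasFDerivAt.const_smul t)).hasFDerivWithinAt)
      hinj.injOn (fun _ => (1 : ℝ))
    rw [himg] at hcv
    simp only [smul_eq_mul, mul_one, abs_of_pos (hpos _)] at hcv
    rw [← hcv]
    simp [Measure.real]
  obtain ⟨η, hη, hηδ⟩ : ∃ η : ℝ, 0 < η ∧ η * (L + 1) < min δ 1 := by
    have hL0 : (0 : ℝ) ≤ L := L.2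
    refine ⟨min δ 1 / (2 * (L + 1)), by positivity, ?_⟩
    have : min δ 1 / (2 * (L + 1)) * (L + 1) = min δ 1 / 2 := by field_simp
    rw [this]
    exact half_lt_self (by positivity)
  let v : ℕ → ℝ := fun k => η / (k + 1)
  have hv : Function.Injective v := by
    intro a b hab
    simp only [v] at hab
    rw [div_eq_div_iff (by positivity) (by positivity)] at hab
    have := mul_left_cancel₀ hη.ne' hab
    exact_mod_cast (add_right_cancel this).symm
  have hvη : ∀ k, |v k| * (L + 1) < min δ 1 := by
    intro k
    refine lt_of_le_of_lt ?_ hηδ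
    have hL0 : (0 : ℝ) ≤ L := L.2
    gcongr
    rw [abs_of_pos (by positivity)]
    exact div_le_self hη.le (by linarith [Nat.cast_nonneg (α := ℝ) k])
  have hcont : Continuous (fderiv ℝ F) := hF.continuous_fderiv one_ne_zero
  have h_int : ∀ t : ℝ, IntegrableOn
      (fun x => (ContinuousLinearMap.id ℝ E + t • fderiv ℝ F x).det) S μ := fun t =>
    (ContinuousLinearMap.continuous_det.comp
      (continuous_const.add (hcont.const_smul t))).continuousOn.integrableOn_compact
      (isCompact_closedBall _ _)
  rw [← setIntegral_eq_integral_of_forall_compl_eq_zero hSd]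
  simp_rw [coeff_weight_sum_eq_det hv (fderiv ℝ F _)]
  rw [integral_finsetSum _ fun i _ => (h_int _).const_mul _]
  simp_rw [integral_const_mul]
  rw [Finset.sum_congr rfl fun i _ => by rw [hvol _ (hvη i)]]
  rw [← Finset.sum_mul]
  have hz := coeff_weight_sum_eq_det hv (0 : E →L[ℝ] E)
  have h0 : (0 : E →L[ℝ] E).det = 0 := by
    rw [ContinuousLinearMap.det, ContinuousLinearMap.toLinearMap_zero, LinearMap.det_zero]
    exact zero_pow (by omega)
  have h1 : (ContinuousLinearMap.id ℝ E).det = 1 := by simp [ContinuousLinearMap.det]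
  simp only [smul_zero, add_zero, h1, mul_one, h0] at hz
  rw [← hz, zero_mul]

theorem abs_det_le_norm_pow {E : Type*} [NormedAddCommGroup E] [NormedSpace ℝ E]
    [FiniteDimensional ℝ E] (A : E →L[ℝ] E) : |A.det| ≤ ‖A‖ ^ Module.finrank ℝ E := by
  borelize E
  let μ : Measure E := Measure.addHaar
  have h := μ.addHaar_image_continuousLinearMap A (closedBall (0 : E) 1)
  have hsub : A '' closedBall (0 : E) 1 ⊆ closedBall (0 : E) ‖A‖ := by
    rintro _ ⟨x, hx, rfl⟩
    rw [mem_closedBall_zero_iff] at hx ⊢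
    exact (A.le_opNorm x).trans (mul_le_of_le_one_right (norm_nonneg _) hx)
  have h2 := measure_mono (μ := μ) hsub
  rw [h, Measure.addHaar_closedBall _ _ (norm_nonneg _),
    Measure.addHaar_closedBall _ _ zero_le_one, one_pow, ENNReal.ofReal_one, one_mul] at h2
  have h3 : μ (ball (0 : E) 1) ≠ 0 := (measure_ball_pos μ _ one_pos).ne'
  rw [ENNReal.mul_le_mul_iff_left h3 measure_ball_lt_top.ne] at h2
  exact (ENNReal.ofReal_le_ofReal_iff (by positivity)).1 h2

theorem integral_nonpos_of_dominated {α : Type*} [MeasurableSpace α] {μ : Measure α}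
    {f : ℕ → α → ℝ} {g : α → ℝ} {G : ℕ → α → ℝ} {f' : α → ℝ}
    (hf : ∀ k, Integrable (f k) μ) (hG : ∀ k, Integrable (G k) μ) (hf' : Integrable f' μ)
    (hg : Integrable g μ) (hfG : ∀ k x, |f k x| ≤ G k x)
    (hlim : ∀ᵐ x ∂μ, Tendsto (fun k => f k x) atTop (𝓝 (f' x)))
    (hlimG : ∀ᵐ x ∂μ, Tendsto (fun k => G k x) atTop (𝓝 (g x)))
    (hGi : ∀ k, ∫ x, G k x ∂μ = ∫ x, g x ∂μ) (hfi : ∀ k, ∫ x, f k x ∂μ = 0) :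
    ∫ x, f' x ∂μ ≤ 0 := by
  have hnn : ∀ k x, 0 ≤ G k x + f k x := fun k x => by
    have := (abs_le.1 (hfG k x)).1
    linarith
  have hnn' : ∀ᵐ x ∂μ, 0 ≤ g x + f' x := by
    filter_upwards [hlim, hlimG] with x h1 h2
    exact ge_of_tendsto' (h2.add h1) fun k => hnn k x
  have hg0 : 0 ≤ ∫ x, g x ∂μ := by
    rw [← hGi 0]
    exact integral_nonneg fun x => (abs_nonneg _).trans (hfG 0 x)
  have hF : ∫⁻ x, ENNReal.ofReal (g x + f' x) ∂μ ≤ ENNReal.ofReal (∫ x, g x ∂μ) := by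
    calc ∫⁻ x, ENNReal.ofReal (g x + f' x) ∂μ
        = ∫⁻ x, liminf (fun k => ENNReal.ofReal (G k x + f k x)) atTop ∂μ := by
          refine lintegral_congr_ae ?_
          filter_upwards [hlim, hlimG] with x h1 h2
          exact ((ENNReal.continuous_ofReal.tendsto _).comp (h2.add h1)).liminf_eq.symm
      _ ≤ liminf (fun k => ∫⁻ x, ENNReal.ofReal (G k x + f k x) ∂μ) atTop :=
          lintegral_liminf_le' fun k => ((hG k).add (hf k)).aemeasurable.ennreal_ofReal
      _ = liminf (fun _ : ℕ => ENNReal.ofReal (∫ x, g x ∂μ)) atTop := by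
          congr 1
          funext k
          have hGk : Integrable (fun x => G k x + f k x) μ := (hG k).add (hf k)
          rw [← ofReal_integral_eq_lintegral_ofReal hGk
            (Eventually.of_forall (hnn k)), integral_add (hG k) (hf k), hGi, hfi, add_zero]
      _ = _ := by simp
  have hgf : Integrable (fun x => g x + f' x) μ := hg.add hf'
  rw [← ofReal_integral_eq_lintegral_ofReal hgf hnn', ENNReal.ofReal_le_ofReal_iff hg0,
    integral_add hg hf'] at hF
  linarith

theorem integrable_det_fderiv {E : Type*} [NormedAddCommGroup E]
    [NormedSpace ℝ E] [FiniteDimensional ℝ E] [MeasurableSpace E] [BorelSpace E] {μ : Measure E}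
    {F : E → E} (hi : Integrable (fun x => ‖fderiv ℝ F x‖ ^ Module.finrank ℝ E) μ) :
    Integrable (fun x => (fderiv ℝ F x).det) μ := by
  have hcE : CompleteSpace E := FiniteDimensional.complete ℝ E
  refine hi.mono' ?_ (Eventually.of_forall fun x => abs_det_le_norm_pow _)
  exact (ContinuousLinearMap.continuous_det.measurable.comp
    (measurable_fderiv ℝ F)).aestronglyMeasurable

/-- The Jacobian determinant of a compactly supported, everywhere differentiable map with
derivative in `L^n` has vanishing integral. -/
theorem integral_det_fderiv_eq_zero {E : Type*} [NormedAddCommGroup E]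
    [NormedSpace ℝ E] [FiniteDimensional ℝ E] [MeasurableSpace E] [BorelSpace E] {μ : Measure E}
    [μ.IsAddHaarMeasure] (hE : 1 ≤ Module.finrank ℝ E) {F : E → E} (hF : Differentiable ℝ F)
    (hc : HasCompactSupport F)
    (hi : Integrable (fun x => ‖fderiv ℝ F x‖ ^ Module.finrank ℝ E) μ) :
    ∫ x, (fderiv ℝ F x).det ∂μ = 0 := by
  have hcE : CompleteSpace E := FiniteDimensional.complete ℝ E
  obtain ⟨Fs, G, hFs, hFsc, -, hD, hDG, hG, hGlim, hGi⟩ := exists_smooth_approx hF hc hE hi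
  have hfG : ∀ k x, |(fderiv ℝ (Fs k) x).det| ≤ G k x := fun k x =>
    (abs_det_le_norm_pow _).trans (hDG k x)
  have hf : ∀ k, Integrable (fun x => (fderiv ℝ (Fs k) x).det) μ := fun k =>
    (hG k).mono' (ContinuousLinearMap.continuous_det.measurable.comp
      (measurable_fderiv ℝ (Fs k))).aestronglyMeasurable (Eventually.of_forall (hfG k))
  have hf' := integrable_det_fderiv hi
  have hlim : ∀ᵐ x ∂μ, Tendsto (fun k => (fderiv ℝ (Fs k) x).det) atTop
      (𝓝 (fderiv ℝ F x).det) := by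
    filter_upwards [hD] with x hx
    exact (ContinuousLinearMap.continuous_det.tendsto _).comp hx
  have hz : ∀ k, ∫ x, (fderiv ℝ (Fs k) x).det ∂μ = 0 := fun k =>
    integral_det_fderiv_eq_zero_of_contDiff hE (hFs k) (hFsc k)
  apply le_antisymm
  · exact integral_nonpos_of_dominated hf hG hf' hi hfG hlim hGlim hGi hz
  · have := integral_nonpos_of_dominated (f := fun k x => -(fderiv ℝ (Fs k) x).det)
      (fun k => (hf k).neg) hG hf'.neg hi (fun k x => by rw [abs_neg]; exact hfG k x)
      (by filter_upwards [hlim] with x hx using hx.neg) hGlim hGi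
      (fun k => by rw [integral_neg, hz, neg_zero])
    simp only [Pi.neg_apply] at this
    rw [integral_neg] at this
    linarith

theorem exists_cutoff_of_isCompact {E : Type*} [NormedAddCommGroup E] [NormedSpace ℝ E]
    [FiniteDimensional ℝ E] {S U : Set E} (hS : IsCompact S) (hU : IsOpen U) (hSU : S ⊆ U) :
    ∃ χ : E → ℝ, ContDiff ℝ 1 χ ∧ HasCompactSupport χ ∧ tsupport χ ⊆ U ∧
      ∀ x ∈ S, ∀ᶠ y in 𝓝 x, χ y = 1 := by
  obtain ⟨L, hL, hSL, hLU⟩ := exists_compact_between hS hU hSU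
  obtain ⟨χ, h1, h2, -⟩ := exists_contMDiffMap_one_nhds_of_subset_interior
    (modelWithCornersSelf ℝ E) (n := 1) hS.isClosed hSL
  have hsub : tsupport χ ⊆ L := by
    refine closure_minimal (fun x hx => ?_) hL.isClosed
    by_contra hxL
    exact hx (h2 x hxL)
  refine ⟨χ, contMDiff_iff_contDiff.1 χ.contMDiff, HasCompactSupport.of_support_subset_isCompact hL
    (subset_closure.trans hsub), hsub.trans hLU, fun x hx => ?_⟩
  exact (eventually_nhdsSet_iff_forall.1 h1) x hx

theorem abs_det_updateRow_le {ι : Type*} [Fintype ι] [DecidableEq ι] (M : Matrix ι ι ℝ) (i : ι)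
    (v : ι → ℝ) {a m : ℝ} (hM : ∀ j k, |M j k| ≤ m) (hv : ∀ k, |v k| ≤ a) :
    |(M.updateRow i v).det| ≤ (Fintype.card ι).factorial * (a * m ^ (Fintype.card ι - 1)) := by
  rw [← Matrix.det_transpose, Matrix.det_apply]
  refine (Finset.abs_sum_le_sum_abs _ _).trans ?_
  have : ∀ σ ∈ (Finset.univ : Finset (Equiv.Perm ι)),
      |Equiv.Perm.sign σ • ∏ k, (M.updateRow i v).transpose (σ k) k| ≤
        a * m ^ (Fintype.card ι - 1) := by
    intro σ _
    have h1 : |Equiv.Perm.sign σ • ∏ k, (M.updateRow i v).transpose (σ k) k| =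
        ∏ k, |(M.updateRow i v).transpose (σ k) k| := by
      rw [← Finset.abs_prod]
      rcases Int.units_eq_one_or (Equiv.Perm.sign σ) with h | h <;> simp [h]
    rw [h1, ← Finset.mul_prod_erase _ _ (Finset.mem_univ i)]
    refine mul_le_mul ?_ ?_ (Finset.prod_nonneg fun _ _ => abs_nonneg _)
      ((abs_nonneg _).trans (hv i))
    · simpa using hv (σ i)
    · calc ∏ k ∈ Finset.univ.erase i, |(M.updateRow i v).transpose (σ k) k|
          ≤ ∏ k ∈ Finset.univ.erase i, m := by
            refine Finset.prod_le_prod (fun _ _ => abs_nonneg _) fun k hk => ?_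
            rw [Matrix.transpose_apply, Matrix.updateRow_ne (Finset.ne_of_mem_erase hk)]
            exact hM _ _
        _ = _ := by simp [Finset.card_erase_of_mem]
  refine (Finset.sum_le_sum this).trans ?_
  simp [Fintype.card_perm]

theorem IsCompact.integrable_of_le_norm_fderiv_pow {E V : Type*} [NormedAddCommGroup E]
    [NormedSpace ℝ E]
    [FiniteDimensional ℝ E] [MeasurableSpace E] [BorelSpace E] {μ : Measure E}
    [IsFiniteMeasureOnCompacts μ] [NormedAddCommGroup V] {f : E → E} {U S : Set E} {N : ℕ}
    (hf : LocallyIntegrableOn (fun x => ‖fderiv ℝ f x‖ ^ N) U μ) (hS : IsCompact S) (hSU : S ⊆ U)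
    {p : E → V} (hp : AEStronglyMeasurable p (μ.restrict S)) {a : ℝ}
    (hb : ∀ x ∈ S, ‖p x‖ ≤ a * (‖fderiv ℝ f x‖ ^ N + 1)) (h0 : ∀ x, x ∉ S → p x = 0) :
    Integrable p μ := by
  rw [← integrableOn_iff_integrable_of_support_subset (s := S)
    (fun x hx => by by_contra h; exact hx (h0 x h))]
  have h1 : IntegrableOn (fun x => a * (‖fderiv ℝ f x‖ ^ N + 1)) S μ := by
    refine Integrable.const_mul ?_ _
    exact (hf.integrableOn_compact_subset hSU hS).add
      (integrableOn_const (hs := hS.measure_lt_top.ne) (hC := by simp))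
  exact Integrable.mono' h1 hp ((ae_restrict_iff' hS.measurableSet).2 (Eventually.of_forall hb))

theorem add_add_pow_le {a b c : ℝ} (ha : 0 ≤ a) (hb : 0 ≤ b) (hc : 0 ≤ c) (N : ℕ) :
    (a + b + c) ^ N ≤ 3 ^ N * (a ^ N + b ^ N + c ^ N) := by
  have hm : a + b + c ≤ 3 * max a (max b c) := by
    have h1 := le_max_left a (max b c)
    have h2 := (le_max_left b c).trans (le_max_right a _)
    have h3 := (le_max_right b c).trans (le_max_right a _)
    linarith
  refine (pow_le_pow_left₀ (by positivity) hm N).trans ?_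
  rw [mul_pow]
  refine mul_le_mul_of_nonneg_left ?_ (by positivity)
  have := pow_nonneg ha N
  have := pow_nonneg hb N
  have := pow_nonneg hc N
  rcases max_choice a (max b c) with h | h
  · rw [h]; linarith
  · rw [h]
    rcases max_choice b c with h | h <;> rw [h] <;> linarith

/-- Replacing one row of the Jacobian matrix by the gradient of a compactly supported function
produces a determinant of vanishing integral. -/
theorem integral_det_updateRow_eq_zero {E : Type*} [NormedAddCommGroup E]
    [NormedSpace ℝ E] [FiniteDimensional ℝ E] [MeasurableSpace E] [BorelSpace E] {μ : Measure E}
    [μ.IsAddHaarMeasure] (hE : 1 ≤ Module.finrank ℝ E) {ι : Type*} [Fintype ι] [DecidableEq ι]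
    (b : Module.Basis ι ℝ E) {f : E → E} {U : Set E} (hU : IsOpen U) (hf : DifferentiableOn ℝ f U)
    (hi : LocallyIntegrableOn (fun x => ‖fderiv ℝ f x‖ ^ Module.finrank ℝ E) U μ)
    {g : E → ℝ} (hg : Differentiable ℝ g) (hgc : HasCompactSupport g) (hgU : tsupport g ⊆ U)
    (hgi : Integrable (fun x => ‖fderiv ℝ g x‖ ^ Module.finrank ℝ E) μ) (i : ι) :
    ∫ x, ((LinearMap.toMatrix b b (fderiv ℝ f x : E →ₗ[ℝ] E)).updateRow i
      (fun j => fderiv ℝ g x (b j))).det ∂μ = 0 := by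
  have hcE : CompleteSpace E := FiniteDimensional.complete ℝ E
  obtain ⟨χ, hχ, hχc, hχU, hχ1⟩ := exists_cutoff_of_isCompact hgc hU hgU
  set N := Module.finrank ℝ E
  let P : E →L[ℝ] E := ContinuousLinearMap.id ℝ E -
    (LinearMap.toContinuousLinearMap (b.coord i)).smulRight (b i)
  have hP : ∀ v j, b.repr (P v) j = if j = i then 0 else b.repr v j := by
    intro v j
    simp only [P, _root_.sub_apply, ContinuousLinearMap.coe_id', id_eq,
      ContinuousLinearMap.smulRight_apply, LinearMap.coe_toContinuousLinearMap', map_sub, map_smul,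
      Module.Basis.repr_self, Finsupp.sub_apply, Finsupp.smul_apply, smul_eq_mul,
      Module.Basis.coord_apply]
    by_cases h : j = i
    · simp [h]
    · simp [h]
  let F : E → E := fun x => P (χ x • f x) + g x • b i
  have hχd : Differentiable ℝ χ := hχ.differentiable one_ne_zero
  have hχf : Differentiable ℝ (fun x => χ x • f x) := by
    intro x
    by_cases hx : x ∈ tsupport χ
    · exact (hχd x).smul ((hf x (hχU hx)).differentiableAt (hU.mem_nhds (hχU hx)))
    · have h0 : (fun x => χ x • f x) =ᶠ[𝓝 x] fun _ => 0 := by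
        filter_upwards [notMem_tsupport_iff_eventuallyEq.1 hx] with y hy
        simp [hy]
      exact (differentiableAt_const 0).congr_of_eventuallyEq h0
  have hFd : Differentiable ℝ F := fun x =>
    (P.differentiableAt.comp x (hχf x)).add ((hg x).smul_const (b i))
  have hFD : ∀ x, fderiv ℝ F x =
      P ∘L fderiv ℝ (fun x => χ x • f x) x + (fderiv ℝ g x).smulRight (b i) := by
    intro x
    exact ((P.hasFDerivAt.comp x (hχf x).hasFDerivAt).add
      ((hg x).hasFDerivAt.smul_const (b i))).fderiv
  have hχf0 : HasCompactSupport (fun x => χ x • f x) := hχc.smul_right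
  have hFc : HasCompactSupport F := by
    refine HasCompactSupport.add (hχf0.comp_left (g := P) (map_zero P)) ?_
    exact hgc.smul_right
  have hχfi : Integrable (fun x => ‖fderiv ℝ (fun x => χ x • f x) x‖ ^ N) μ := by
    obtain ⟨a₁, ha₁⟩ := hχc.isCompact.exists_bound_of_continuousOn
      (hf.continuousOn.mono hχU)
    obtain ⟨a₂, ha₂⟩ := hχc.isCompact.exists_bound_of_continuousOn hχ.continuous.continuousOn
    obtain ⟨a₃, ha₃⟩ := hχc.isCompact.exists_bound_of_continuousOn
      (hχ.continuous_fderiv one_ne_zero).continuousOn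
    refine IsCompact.integrable_of_le_norm_fderiv_pow hi hχc.isCompact hχU
      (a := 3 ^ N * ((a₃ * a₁) ^ N + |a₂| ^ N))
      (((measurable_fderiv ℝ _).norm.pow_const _).aestronglyMeasurable) ?_ ?_
    · intro x hx
      have hfx := (hf x (hχU hx)).differentiableAt (hU.mem_nhds (hχU hx))
      have h1 : ‖fderiv ℝ (fun x => χ x • f x) x‖ ≤ |a₂| * ‖fderiv ℝ f x‖ + a₃ * a₁ + 0 := by
        have hs : HasFDerivAt (fun x => χ x • f x) _ x :=
          (hχd x).hasFDerivAt.smul hfx.hasFDerivAt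
        rw [hs.fderiv, add_zero]
        refine (norm_add_le _ _).trans (add_le_add ?_ ?_)
        · rw [norm_smul]
          exact mul_le_mul_of_nonneg_right ((ha₂ x hx).trans (le_abs_self _)) (norm_nonneg _)
        · rw [ContinuousLinearMap.norm_smulRight_apply]
          exact mul_le_mul (ha₃ x hx) (ha₁ x hx) (norm_nonneg _)
            ((norm_nonneg _).trans (ha₃ x hx))
      have h31 : 0 ≤ a₃ * a₁ := mul_nonneg ((norm_nonneg _).trans (ha₃ x hx))
        ((norm_nonneg _).trans (ha₁ x hx))
      rw [Real.norm_of_nonneg (by positivity)]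
      refine (pow_le_pow_left₀ (norm_nonneg _) h1 N).trans ?_
      refine (add_add_pow_le (by positivity) h31 le_rfl N).trans ?_
      rw [zero_pow (by lia), add_zero, mul_assoc]
      refine mul_le_mul_of_nonneg_left ?_ (by positivity)
      rw [mul_pow]
      have q1 : 0 ≤ (a₃ * a₁) ^ N := by positivity
      have q2 : 0 ≤ ‖fderiv ℝ f x‖ ^ N := by positivity
      have q3 : 0 ≤ |a₂| ^ N := by positivity
      nlinarith [mul_nonneg q1 q2]
    · intro x hx
      have h0 : (fun x => χ x • f x) =ᶠ[𝓝 x] fun _ => 0 := by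
        filter_upwards [notMem_tsupport_iff_eventuallyEq.1 hx] with y hy
        simp [hy]
      rw [h0.fderiv_eq]
      simp [show N ≠ 0 by lia]
  have hFi : Integrable (fun x => ‖fderiv ℝ F x‖ ^ N) μ := by
    refine (((hχfi.const_mul (‖P‖ ^ N)).add (hgi.const_mul (‖b i‖ ^ N))).const_mul (3 ^ N)).mono'
      (((measurable_fderiv ℝ F).norm.pow_const _).aestronglyMeasurable)
      (Eventually.of_forall fun x => ?_)
    rw [Real.norm_of_nonneg (by positivity)]
    have h1 : ‖fderiv ℝ F x‖ ≤ ‖P‖ * ‖fderiv ℝ (fun x => χ x • f x) x‖ +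
        ‖b i‖ * ‖fderiv ℝ g x‖ + 0 := by
      rw [hFD, add_zero]
      refine (norm_add_le _ _).trans (add_le_add (ContinuousLinearMap.opNorm_comp_le _ _) ?_)
      rw [ContinuousLinearMap.norm_smulRight_apply, mul_comm]
    refine (pow_le_pow_left₀ (norm_nonneg _) h1 N).trans ?_
    refine (add_add_pow_le (by positivity) (by positivity) le_rfl N).trans (le_of_eq ?_)
    simp only [Pi.add_apply]
    rw [zero_pow (by lia), add_zero, mul_pow, mul_pow]
  rw [← integral_det_fderiv_eq_zero hE hFd hFc hFi]
  refine integral_congr_ae (Eventually.of_forall fun x => ?_)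
  change ((LinearMap.toMatrix b b (fderiv ℝ f x : E →ₗ[ℝ] E)).updateRow i
      (fun j => fderiv ℝ g x (b j))).det = (fderiv ℝ F x).det
  rw [ContinuousLinearMap.det, ← LinearMap.det_toMatrix b]
  by_cases hx : x ∈ tsupport g
  · refine congrArg Matrix.det ?_
    have h0 : (fun x => χ x • f x) =ᶠ[𝓝 x] f := by
      filter_upwards [hχ1 x hx] with y hy
      simp [hy]
    ext j k
    rw [LinearMap.toMatrix_apply, hFD, h0.fderiv_eq]
    simp only [ContinuousLinearMap.coe_coe, _root_.add_apply,
      ContinuousLinearMap.comp_apply, ContinuousLinearMap.smulRight_apply, map_add, map_smul,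
      Finsupp.add_apply, Finsupp.smul_apply, hP, Module.Basis.repr_self, smul_eq_mul]
    by_cases h : j = i
    · subst h; simp
    · simp [h, LinearMap.toMatrix_apply, Matrix.updateRow_ne]
  · have hg0 : fderiv ℝ g x = 0 := by
      rw [(notMem_tsupport_iff_eventuallyEq.1 hx).fderiv_eq]
      simp
    have e1 : ((LinearMap.toMatrix b b (fderiv ℝ f x : E →ₗ[ℝ] E)).updateRow i
      (fun j => fderiv ℝ g x (b j))).det = 0 :=
      Matrix.det_eq_zero_of_row_eq_zero i (fun j => by simp [hg0])
    rw [e1]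
    refine (Matrix.det_eq_zero_of_row_eq_zero i fun j => ?_).symm
    rw [LinearMap.toMatrix_apply, hFD, hg0]
    simp [hP]

theorem hasFDerivAt_mul_of_tsupport {E V : Type*} [NormedAddCommGroup E] [NormedSpace ℝ E]
    [NormedAddCommGroup V] [NormedSpace ℝ V] {φ : E → ℝ} {f : E → V} {U : Set E} (hU : IsOpen U)
    (hf : DifferentiableOn ℝ f U) (hφ : Differentiable ℝ φ) (hφU : tsupport φ ⊆ U) (x : E) :
    HasFDerivAt (fun x => φ x • f x)
      (φ x • fderiv ℝ f x + (fderiv ℝ φ x).smulRight (f x)) x := by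
  by_cases hx : x ∈ tsupport φ
  · exact (hφ x).hasFDerivAt.smul
      ((hf x (hφU hx)).differentiableAt (hU.mem_nhds (hφU hx))).hasFDerivAt
  · have h1 := notMem_tsupport_iff_eventuallyEq.1 hx
    have h0 : (fun x => φ x • f x) =ᶠ[𝓝 x] fun _ => 0 := by
      filter_upwards [h1] with y hy
      simp [hy]
    have h2 : fderiv ℝ φ x = 0 := by rw [h1.fderiv_eq]; simp
    have h3 : φ x = 0 := h1.eq_of_nhds
    rw [h2, h3]
    have h4 : HasFDerivAt (fun x => φ x • f x) (0 : E →L[ℝ] V) x :=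
      (hasFDerivAt_const (𝕜 := ℝ) (0 : V) x).congr_of_eventuallyEq h0
    simpa using h4

theorem exists_coord_bounds {E ι : Type*} [NormedAddCommGroup E]
    [NormedSpace ℝ E] [FiniteDimensional ℝ E] [Fintype ι] (b : Module.Basis ι ℝ E) :
    ∃ β : ℝ, 0 ≤ β ∧ (∀ i, ‖b i‖ ≤ β) ∧ ∀ (i : ι) (v : E), |b.repr v i| ≤ β * ‖v‖ := by
  refine ⟨∑ i, ‖b i‖ + ∑ i, ‖LinearMap.toContinuousLinearMap (b.coord i)‖, by positivity,
    fun i => ?_, fun i v => ?_⟩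
  · have := Finset.single_le_sum (f := fun i => ‖b i‖) (fun _ _ => norm_nonneg _)
      (Finset.mem_univ i)
    have h2 : 0 ≤ ∑ i, ‖LinearMap.toContinuousLinearMap (b.coord i)‖ := by positivity
    linarith
  · have := Finset.single_le_sum (f := fun i => ‖LinearMap.toContinuousLinearMap (b.coord i)‖)
      (fun _ _ => norm_nonneg _) (Finset.mem_univ i)
    have h2 : 0 ≤ ∑ i, ‖b i‖ := by positivity
    have h3 := (LinearMap.toContinuousLinearMap (b.coord i)).le_opNorm v
    refine h3.trans (mul_le_mul_of_nonneg_right (by linarith) (norm_nonneg _))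

theorem det_updateRow_smul_mul_add {ι : Type*} [Fintype ι] [DecidableEq ι] (M T : Matrix ι ι ℝ)
    (i : ι) (a c : ℝ) (v : ι → ℝ) :
    (M.updateRow i (a • (T * M) i + c • v)).det =
      a * T i i * M.det + c * (M.updateRow i v).det := by
  rw [Matrix.det_updateRow_add, Matrix.det_updateRow_smul, Matrix.det_updateRow_smul]
  have : (T * M) i = ∑ k, T i k • M k := by
    ext j
    simp [Matrix.mul_apply, Finset.sum_apply]
  rw [this, Matrix.det_updateRow_sum]
  simp only [smul_eq_mul]
  ring

/-- A quantitative divergence formula: the integral of `φ (div H)(f) det Df` is controlled by the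
terms in which `φ` is differentiated. -/
theorem exists_abs_integral_trace_mul_det_le (E : Type*) [NormedAddCommGroup E]
    [NormedSpace ℝ E] [FiniteDimensional ℝ E] [MeasurableSpace E] [BorelSpace E] (μ : Measure E)
    [μ.IsAddHaarMeasure] (hE : 1 ≤ Module.finrank ℝ E) :
    ∃ C : ℝ, 0 ≤ C ∧ ∀ (f : E → E) (U V : Set E) (H : E → E) (φ : E → ℝ), IsOpen U → IsOpen V →
      DifferentiableOn ℝ f U →
      LocallyIntegrableOn (fun x => ‖fderiv ℝ f x‖ ^ Module.finrank ℝ E) U μ →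
      ContDiffOn ℝ 1 H V → MapsTo f U V → ContDiff ℝ 1 φ → HasCompactSupport φ → tsupport φ ⊆ U →
      Integrable (fun x => φ x * LinearMap.trace ℝ E (fderiv ℝ H (f x)) * (fderiv ℝ f x).det) μ ∧
      Integrable (fun x => ‖fderiv ℝ φ x‖ * ‖H (f x)‖ *
        ‖fderiv ℝ f x‖ ^ (Module.finrank ℝ E - 1)) μ ∧
      |∫ x, φ x * LinearMap.trace ℝ E (fderiv ℝ H (f x)) * (fderiv ℝ f x).det ∂μ| ≤
        C * ∫ x, ‖fderiv ℝ φ x‖ * ‖H (f x)‖ *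
          ‖fderiv ℝ f x‖ ^ (Module.finrank ℝ E - 1) ∂μ := by
  have hcE : CompleteSpace E := FiniteDimensional.complete ℝ E
  set N := Module.finrank ℝ E with hN
  let b := Module.finBasis ℝ E
  obtain ⟨β, hβ, hb1, hb2⟩ := exists_coord_bounds b
  refine ⟨N * (β * (N.factorial * (β * (β * β) ^ (N - 1)))), by positivity, ?_⟩
  intro f U V H φ hU hV hf hi hH hfV hφ hφc hφU
  set S := tsupport φ with hS
  have hSc : IsCompact S := hφc.isCompact
  have hφd : Differentiable ℝ φ := hφ.differentiable one_ne_zero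
  have hfS : ContinuousOn f S := hf.continuousOn.mono hφU
  have hfSV : MapsTo f S V := fun x hx => hfV (hφU hx)
  have hHf : DifferentiableOn ℝ (fun x => H (f x)) U :=
    (hH.differentiableOn one_ne_zero).comp hf hfV
  have hDH : ContinuousOn (fun x => fderiv ℝ H (f x)) S :=
    (hH.continuousOn_fderiv_of_isOpen hV le_rfl).comp hfS hfSV
  have hHfS : ContinuousOn (fun x => H (f x)) S := hHf.continuousOn.mono hφU
  have hDφ : Continuous (fderiv ℝ φ) := hφ.continuous_fderiv one_ne_zero
  have hoff : ∀ x, x ∉ S → φ x = 0 ∧ fderiv ℝ φ x = 0 := fun x hx => by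
    have h1 := notMem_tsupport_iff_eventuallyEq.1 hx
    exact ⟨h1.eq_of_nhds, by rw [h1.fderiv_eq]; simp⟩
  let M : E → Matrix (Fin N) (Fin N) ℝ := fun x =>
    LinearMap.toMatrix b b (fderiv ℝ f x : E →ₗ[ℝ] E)
  let T : E → Matrix (Fin N) (Fin N) ℝ := fun x =>
    LinearMap.toMatrix b b (fderiv ℝ H (f x) : E →ₗ[ℝ] E)
  have hdet : ∀ x, (fderiv ℝ f x).det = (M x).det := fun x => by
    rw [ContinuousLinearMap.det, ← LinearMap.det_toMatrix b]
  let A : Fin N → E → ℝ := fun i x => φ x * T x i i * (M x).det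
  let R : Fin N → E → ℝ := fun i x =>
    b.repr (H (f x)) i * ((M x).updateRow i (fun j => fderiv ℝ φ x (b j))).det
  let Q : E → ℝ := fun x => ‖fderiv ℝ φ x‖ * ‖H (f x)‖ * ‖fderiv ℝ f x‖ ^ (N - 1)
  have hcoord : ∀ i, Continuous fun v => b.repr v i := fun i =>
    (LinearMap.toContinuousLinearMap (b.coord i)).continuous
  have hpow : ∀ x, ‖fderiv ℝ f x‖ ^ (N - 1) ≤ ‖fderiv ℝ f x‖ ^ N + 1 := fun x => by
    rcases le_total ‖fderiv ℝ f x‖ 1 with h | h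
    · have := pow_le_one₀ (n := N - 1) (norm_nonneg _) h
      have : 0 ≤ ‖fderiv ℝ f x‖ ^ N := by positivity
      linarith
    · have := pow_le_pow_right₀ h (Nat.sub_le N 1)
      linarith
  have hRQ : ∀ i x, |R i x| ≤ β * (N.factorial * (β * (β * β) ^ (N - 1))) * Q x := by
    intro i x
    have h1 : |((M x).updateRow i (fun j => fderiv ℝ φ x (b j))).det| ≤
        N.factorial * ((‖fderiv ℝ φ x‖ * β) * (β * (‖fderiv ℝ f x‖ * β)) ^ (N - 1)) := by
      have := abs_det_updateRow_le (M x) i (fun j => fderiv ℝ φ x (b j))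
        (a := ‖fderiv ℝ φ x‖ * β) (m := β * (‖fderiv ℝ f x‖ * β)) ?_ ?_
      · simpa using this
      · intro j k
        simp only [M, LinearMap.toMatrix_apply, ContinuousLinearMap.coe_coe]
        refine (hb2 _ _).trans (mul_le_mul_of_nonneg_left ?_ hβ)
        exact ((fderiv ℝ f x).le_opNorm _).trans
          (mul_le_mul_of_nonneg_left (hb1 k) (norm_nonneg _))
      · intro k
        exact ((fderiv ℝ φ x).le_opNorm _).trans
          (mul_le_mul_of_nonneg_left (hb1 k) (norm_nonneg _))
    simp only [R]
    rw [abs_mul]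
    refine (mul_le_mul (hb2 i _) h1 (abs_nonneg _) (by positivity)).trans (le_of_eq ?_)
    simp only [Q]
    rw [show β * (‖fderiv ℝ f x‖ * β) = (β * β) * ‖fderiv ℝ f x‖ by ring, mul_pow]
    ring
  obtain ⟨a₁, ha₁⟩ := hSc.exists_bound_of_continuousOn hHfS
  obtain ⟨a₂, ha₂⟩ := hSc.exists_bound_of_continuousOn hDφ.continuousOn
  obtain ⟨a₃, ha₃⟩ := hSc.exists_bound_of_continuousOn hφ.continuous.continuousOn
  obtain ⟨a₄, ha₄⟩ := hSc.exists_bound_of_continuousOn hDH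
  have hQ : Integrable Q μ := by
    refine IsCompact.integrable_of_le_norm_fderiv_pow hi hSc hφU (a := a₂ * a₁) ?_ ?_ ?_
    · exact ((hDφ.norm.aestronglyMeasurable).mul
        (hHfS.norm.aestronglyMeasurable hSc.measurableSet)).mul
        ((measurable_fderiv ℝ f).norm.pow_const _).aestronglyMeasurable
    · intro x hx
      have h2 : 0 ≤ a₂ := (norm_nonneg _).trans (ha₂ x hx)
      have h1 : 0 ≤ a₁ := (norm_nonneg _).trans (ha₁ x hx)
      rw [Real.norm_of_nonneg (by positivity)]
      exact mul_le_mul (mul_le_mul (ha₂ x hx) (ha₁ x hx) (norm_nonneg _) h2) (hpow x)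
        (by positivity) (by positivity)
    · intro x hx
      simp [Q, (hoff x hx).2]
  have hR : ∀ i, Integrable (R i) μ := by
    intro i
    have hRS : ∀ x, x ∉ S → R i x = 0 := fun x hx => by
      have := hRQ i x
      simp only [Q, (hoff x hx).2, norm_zero, zero_mul, mul_zero] at this
      exact abs_nonpos_iff.1 this
    have hRm : AEStronglyMeasurable (R i) (μ.restrict S) := by
      refine AEStronglyMeasurable.mul ((hcoord i).comp_aestronglyMeasurable
        (hHfS.aestronglyMeasurable hSc.measurableSet)) ?_
      have hc : Continuous fun p : (E →L[ℝ] E) × (E →L[ℝ] ℝ) =>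
          ((LinearMap.toMatrix b b (p.1 : E →ₗ[ℝ] E)).updateRow i (fun j => p.2 (b j))).det := by
        refine Continuous.matrix_det (Continuous.matrix_updateRow i ?_ ?_)
        · refine continuous_matrix fun j k => ?_
          simp only [LinearMap.toMatrix_apply, ContinuousLinearMap.coe_coe]
          exact (hcoord j).comp ((ContinuousLinearMap.apply ℝ E (b k)).continuous.comp
            continuous_fst)
        · exact continuous_pi fun j =>
            (ContinuousLinearMap.apply ℝ ℝ (b j)).continuous.comp continuous_snd
      exact (hc.measurable.comp ((measurable_fderiv ℝ f).prodMk
        (measurable_fderiv ℝ φ))).aestronglyMeasurable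
    have hRm' : AEStronglyMeasurable (R i) μ := by
      have : R i = S.indicator (R i) := by
        ext x
        by_cases hx : x ∈ S
        · simp [hx]
        · simp [hx, hRS x hx]
      rw [this]
      exact (aestronglyMeasurable_indicator_iff hSc.measurableSet).2 hRm
    exact (hQ.const_mul _).mono' hRm' (Eventually.of_forall (hRQ i))
  have hA : ∀ i, Integrable (A i) μ := by
    intro i
    have hT : ContinuousOn (fun x => T x i i) S := by
      simp only [T, LinearMap.toMatrix_apply, ContinuousLinearMap.coe_coe]
      exact (hcoord i).comp_continuousOn
        ((ContinuousLinearMap.apply ℝ E (b i)).continuous.comp_continuousOn hDH)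
    obtain ⟨a₅, ha₅⟩ := hSc.exists_bound_of_continuousOn hT
    refine IsCompact.integrable_of_le_norm_fderiv_pow hi hSc hφU (a := a₃ * a₅) ?_ ?_ ?_
    · refine ((hφ.continuous.aestronglyMeasurable).mul
        (hT.aestronglyMeasurable hSc.measurableSet)).mul ?_
      simp_rw [← hdet]
      exact (ContinuousLinearMap.continuous_det.measurable.comp
        (measurable_fderiv ℝ f)).aestronglyMeasurable
    · intro x hx
      have h2 : 0 ≤ a₃ := (norm_nonneg _).trans (ha₃ x hx)
      have h1 : 0 ≤ a₅ := (norm_nonneg _).trans (ha₅ x hx)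
      simp only [A]
      rw [norm_mul, norm_mul]
      refine mul_le_mul (mul_le_mul (ha₃ x hx) (ha₅ x hx) (norm_nonneg _) h2) ?_
        (by positivity) (by positivity)
      rw [← hdet, Real.norm_eq_abs]
      have := abs_det_le_norm_pow (fderiv ℝ f x)
      linarith
    · intro x hx
      simp [A, (hoff x hx).1]
  have hAR : ∀ i, ∫ x, A i x ∂μ = - ∫ x, R i x ∂μ := by
    intro i
    let ci : E →L[ℝ] ℝ := LinearMap.toContinuousLinearMap (b.coord i)
    let g : E → ℝ := fun x => φ x • ci (H (f x))
    have hciH : DifferentiableOn ℝ (fun x => ci (H (f x))) U :=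
      ci.differentiable.comp_differentiableOn hHf
    have hg := hasFDerivAt_mul_of_tsupport hU hciH hφd hφU
    have hgd : ∀ x ∈ S, fderiv ℝ g x = φ x • (ci ∘L fderiv ℝ H (f x) ∘L fderiv ℝ f x) +
        (fderiv ℝ φ x).smulRight (ci (H (f x))) := by
      intro x hx
      have hfx := (hf x (hφU hx)).differentiableAt (hU.mem_nhds (hφU hx))
      have hHx := (hH.differentiableOn one_ne_zero (f x) (hfSV hx)).differentiableAt
        (hV.mem_nhds (hfSV hx))
      rw [(hg x).fderiv]
      have h1 : HasFDerivAt (fun x => ci (H (f x)))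
          (ci ∘L fderiv ℝ H (f x) ∘L fderiv ℝ f x) x :=
        ci.hasFDerivAt.comp x (hHx.hasFDerivAt.comp x hfx.hasFDerivAt)
      rw [h1.fderiv]
    have hgS : ∀ x, x ∉ S → fderiv ℝ g x = 0 := fun x hx => by
      rw [(hg x).fderiv, (hoff x hx).1, (hoff x hx).2]
      simp
    have hgi : Integrable (fun x => ‖fderiv ℝ g x‖ ^ N) μ := by
      refine IsCompact.integrable_of_le_norm_fderiv_pow hi hSc hφU
        (a := 3 ^ N * ((a₃ * (‖ci‖ * a₄)) ^ N + (a₂ * (‖ci‖ * a₁)) ^ N))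
        (((measurable_fderiv ℝ _).norm.pow_const _).aestronglyMeasurable) ?_ ?_
      · intro x hx
        have p1 : 0 ≤ a₁ := (norm_nonneg _).trans (ha₁ x hx)
        have p2 : 0 ≤ a₂ := (norm_nonneg _).trans (ha₂ x hx)
        have p3 : 0 ≤ a₃ := (norm_nonneg _).trans (ha₃ x hx)
        have p4 : 0 ≤ a₄ := (norm_nonneg _).trans (ha₄ x hx)
        have h1 : ‖fderiv ℝ g x‖ ≤ (a₃ * (‖ci‖ * a₄)) * ‖fderiv ℝ f x‖ +
            a₂ * (‖ci‖ * a₁) + 0 := by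
          rw [hgd x hx, add_zero]
          refine (norm_add_le _ _).trans (add_le_add ?_ ?_)
          · rw [norm_smul, mul_assoc, mul_assoc]
            refine mul_le_mul (ha₃ x hx) ?_ (norm_nonneg _) p3
            refine (ContinuousLinearMap.opNorm_comp_le _ _).trans
              (mul_le_mul_of_nonneg_left ?_ (norm_nonneg _))
            exact (ContinuousLinearMap.opNorm_comp_le _ _).trans
              (mul_le_mul_of_nonneg_right (ha₄ x hx) (norm_nonneg _))
          · rw [ContinuousLinearMap.norm_smulRight_apply]
            refine mul_le_mul (ha₂ x hx) ?_ (norm_nonneg _) p2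
            exact (ci.le_opNorm _).trans (mul_le_mul_of_nonneg_left (ha₁ x hx) (norm_nonneg _))
        rw [Real.norm_of_nonneg (by positivity)]
        refine (pow_le_pow_left₀ (norm_nonneg _) h1 N).trans ?_
        refine (add_add_pow_le (by positivity) (by positivity) le_rfl N).trans ?_
        rw [zero_pow (by lia), add_zero, mul_assoc (3 ^ N), mul_pow _ ‖fderiv ℝ f x‖]
        refine mul_le_mul_of_nonneg_left ?_ (by positivity)
        have q1 : 0 ≤ (a₃ * (‖ci‖ * a₄)) ^ N := by positivity
        have q2 : 0 ≤ ‖fderiv ℝ f x‖ ^ N := by positivity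
        have q3 : 0 ≤ (a₂ * (‖ci‖ * a₁)) ^ N := by positivity
        nlinarith [mul_nonneg q3 q2]
      · intro x hx
        rw [hgS x hx, norm_zero, zero_pow (by lia)]
    have hgsub : tsupport g ⊆ S := closure_mono fun x hx => by
      rw [Function.mem_support] at hx ⊢
      exact fun h => hx (by simp [g, h])
    have hz := integral_det_updateRow_eq_zero (μ := μ) hE b hU hf hi
      (fun x => (hg x).differentiableAt)
      (HasCompactSupport.of_support_subset_isCompact hSc (subset_closure.trans hgsub))
      (hgsub.trans hφU) hgi i
    have heq : ∀ x, ((LinearMap.toMatrix b b (fderiv ℝ f x : E →ₗ[ℝ] E)).updateRow i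
        (fun j => fderiv ℝ g x (b j))).det = A i x + R i x := by
      intro x
      by_cases hx : x ∈ S
      · have : (fun j => fderiv ℝ g x (b j)) = φ x • (T x * M x) i +
            b.repr (H (f x)) i • fun j => fderiv ℝ φ x (b j) := by
          funext j
          have h3 : (T x * M x) i j = ci (fderiv ℝ H (f x) (fderiv ℝ f x (b j))) := by
            simp only [T, M]
            rw [← LinearMap.toMatrix_comp, LinearMap.toMatrix_apply]
            rfl
          rw [hgd x hx, Pi.add_apply, Pi.smul_apply, Pi.smul_apply, h3]
          simp only [_root_.add_apply, _root_.smul_apply,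
            ContinuousLinearMap.comp_apply, ContinuousLinearMap.smulRight_apply, smul_eq_mul]
          rw [mul_comm (fderiv ℝ φ x (b j))]
          rfl
        rw [this]
        exact det_updateRow_smul_mul_add (M x) (T x) i _ _ _
      · have h1 : ((LinearMap.toMatrix b b (fderiv ℝ f x : E →ₗ[ℝ] E)).updateRow i
            (fun j => fderiv ℝ g x (b j))).det = 0 :=
          Matrix.det_eq_zero_of_row_eq_zero i (fun j => by simp [hgS x hx])
        have h2 : ((M x).updateRow i (fun j => fderiv ℝ φ x (b j))).det = 0 :=
          Matrix.det_eq_zero_of_row_eq_zero i (fun j => by simp [(hoff x hx).2])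
        simp only [A, R]
        rw [h1, h2, (hoff x hx).1]
        simp
    have hsum : ∫ x, (A i x + R i x) ∂μ = 0 := by
      rw [← hz]
      exact integral_congr_ae (Eventually.of_forall fun x => (heq x).symm)
    rw [integral_add (hA i) (hR i)] at hsum
    linarith
  have hAsum : (fun x => φ x * LinearMap.trace ℝ E (fderiv ℝ H (f x)) * (fderiv ℝ f x).det) =
      fun x => ∑ i, A i x := by
    funext x
    rw [hdet, LinearMap.trace_eq_matrix_trace ℝ b, Matrix.trace, Finset.mul_sum,
      Finset.sum_mul]
    rfl
  refine ⟨?_, hQ, ?_⟩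
  · rw [hAsum]
    exact integrable_finsetSum _ fun i _ => hA i
  · rw [hAsum, integral_finsetSum _ fun i _ => hA i]
    refine (Finset.abs_sum_le_sum_abs _ _).trans ?_
    have : ∀ i ∈ (Finset.univ : Finset (Fin N)), |∫ x, A i x ∂μ| ≤
        β * (N.factorial * (β * (β * β) ^ (N - 1))) * ∫ x, Q x ∂μ := by
      intro i _
      rw [hAR, abs_neg, ← integral_const_mul]
      refine abs_integral_le_integral_abs.trans ?_
      exact integral_mono (hR i).abs (hQ.const_mul _) (hRQ i)
    refine (Finset.sum_le_sum this).trans (le_of_eq ?_)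
    rw [Finset.sum_const, Finset.card_univ, Fintype.card_fin, nsmul_eq_mul, ← mul_assoc]

theorem exists_abs_deriv_smoothTransition_le :
    ∃ B : ℝ, 0 ≤ B ∧ ∀ s, |deriv Real.smoothTransition s| ≤ B := by
  have hc : Continuous (deriv Real.smoothTransition) :=
    (Real.smoothTransition.contDiff (n := 1)).continuous_deriv le_rfl
  obtain ⟨B, hB⟩ := (isCompact_Icc (a := (0 : ℝ)) (b := 1)).exists_bound_of_continuousOn
    hc.continuousOn
  refine ⟨B, (norm_nonneg _).trans (hB 0 (by simp)), fun s => ?_⟩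
  by_cases hs : s ∈ Icc (0 : ℝ) 1
  · exact hB s hs
  have hB0 : 0 ≤ B := (norm_nonneg _).trans (hB 0 (by simp))
  have : deriv Real.smoothTransition s = 0 := by
    rcases lt_or_ge s 0 with h | h
    · have : Real.smoothTransition =ᶠ[𝓝 s] fun _ => 0 := by
        filter_upwards [Iio_mem_nhds h] with y hy
        exact Real.smoothTransition.zero_of_nonpos (le_of_lt hy)
      rw [this.deriv_eq]; simp
    · have h1 : 1 < s := by
        by_contra h2
        exact hs ⟨h, not_lt.1 h2⟩
      have : Real.smoothTransition =ᶠ[𝓝 s] fun _ => 1 := by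
        filter_upwards [Ioi_mem_nhds h1] with y hy
        exact Real.smoothTransition.one_of_one_le (le_of_lt hy)
      rw [this.deriv_eq]; simp
  rw [this]
  simpa using hB0

theorem exists_radial_cutoff : ∃ B : ℝ, 0 ≤ B ∧ ∀ (E : Type*) [NormedAddCommGroup E]
    [InnerProductSpace ℝ E] (x₀ : E) (r' r : ℝ), 0 ≤ r' → r' < r →
    ∃ φ : E → ℝ, ContDiff ℝ 1 φ ∧ (∀ x, 0 ≤ φ x) ∧ (∀ x, φ x ≤ 1) ∧
      (∀ x ∈ closedBall x₀ r', φ x = 1) ∧ tsupport φ ⊆ closedBall x₀ r ∧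
      ∀ x, ‖fderiv ℝ φ x‖ ≤ B / (r - r') := by
  obtain ⟨B, hB0, hB⟩ := exists_abs_deriv_smoothTransition_le
  refine ⟨2 * B, by positivity, ?_⟩
  intro E _ _ x₀ r' r hr' hr
  have hd : 0 < r ^ 2 - r' ^ 2 := by nlinarith
  let q : E → ℝ := fun x => (r ^ 2 - ‖x - x₀‖ ^ 2) / (r ^ 2 - r' ^ 2)
  have hq : ContDiff ℝ 1 q :=
    (contDiff_const.sub ((contDiff_id.sub contDiff_const).norm_sq ℝ)).div_const _
  have hqD : ∀ x, HasFDerivAt q ((r ^ 2 - r' ^ 2)⁻¹ • -((2 : ℝ) • innerSL ℝ (x - x₀))) x := by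
    intro x
    have h1 : HasFDerivAt (fun x => ‖x - x₀‖ ^ 2) ((2 : ℝ) • innerSL ℝ (x - x₀)) x := by
      have := (hasStrictFDerivAt_norm_sq (x - x₀)).hasFDerivAt.comp x
        ((hasFDerivAt_id x).sub_const x₀)
      rw [ofNat_smul_eq_nsmul ℝ]
      exact this
    have h2 := (h1.const_sub (r ^ 2)).const_smul (r ^ 2 - r' ^ 2)⁻¹
    refine h2.congr_of_eventuallyEq (Eventually.of_forall fun y => ?_)
    simp only [q, Pi.smul_apply, smul_eq_mul]
    rw [div_eq_inv_mul]
  refine ⟨fun x => Real.smoothTransition (q x), Real.smoothTransition.contDiff.comp hq,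
    fun x => Real.smoothTransition.nonneg _, fun x => Real.smoothTransition.le_one _, ?_, ?_, ?_⟩
  · intro x hx
    apply Real.smoothTransition.one_of_one_le
    rw [mem_closedBall, dist_eq_norm] at hx
    simp only [q]
    rw [le_div_iff₀ hd]
    have := pow_le_pow_left₀ (norm_nonneg _) hx 2
    linarith
  · refine closure_minimal (fun x hx => ?_) isClosed_closedBall
    by_contra hxr
    apply hx
    apply Real.smoothTransition.zero_of_nonpos
    rw [mem_closedBall, dist_eq_norm, not_le] at hxr
    refine div_nonpos_of_nonpos_of_nonneg ?_ hd.le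
    have := pow_le_pow_left₀ (by linarith) hxr.le 2
    linarith
  · intro x
    have h1 : HasFDerivAt (fun x => Real.smoothTransition (q x))
        (deriv Real.smoothTransition (q x) •
          ((r ^ 2 - r' ^ 2)⁻¹ • -((2 : ℝ) • innerSL ℝ (x - x₀)))) x :=
      ((Real.smoothTransition.contDiff (n := 1)).differentiable one_ne_zero
        (q x)).hasDerivAt.comp_hasFDerivAt x (hqD x)
    rw [h1.fderiv]
    rcases le_or_gt ‖x - x₀‖ r with hx | hx
    · rw [norm_smul, norm_smul, norm_neg, norm_smul, innerSL_apply_norm,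
        Real.norm_of_nonneg (inv_nonneg.2 hd.le), Real.norm_eq_abs]
      have e : (2 * B) / (r - r') = B * ((r ^ 2 - r' ^ 2)⁻¹ * (2 * (r + r'))) := by
        have : r ^ 2 - r' ^ 2 = (r - r') * (r + r') := by ring
        have h3 : r - r' ≠ 0 := by linarith
        have h4 : r + r' ≠ 0 := by linarith
        rw [this]
        field_simp
      rw [e]
      refine mul_le_mul (hB _) ?_ (by positivity) hB0
      refine mul_le_mul_of_nonneg_left ?_ (inv_nonneg.2 hd.le)
      norm_num
      linarith
    · have h0 : deriv Real.smoothTransition (q x) = 0 := by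
        have hneg : q x < 0 := by
          refine div_neg_of_neg_of_pos ?_ hd
          have := pow_lt_pow_left₀ hx (by linarith) two_ne_zero
          linarith
        have : Real.smoothTransition =ᶠ[𝓝 (q x)] fun _ => 0 := by
          filter_upwards [Iio_mem_nhds hneg] with y hy
          exact Real.smoothTransition.zero_of_nonpos (le_of_lt hy)
        rw [this.deriv_eq]; simp
      rw [h0, zero_smul, norm_zero]
      exact div_nonneg (by positivity) (by linarith)

theorem pow_sub_one_mul_le {a b ε : ℝ} (ha : 0 ≤ a) (hb : 0 ≤ b) (hε : 0 < ε) {N : ℕ}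
    (hN : 1 ≤ N) : a ^ (N - 1) * b ≤ ε * a ^ N + (ε⁻¹) ^ (N - 1) * b ^ N := by
  obtain ⟨m, rfl⟩ := Nat.exists_eq_add_of_le hN
  simp only [Nat.add_sub_cancel_left]
  rw [add_comm 1 m, pow_succ, pow_succ b]
  have h1 : 0 ≤ a ^ m := by positivity
  have h2 : 0 ≤ b ^ m := by positivity
  have h3 : 0 ≤ ε⁻¹ ^ m := by positivity
  rcases le_or_gt b (ε * a) with h | h
  · have := mul_le_mul_of_nonneg_left h h1
    have h4 : 0 ≤ ε⁻¹ ^ m * (b ^ m * b) := by positivity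
    linarith
  · have h5 : a ≤ ε⁻¹ * b := by
      rw [le_inv_mul_iff₀ hε]; exact h.le
    have := mul_le_mul_of_nonneg_right (pow_le_pow_left₀ ha h5 m) hb
    rw [mul_pow] at this
    have h4 : 0 ≤ ε * (a ^ m * a) := by positivity
    linarith

/-- Abstract Caccioppoli inequality, obtained from the divergence formula by absorption. -/
theorem exists_caccioppoli (E : Type*) [NormedAddCommGroup E]
    [NormedSpace ℝ E] [FiniteDimensional ℝ E] [MeasurableSpace E] [BorelSpace E] (μ : Measure E)
    [μ.IsAddHaarMeasure] (hE : 1 ≤ Module.finrank ℝ E) (K : ℝ) (hK : 0 ≤ K) :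
    ∃ C : ℝ, 0 ≤ C ∧ ∀ (f : E → E) (U V : Set E) (H : E → E) (φ : E → ℝ) (s : ℝ)
      (w a v : E → ℝ), IsOpen U → IsOpen V →
      DifferentiableOn ℝ f U →
      LocallyIntegrableOn (fun x => ‖fderiv ℝ f x‖ ^ Module.finrank ℝ E) U μ →
      ContDiffOn ℝ 1 H V → MapsTo f U V → ContDiff ℝ 1 φ → HasCompactSupport φ → tsupport φ ⊆ U →
      (∀ x, 0 ≤ φ x) → |s| = 1 → (∀ x ∈ U, 0 ≤ w x) → (∀ x ∈ U, 0 ≤ a x) → (∀ x ∈ U, 0 ≤ v x) →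
      (∀ᵐ x ∂(μ.restrict U), w x * a x ^ Module.finrank ℝ E ≤
        K * (s * LinearMap.trace ℝ E (fderiv ℝ H (f x)) * (fderiv ℝ f x).det)) →
      (∀ x ∈ U, ‖H (f x)‖ * ‖fderiv ℝ f x‖ ^ (Module.finrank ℝ E - 1) ≤
        w x * v x * a x ^ (Module.finrank ℝ E - 1)) →
      Integrable (fun x => φ x ^ Module.finrank ℝ E * (w x * a x ^ Module.finrank ℝ E)) μ →
      Integrable (fun x => ‖fderiv ℝ φ x‖ ^ Module.finrank ℝ E *
        (w x * v x ^ Module.finrank ℝ E)) μ →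
      ∫ x, φ x ^ Module.finrank ℝ E * (w x * a x ^ Module.finrank ℝ E) ∂μ ≤
        C * ∫ x, ‖fderiv ℝ φ x‖ ^ Module.finrank ℝ E *
          (w x * v x ^ Module.finrank ℝ E) ∂μ := by
  obtain ⟨C, hC, h⟩ := exists_abs_integral_trace_mul_det_le E μ hE
  set N := Module.finrank ℝ E
  let D : ℝ := K * C * N + 1
  have hD : 0 < D := by positivity
  refine ⟨2 * D * ((2 * D)) ^ (N - 1), by positivity, ?_⟩
  intro f U V H φ s w a v hU hV hf hi hH hfV hφ hφc hφU hφ0 hs hw ha hv hqr hHle hI1 hI2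
  have hφN : ContDiff ℝ 1 (fun x => φ x ^ N) := hφ.pow N
  have hφd : Differentiable ℝ φ := hφ.differentiable one_ne_zero
  have hsub : tsupport (fun x => φ x ^ N) ⊆ tsupport φ := closure_mono fun x hx => by
    rw [Function.mem_support] at hx ⊢
    exact fun h0 => hx (by rw [h0, zero_pow (by lia)])
  have hφNc : HasCompactSupport (fun x => φ x ^ N) :=
    HasCompactSupport.of_support_subset_isCompact hφc (subset_closure.trans hsub)
  obtain ⟨hA, hQ, hle⟩ := h f U V H (fun x => φ x ^ N) hU hV hf hi hH hfV hφN hφNc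
    (hsub.trans hφU)
  have hDφ : ∀ x, ‖fderiv ℝ (fun x => φ x ^ N) x‖ = N * φ x ^ (N - 1) * ‖fderiv ℝ φ x‖ := by
    intro x
    have := (hφd x).hasFDerivAt.pow N
    have h2 : HasFDerivAt (fun x => φ x ^ N) _ x := this
    rw [h2.fderiv, norm_smul]
    congr 1
    simp [abs_of_nonneg (hφ0 x)]
  have hoff : ∀ x, x ∉ U → φ x = 0 ∧ fderiv ℝ φ x = 0 := fun x hx => by
    have h1 := notMem_tsupport_iff_eventuallyEq.1 (fun h => hx (hφU h))
    exact ⟨h1.eq_of_nhds, by rw [h1.fderiv_eq]; simp⟩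
  have h1 : ∫ x, φ x ^ N * (w x * a x ^ N) ∂μ ≤ K * |∫ x, φ x ^ N *
      LinearMap.trace ℝ E (fderiv ℝ H (f x)) * (fderiv ℝ f x).det ∂μ| := by
    calc ∫ x, φ x ^ N * (w x * a x ^ N) ∂μ
        ≤ ∫ x, (K * s) * (φ x ^ N *
          LinearMap.trace ℝ E (fderiv ℝ H (f x)) * (fderiv ℝ f x).det) ∂μ := by
          refine integral_mono_ae hI1 (hA.const_mul _) ?_
          filter_upwards [(ae_restrict_iff' hU.measurableSet).1 hqr] with x hx
          by_cases hxU : x ∈ U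
          · have := mul_le_mul_of_nonneg_left (hx hxU) (pow_nonneg (hφ0 x) N)
            refine this.trans (le_of_eq ?_)
            ring
          · simp [(hoff x hxU).1, show N ≠ 0 by lia]
      _ = K * (s * ∫ x, φ x ^ N *
          LinearMap.trace ℝ E (fderiv ℝ H (f x)) * (fderiv ℝ f x).det ∂μ) := by
          rw [integral_const_mul, mul_assoc]
      _ ≤ _ := by
          refine mul_le_mul_of_nonneg_left ?_ hK
          refine (le_abs_self _).trans ?_
          rw [abs_mul, hs, one_mul]
  have h2 : ∫ x, ‖fderiv ℝ (fun x => φ x ^ N) x‖ * ‖H (f x)‖ * ‖fderiv ℝ f x‖ ^ (N - 1) ∂μ ≤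
      N * ((2 * D)⁻¹ * ∫ x, φ x ^ N * (w x * a x ^ N) ∂μ +
        (2 * D) ^ (N - 1) * ∫ x, ‖fderiv ℝ φ x‖ ^ N * (w x * v x ^ N) ∂μ) := by
    rw [← integral_const_mul, ← integral_const_mul,
      ← integral_add (hI1.const_mul _) (hI2.const_mul _), ← integral_const_mul]
    refine integral_mono hQ (((hI1.const_mul _).add (hI2.const_mul _)).const_mul _) fun x => ?_
    by_cases hxU : x ∈ U
    · rw [hDφ, mul_assoc (N : ℝ), mul_assoc (N : ℝ), mul_assoc (N : ℝ)]
      refine mul_le_mul_of_nonneg_left ?_ (by positivity)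
      have p1 := pow_sub_one_mul_le (mul_nonneg (hφ0 x) (ha x hxU))
        (mul_nonneg (norm_nonneg (fderiv ℝ φ x)) (hv x hxU)) (inv_pos.2 (by positivity : 0 < 2 * D))
        (show 1 ≤ N from hE)
      have p2 := mul_le_mul_of_nonneg_left p1 (hw x hxU)
      have p3 := mul_le_mul_of_nonneg_left (hHle x hxU)
        (mul_nonneg (pow_nonneg (hφ0 x) (N - 1)) (norm_nonneg (fderiv ℝ φ x)))
      rw [inv_inv, mul_pow (φ x), mul_pow (φ x), mul_pow ‖fderiv ℝ φ x‖] at p2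
      calc φ x ^ (N - 1) * ‖fderiv ℝ φ x‖ * ‖H (f x)‖ * ‖fderiv ℝ f x‖ ^ (N - 1)
          = φ x ^ (N - 1) * ‖fderiv ℝ φ x‖ * (‖H (f x)‖ * ‖fderiv ℝ f x‖ ^ (N - 1)) := by ring
        _ ≤ _ := p3
        _ = w x * (φ x ^ (N - 1) * a x ^ (N - 1) * (‖fderiv ℝ φ x‖ * v x)) := by ring
        _ ≤ _ := p2
        _ = _ := by ring
    · rw [hDφ, (hoff x hxU).1, (hoff x hxU).2]
      simp [show N ≠ 0 by lia]
  set I := ∫ x, φ x ^ N * (w x * a x ^ N) ∂μ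
  set J := ∫ x, ‖fderiv ℝ φ x‖ ^ N * (w x * v x ^ N) ∂μ
  have hI0 : 0 ≤ I := integral_nonneg fun x => by
    by_cases hxU : x ∈ U
    · exact mul_nonneg (pow_nonneg (hφ0 x) N) (mul_nonneg (hw x hxU) (pow_nonneg (ha x hxU) N))
    · simp [(hoff x hxU).1, show N ≠ 0 by lia]
  have hJ0 : 0 ≤ J := integral_nonneg fun x => by
    by_cases hxU : x ∈ U
    · exact mul_nonneg (by positivity) (mul_nonneg (hw x hxU) (pow_nonneg (hv x hxU) N))
    · simp [(hoff x hxU).2, show N ≠ 0 by lia]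
  have h3 : I ≤ K * C * N * ((2 * D)⁻¹ * I + (2 * D) ^ (N - 1) * J) := by
    refine h1.trans ((mul_le_mul_of_nonneg_left (hle.trans
      (mul_le_mul_of_nonneg_left h2 hC)) hK).trans (le_of_eq ?_))
    ring
  have h4 : I ≤ D * ((2 * D)⁻¹ * I + (2 * D) ^ (N - 1) * J) := by
    refine h3.trans (mul_le_mul_of_nonneg_right ?_ (by positivity))
    simp [D]
  have h5 : D * ((2 * D)⁻¹ * I + (2 * D) ^ (N - 1) * J) = I / 2 + D * (2 * D) ^ (N - 1) * J := by
    field_simp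
  rw [h5] at h4
  linarith

theorem trace_fderiv_sub_const {E : Type*} [NormedAddCommGroup E] [NormedSpace ℝ E]
    [FiniteDimensional ℝ E] (c y : E) :
    LinearMap.trace ℝ E (fderiv ℝ (fun z => z - c) y) = Module.finrank ℝ E := by
  rw [fderiv_sub_const]
  simp

theorem exists_setIntegral_norm_fderiv_pow_le (E : Type*) [NormedAddCommGroup E]
    [InnerProductSpace ℝ E] [FiniteDimensional ℝ E] [MeasurableSpace E] [BorelSpace E]
    (μ : Measure E) [μ.IsAddHaarMeasure] (hE : 1 ≤ Module.finrank ℝ E) (K : ℝ) (hK : 0 ≤ K) :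
    ∃ C : ℝ, 0 ≤ C ∧ ∀ (f : E → E) (x₀ c : E) (d A : ℝ), 0 < d →
      DifferentiableOn ℝ f (ball x₀ d) →
      LocallyIntegrableOn (fun x => ‖fderiv ℝ f x‖ ^ Module.finrank ℝ E) (ball x₀ d) μ →
      (∀ᵐ x ∂(μ.restrict (ball x₀ d)), ‖fderiv ℝ f x‖ ^ Module.finrank ℝ E ≤
        K * (fderiv ℝ f x).det) →
      (∀ x ∈ ball x₀ d, ‖f x - c‖ ≤ A) →
      ∫ x in closedBall x₀ (d / 2), ‖fderiv ℝ f x‖ ^ Module.finrank ℝ E ∂μ ≤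
        C * A ^ Module.finrank ℝ E := by
  have hcE : CompleteSpace E := FiniteDimensional.complete ℝ E
  obtain ⟨C, hC, h⟩ := exists_caccioppoli E μ hE K hK
  obtain ⟨B, hB0, hB⟩ := exists_radial_cutoff
  set N := Module.finrank ℝ E with hN
  refine ⟨C * ((3 * B) ^ N * μ.real (ball 0 1)), by positivity, ?_⟩
  intro f x₀ c d A hd hf hi hqr hA
  have hA0 : 0 ≤ A := (norm_nonneg _).trans (hA x₀ (mem_ball_self hd))
  obtain ⟨φ, hφ, hφ0, hφ1, hφe, hφs, hφD⟩ := hB E x₀ (d / 2) (3 * d / 4) (by linarith) (by linarith)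
  have hsub : closedBall x₀ (3 * d / 4) ⊆ ball x₀ d := closedBall_subset_ball (by linarith)
  have hφc : HasCompactSupport φ :=
    HasCompactSupport.of_support_subset_isCompact (isCompact_closedBall _ _)
      (subset_closure.trans hφs)
  have hφU : tsupport φ ⊆ ball x₀ d := hφs.trans hsub
  have hoff : ∀ x, x ∉ tsupport φ → φ x = 0 ∧ fderiv ℝ φ x = 0 := fun x hx => by
    have h1 := notMem_tsupport_iff_eventuallyEq.1 hx
    exact ⟨h1.eq_of_nhds, by rw [h1.fderiv_eq]; simp⟩
  have hI1 : Integrable (fun x => φ x ^ N * (1 * ‖fderiv ℝ f x‖ ^ N)) μ := by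
    refine IsCompact.integrable_of_le_norm_fderiv_pow hi hφc.isCompact hφU (a := 1) ?_ ?_ ?_
    · exact ((hφ.continuous.pow N).aestronglyMeasurable).mul
        (((measurable_fderiv ℝ f).norm.pow_const _).const_mul _).aestronglyMeasurable
    · intro x _
      rw [Real.norm_of_nonneg (mul_nonneg (pow_nonneg (hφ0 x) _) (by positivity)), one_mul, one_mul]
      have h1 : φ x ^ N ≤ 1 := pow_le_one₀ (hφ0 x) (hφ1 x)
      have h2 : 0 ≤ ‖fderiv ℝ f x‖ ^ N := by positivity
      nlinarith
    · intro x hx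
      rw [(hoff x hx).1, zero_pow (by lia), zero_mul]
  have hbd : ∀ x, ‖fderiv ℝ φ x‖ ^ N * (1 * ‖f x - c‖ ^ N) ≤
      (closedBall x₀ (3 * d / 4)).indicator (fun _ => (B / (d / 4)) ^ N * A ^ N) x := by
    intro x
    by_cases hx : x ∈ closedBall x₀ (3 * d / 4)
    · rw [indicator_of_mem hx, one_mul]
      have h1 := hφD x
      rw [show 3 * d / 4 - d / 2 = d / 4 by ring] at h1
      exact mul_le_mul (pow_le_pow_left₀ (norm_nonneg _) h1 N)
        (pow_le_pow_left₀ (norm_nonneg _) (hA x (hsub hx)) N) (by positivity) (by positivity)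
    · rw [indicator_of_notMem hx, (hoff x fun h => hx (hφs h)).2, norm_zero, zero_pow (by lia),
        zero_mul]
  have hind : Integrable ((closedBall x₀ (3 * d / 4)).indicator
      (fun _ => (B / (d / 4)) ^ N * A ^ N)) μ :=
    (integrableOn_const (hs := measure_closedBall_lt_top.ne)
      (hC := enorm_ne_top)).integrable_indicator measurableSet_closedBall
  have hI2 : Integrable (fun x => ‖fderiv ℝ φ x‖ ^ N * (1 * ‖f x - c‖ ^ N)) μ := by
    refine IsCompact.integrable_of_le_norm_fderiv_pow hi hφc.isCompact hφU
      (a := (B / (d / 4)) ^ N * A ^ N) ?_ ?_ ?_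
    · refine ((measurable_fderiv ℝ φ).norm.pow_const _).aestronglyMeasurable.mul ?_
      have hc : ContinuousOn (fun x => 1 * ‖f x - c‖ ^ N) (tsupport φ) :=
        continuousOn_const.mul (((hf.continuousOn.mono hφU).sub continuousOn_const).norm.pow N)
      exact hc.aestronglyMeasurable hφc.isCompact.measurableSet
    · intro x hx
      rw [Real.norm_of_nonneg (by positivity)]
      refine (hbd x).trans ?_
      rw [indicator_of_mem (hφs hx)]
      exact le_mul_of_one_le_right (by positivity)
        (by linarith [pow_nonneg (norm_nonneg (fderiv ℝ f x)) N])
    · intro x hx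
      rw [(hoff x hx).2, norm_zero, zero_pow (by lia), zero_mul]
  have key := h f (ball x₀ d) univ (fun y => y - c) φ 1 (fun _ => 1) (fun x => ‖fderiv ℝ f x‖)
    (fun x => ‖f x - c‖) isOpen_ball isOpen_univ hf hi
    (contDiff_id.sub contDiff_const).contDiffOn (mapsTo_univ _ _) hφ hφc hφU hφ0 (by simp)
    (fun _ _ => zero_le_one) (fun _ _ => norm_nonneg _) (fun _ _ => norm_nonneg _) ?_
    (fun x _ => by simp) hI1 hI2
  · have e1 : ∫ x in closedBall x₀ (d / 2), ‖fderiv ℝ f x‖ ^ N ∂μ ≤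
        ∫ x, φ x ^ N * (1 * ‖fderiv ℝ f x‖ ^ N) ∂μ := by
      calc ∫ x in closedBall x₀ (d / 2), ‖fderiv ℝ f x‖ ^ N ∂μ
          = ∫ x in closedBall x₀ (d / 2), φ x ^ N * (1 * ‖fderiv ℝ f x‖ ^ N) ∂μ := by
            refine setIntegral_congr_fun measurableSet_closedBall fun x hx => ?_
            simp [hφe x hx]
        _ ≤ _ := setIntegral_le_integral hI1 (Eventually.of_forall fun x =>
            mul_nonneg (pow_nonneg (hφ0 x) _) (by positivity))
    refine e1.trans (key.trans ?_)
    rw [mul_assoc]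
    refine mul_le_mul_of_nonneg_left ?_ hC
    refine (integral_mono hI2 hind hbd).trans (le_of_eq ?_)
    rw [integral_indicator measurableSet_closedBall, setIntegral_const, Measure.real,
      Measure.addHaar_closedBall _ _ (by positivity), ENNReal.toReal_mul,
      ENNReal.toReal_ofReal (by positivity), smul_eq_mul, ← Measure.real, ← hN]
    have : (3 * B) ^ N = (3 * d / 4) ^ N * (B / (d / 4)) ^ N := by
      rw [← mul_pow]
      congr 1
      field_simp
    rw [this]
    ring
  · filter_upwards [hqr] with x hx
    rw [trace_fderiv_sub_const, one_mul, one_mul]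
    refine hx.trans (mul_le_mul_of_nonneg_left ?_ hK)
    rcases hK.eq_or_lt with h0 | h0
    · have hz : ‖fderiv ℝ f x‖ ^ N = 0 := le_antisymm (by simpa [← h0] using hx) (by positivity)
      have hdet : (fderiv ℝ f x).det = 0 := by
        have := abs_det_le_norm_pow (fderiv ℝ f x)
        rw [← hN, hz] at this
        exact abs_nonpos_iff.1 this
      simp [hdet]
    · have hdet : 0 ≤ (fderiv ℝ f x).det := by
        have h1 : 0 ≤ ‖fderiv ℝ f x‖ ^ N := by positivity
        exact nonneg_of_mul_nonneg_right (h1.trans hx) h0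
      exact le_mul_of_one_le_left hdet (by exact_mod_cast hE)

theorem setLIntegral_lt_top_of_ball_bounds {E : Type*} [NormedAddCommGroup E]
    [NormedSpace ℝ E] [FiniteDimensional ℝ E] [MeasurableSpace E] [BorelSpace E]
    {μ : Measure E} [μ.IsAddHaarMeasure] {g : E → ℝ≥0∞} {S : Set E} {d : E → ℝ} {p : E} {s c : ℝ}
    (hd : ∀ x ∈ S, 0 < d x) (hds : ∀ x ∈ S, d x ≤ s) (hS : S ⊆ ball p s)
    (hg : ∀ x ∈ S, ∫⁻ y in closedBall x (d x / 2), g y ∂μ ≤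
      ENNReal.ofReal (c * d x ^ Module.finrank ℝ E)) (hc : 0 ≤ c) :
    ∫⁻ y in S, g y ∂μ < ∞ := by
  have hcE : CompleteSpace E := FiniteDimensional.complete ℝ E
  obtain ⟨u, huS, hdis, hcov⟩ := Vitali.exists_disjoint_subfamily_covering_enlargement_closedBall S
    (fun x => x) (fun x => d x / 10) (s / 10) (fun x hx => by linarith [hds x hx]) 5 (by norm_num)
  have hucount : u.Countable := by
    refine hdis.countable_of_nonempty_interior fun x hx => ?_
    exact ⟨x, ball_subset_interior_closedBall (mem_ball_self (by linarith [hd x (huS hx)]))⟩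
  have hcov2 : S ⊆ ⋃ x ∈ u, closedBall x (d x / 2) := by
    intro x hx
    obtain ⟨b, hb, hsub⟩ := hcov x hx
    refine mem_biUnion hb ?_
    have := hsub (mem_closedBall_self (by linarith [hd x hx]))
    rwa [show 5 * (d b / 10) = d b / 2 by ring] at this
  set N := Module.finrank ℝ E
  have hball : ∀ x ∈ S, ENNReal.ofReal (c * d x ^ N) =
      ENNReal.ofReal (c * 10 ^ N) * (μ (ball 0 1))⁻¹ * μ (closedBall x (d x / 10)) := by
    intro x hx
    rw [Measure.addHaar_closedBall _ _ (by linarith [hd x hx])]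
    have h1 : μ (ball (0 : E) 1) ≠ 0 := (measure_ball_pos μ _ one_pos).ne'
    have h2 : μ (ball (0 : E) 1) ≠ ∞ := measure_ball_lt_top.ne
    rw [mul_comm (ENNReal.ofReal ((d x / 10) ^ N)), ← mul_assoc, mul_assoc (ENNReal.ofReal _) _⁻¹,
      ENNReal.inv_mul_cancel h1 h2, mul_one, ← ENNReal.ofReal_mul (by positivity), mul_assoc,
      ← mul_pow, mul_div_cancel₀ _ (by norm_num)]
  calc ∫⁻ y in S, g y ∂μ ≤ ∫⁻ y in ⋃ x ∈ u, closedBall x (d x / 2), g y ∂μ :=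
        lintegral_mono_set hcov2
    _ ≤ ∑' x : u, ∫⁻ y in closedBall (x : E) (d x / 2), g y ∂μ := by
        have := hucount.to_subtype
        rw [biUnion_eq_iUnion]
        exact lintegral_iUnion_le _ _
    _ ≤ ∑' x : u, ENNReal.ofReal (c * 10 ^ N) * (μ (ball 0 1))⁻¹ *
          μ (closedBall (x : E) (d x / 10)) :=
        ENNReal.tsum_le_tsum fun x => (hg x (huS x.2)).trans (hball x (huS x.2)).le
    _ = ENNReal.ofReal (c * 10 ^ N) * (μ (ball 0 1))⁻¹ *
          μ (⋃ x ∈ u, closedBall (x : E) (d x / 10)) := by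
        rw [ENNReal.tsum_mul_left, measure_biUnion hucount hdis
          (fun _ _ => measurableSet_closedBall)]
    _ ≤ ENNReal.ofReal (c * 10 ^ N) * (μ (ball 0 1))⁻¹ * μ (ball p (2 * s)) := by
        refine mul_le_mul_right (measure_mono (iUnion₂_subset fun x hx => ?_)) _
        refine closedBall_subset_ball' ?_
        have h1 := hS (huS hx)
        rw [mem_ball] at h1
        have := hds x (huS hx)
        have := hd x (huS hx)
        linarith
    _ < ∞ := by
        refine ENNReal.mul_lt_top (ENNReal.mul_lt_top ENNReal.ofReal_lt_top ?_)
          measure_ball_lt_top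
        exact ENNReal.inv_lt_top.2 (measure_ball_pos μ _ one_pos)

theorem norm_fderiv_le_of_dist_le {E : Type*} [NormedAddCommGroup E] [NormedSpace ℝ E]
    {f : E → E} {Ω : Set E} (hΩ : IsOpen Ω) (hf : DifferentiableOn ℝ f Ω) {x : E} (hx : x ∈ Ω)
    {m δ : ℝ} (hm : 0 ≤ m) (hδ : 0 < δ)
    (h : ∀ y ∈ Ω, dist y x < δ → dist (f y) (f x) ≤ m * dist y x) : ‖fderiv ℝ f x‖ ≤ m := by
  refine ((hf x hx).differentiableAt (hΩ.mem_nhds hx)).hasFDerivAt.le_of_lip' hm ?_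
  filter_upwards [hΩ.mem_nhds hx, ball_mem_nhds x hδ] with y hy hyx
  have := h y hy hyx
  rwa [dist_eq_norm, dist_eq_norm] at this

/-- By the Baire category theorem, an everywhere differentiable map satisfies a uniform Lipschitz
type condition on a relatively open piece of any nonempty relatively closed set. -/
theorem exists_ball_uniform_dist_le {E : Type*} [NormedAddCommGroup E] [NormedSpace ℝ E]
    [FiniteDimensional ℝ E] {f : E → E} {Ω P : Set E} (hΩ : IsOpen Ω)
    (hf : DifferentiableOn ℝ f Ω) (hPΩ : P ⊆ Ω) (hP : IsGδ P) (hne : P.Nonempty) :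
    ∃ p ∈ P, ∃ s m : ℝ, 0 < s ∧ 0 < m ∧ ∀ x ∈ P, dist x p < s → ∀ y ∈ Ω, dist y x < 1 / m →
      dist (f y) (f x) ≤ m * dist y x := by
  have hprop : ProperSpace E := FiniteDimensional.proper ℝ E
  have hB : BaireSpace P := hP.baireSpace_of_t2Space_locallyCompactSpace
  have hneP : Nonempty P := hne.to_subtype
  let S : ℕ → Set P := fun m => {x | ∀ y ∈ Ω, dist y x < 1 / ((m : ℝ) + 1) →
    dist (f y) (f x) ≤ ((m : ℝ) + 1) * dist y x}
  have hfP : Continuous fun x : P => f x :=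
    continuousOn_iff_continuous_domRestrict.1 (hf.continuousOn.mono hPΩ)
  have hSc : ∀ m, IsClosed (S m) := by
    intro m
    simp only [S, ofPred_forall]
    refine isClosed_iInter fun y => isClosed_iInter fun _ => ?_
    refine isClosed_imp ?_ ?_
    · exact isOpen_lt (continuous_const.dist continuous_subtype_val) continuous_const
    · exact isClosed_le (continuous_const.dist hfP)
        (continuous_const.mul (continuous_const.dist continuous_subtype_val))
  have hSU : ⋃ m, S m = univ := by
    refine eq_univ_of_forall fun x => mem_iUnion.2 ?_
    have hx := ((hf x (hPΩ x.2)).differentiableAt (hΩ.mem_nhds (hPΩ x.2))).hasFDerivAt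
    obtain ⟨c, hc⟩ := hx.isBigO_sub.bound
    obtain ⟨ε, hε, hεs⟩ := Metric.eventually_nhds_iff_ball.1 hc
    obtain ⟨m, hm⟩ := exists_nat_gt (max c (1 / ε))
    refine ⟨m, fun y _ hyx => ?_⟩
    have h1 : c < m := (le_max_left _ _).trans_lt hm
    have h2 : 1 / ε < m := (le_max_right _ _).trans_lt hm
    have h3 : 1 / ((m : ℝ) + 1) < ε := by
      rw [div_lt_comm₀ (by positivity) hε]
      linarith
    have := hεs y (hyx.trans h3)
    rw [← dist_eq_norm, ← dist_eq_norm] at this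
    exact this.trans (mul_le_mul_of_nonneg_right (by linarith) dist_nonneg)
  obtain ⟨m, p, hp⟩ := nonempty_interior_of_iUnion_of_closed hSc hSU
  obtain ⟨s, hs, hsub⟩ := Metric.mem_nhds_iff.1 (mem_interior_iff_mem_nhds.1 hp)
  exact ⟨p, p.2, s, m + 1, hs, by positivity, fun x hx hxp => hsub (a := ⟨x, hx⟩) hxp⟩

/-- An everywhere differentiable quasiregular map has locally integrable `‖Df‖ ^ n`. -/
theorem locallyIntegrableOn_norm_fderiv_pow {E : Type*} [NormedAddCommGroup E]
    [InnerProductSpace ℝ E] [FiniteDimensional ℝ E] [MeasurableSpace E] [BorelSpace E]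
    (μ : Measure E) [μ.IsAddHaarMeasure] (hE : 1 ≤ Module.finrank ℝ E) {K : ℝ} (hK : 0 ≤ K)
    {f : E → E} {Ω : Set E} (hΩ : IsOpen Ω) (hf : DifferentiableOn ℝ f Ω)
    (hqr : ∀ᵐ x ∂(μ.restrict Ω), ‖fderiv ℝ f x‖ ^ Module.finrank ℝ E ≤
      K * (fderiv ℝ f x).det) :
    LocallyIntegrableOn (fun x => ‖fderiv ℝ f x‖ ^ Module.finrank ℝ E) Ω μ := by
  have hcE : CompleteSpace E := FiniteDimensional.complete ℝ E
  set N := Module.finrank ℝ E with hN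
  let g : E → ℝ := fun x => ‖fderiv ℝ f x‖ ^ N
  have hgm : Measurable g := (measurable_fderiv ℝ f).norm.pow_const N
  have hg0 : ∀ x, 0 ≤ g x := fun x => by positivity
  let G : Set E := {x | IntegrableAtFilter g (𝓝 x) μ}
  have hGo : IsOpen G := by
    rw [isOpen_iff_mem_nhds]
    rintro x ⟨s, hs, hi⟩
    obtain ⟨t, hts, hto, hxt⟩ := _root_.mem_nhds_iff.1 hs
    exact _root_.mem_nhds_iff.2 ⟨t, fun y hy => ⟨t, hto.mem_nhds hy, hi.mono_set hts⟩, hto, hxt⟩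
  suffices hP : Ω ⊆ G by
    intro x hx
    exact (hP hx).filter_mono nhdsWithin_le_nhds
  by_contra hcon
  obtain ⟨p, hp, s₀, m, hs₀, hm, hLip⟩ := exists_ball_uniform_dist_le (P := Ω ∩ Gᶜ) hΩ hf
    inter_subset_left (hΩ.isGδ.inter hGo.isClosed_compl.isGδ) (by
      obtain ⟨x, hx, hxG⟩ := not_subset.1 hcon
      exact ⟨x, hx, hxG⟩)
  obtain ⟨s₁, hs₁, hs₁Ω⟩ := Metric.isOpen_iff.1 hΩ p hp.1
  obtain ⟨s, hs, hss₀, hss₁, hsm⟩ : ∃ s, 0 < s ∧ s ≤ s₀ ∧ s ≤ s₁ ∧ s ≤ 1 / m :=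
    ⟨min s₀ (min s₁ (1 / m)), by positivity, min_le_left _ _,
      (min_le_right _ _).trans (min_le_left _ _), (min_le_right _ _).trans (min_le_right _ _)⟩
  have hballΩ : ball p s ⊆ Ω := (ball_subset_ball hss₁).trans hs₁Ω
  obtain ⟨C, hC, hCac⟩ := exists_setIntegral_norm_fderiv_pow_le E μ hE K hK
  apply hp.2
  have hmem : ball p (s / 8) ∈ 𝓝 p := ball_mem_nhds p (by positivity)
  refine ⟨ball p (s / 8), hmem, ?_⟩
  have h1 : IntegrableOn g (ball p (s / 8) ∩ Gᶜ) μ := by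
    refine Measure.integrableOn_of_bounded (M := m ^ N)
      ((measure_mono inter_subset_left).trans_lt measure_ball_lt_top).ne
      hgm.aestronglyMeasurable ?_
    rw [ae_restrict_iff' (measurableSet_ball.inter hGo.isClosed_compl.measurableSet)]
    refine Eventually.of_forall fun x hx => ?_
    have hxΩ : x ∈ Ω := hballΩ (ball_subset_ball (by linarith) hx.1)
    have hxs : dist x p < s₀ := (mem_ball.1 hx.1).trans (by linarith)
    rw [Real.norm_of_nonneg (hg0 x)]
    exact pow_le_pow_left₀ (norm_nonneg _) (norm_fderiv_le_of_dist_le hΩ hf hxΩ hm.le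
      (by positivity) (hLip x ⟨hxΩ, hx.2⟩ hxs)) N
  have h2 : IntegrableOn g (ball p (s / 8) ∩ G) μ := by
    have hclosed : IsClosed (Gᶜ ∩ closedBall p (s / 4)) :=
      hGo.isClosed_compl.inter isClosed_closedBall
    have hpQ : p ∈ Gᶜ ∩ closedBall p (s / 4) := ⟨hp.2, mem_closedBall_self (by positivity)⟩
    set Q := Gᶜ ∩ closedBall p (s / 4) with hQ
    have hd : ∀ x ∈ ball p (s / 8) ∩ G, 0 < infDist x Q := fun x hx =>
      (hclosed.notMem_iff_infDist_pos ⟨p, hpQ⟩).1 fun h => h.1 hx.2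
    have hds : ∀ x ∈ ball p (s / 8) ∩ G, infDist x Q ≤ s / 8 := fun x hx =>
      (infDist_le_dist_of_mem hpQ).trans (mem_ball.1 hx.1).le
    have hlt : ∫⁻ y in ball p (s / 8) ∩ G, ENNReal.ofReal (g y) ∂μ < ∞ := by
      refine setLIntegral_lt_top_of_ball_bounds (d := fun x => infDist x Q) (p := p) (s := s / 8)
        (c := C * (3 * m) ^ N) hd hds inter_subset_left ?_ (by positivity)
      intro x hx
      obtain ⟨q, hq, hxq⟩ := (infDist_lt_iff (r := 2 * infDist x Q) ⟨p, hpQ⟩).1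
        (by linarith [hd x hx])
      have hdx := hd x hx
      have hdsx := hds x hx
      have hxp := mem_ball.1 hx.1
      have hsubB : ball x (infDist x Q) ⊆ ball p (s / 4) := ball_subset_ball' (by linarith)
      have hsubΩ : ball x (infDist x Q) ⊆ Ω :=
        (hsubB.trans (ball_subset_ball (by linarith))).trans hballΩ
      have hsubG : ball x (infDist x Q) ⊆ G := by
        intro y hy
        by_contra hyG
        have h3 : infDist x Q ≤ dist x y :=
          infDist_le_dist_of_mem ⟨hyG, ball_subset_closedBall (hsubB hy)⟩
        rw [mem_ball, dist_comm] at hy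
        linarith
      have hqp : dist q p ≤ s / 4 := mem_closedBall.1 hq.2
      have hqΩ : q ∈ Ω := hballΩ (by rw [mem_ball]; linarith)
      have hbound : ∀ y ∈ ball x (infDist x Q), ‖f y - f q‖ ≤ m * (3 * infDist x Q) := by
        intro y hy
        have h4 : dist y q < 3 * infDist x Q := by
          have := dist_triangle y x q
          rw [mem_ball] at hy
          linarith
        have h5 := hLip q ⟨hqΩ, hq.1⟩ (by linarith) y (hsubΩ hy) (by linarith)
        rw [← dist_eq_norm]
        exact h5.trans (mul_le_mul_of_nonneg_left h4.le hm.le)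
      have hloc : LocallyIntegrableOn g (ball x (infDist x Q)) μ := fun y hy =>
        (show IntegrableAtFilter g (𝓝 y) μ from hsubG hy).filter_mono nhdsWithin_le_nhds
      have key := hCac f x (f q) (infDist x Q) _ hdx (hf.mono hsubΩ) hloc
        (ae_restrict_of_ae_restrict_of_subset hsubΩ hqr) hbound
      have h_int : IntegrableOn g (closedBall x (infDist x Q / 2)) μ :=
        hloc.integrableOn_compact_subset (closedBall_subset_ball (by linarith))
          (isCompact_closedBall _ _)
      rw [← ofReal_integral_eq_lintegral_ofReal h_int (Eventually.of_forall hg0)]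
      refine ENNReal.ofReal_le_ofReal (key.trans (le_of_eq ?_))
      rw [mul_assoc, ← mul_pow]
      congr 2
      ring
    refine ⟨hgm.aestronglyMeasurable, ?_⟩
    rw [hasFiniteIntegral_iff_ofReal (Eventually.of_forall hg0)]
    exact hlt
  have := h1.union h2
  rwa [← inter_union_distrib_left, compl_union_self, inter_univ] at this

theorem hasDerivAt_max_zero_sq (s : ℝ) :
    HasDerivAt (fun x : ℝ => max x 0 ^ 2) (2 * max s 0) s := by
  rcases lt_trichotomy s 0 with hs | rfl | hs
  · rw [max_eq_right hs.le, mul_zero]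
    refine (hasDerivAt_const s (0 : ℝ)).congr_of_eventuallyEq ?_
    filter_upwards [gt_mem_nhds hs] with x hx
    simp [max_eq_right hx.le]
  · rw [max_self, mul_zero, hasDerivAt_iff_isLittleO]
    have h : (fun x : ℝ => x ^ 2) =o[𝓝 0] (fun x : ℝ => x) := by
      simpa using Asymptotics.isLittleO_pow_pow (𝕜 := ℝ) (show 1 < 2 by norm_num)
    refine (Asymptotics.IsBigO.of_norm_le fun x => ?_).trans_isLittleO (by simpa using h)
    rcases le_total x 0 with hx | hx <;> simp [hx, sq_nonneg]
  · rw [max_eq_left hs.le]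
    have h : HasDerivAt (fun x : ℝ => x ^ 2) (2 * s) s := by simpa using hasDerivAt_pow 2 s
    refine h.congr_of_eventuallyEq ?_
    filter_upwards [lt_mem_nhds hs] with x hx
    simp [max_eq_left hx.le]

theorem contDiff_max_zero_sq : ContDiff ℝ 1 (fun x : ℝ => max x 0 ^ 2) := by
  refine contDiff_one_iff_deriv.2 ⟨fun s => (hasDerivAt_max_zero_sq s).differentiableAt, ?_⟩
  rw [show deriv (fun x : ℝ => max x 0 ^ 2) = fun s => 2 * max s 0 from
    funext fun s => (hasDerivAt_max_zero_sq s).deriv]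
  fun_prop

section LogNorm

variable {E : Type*} [NormedAddCommGroup E] [InnerProductSpace ℝ E]

theorem hasFDerivAt_log_norm {y : E} (hy : y ≠ 0) :
    HasFDerivAt (fun z : E => Real.log ‖z‖) ((‖y‖ ^ 2)⁻¹ • innerSL ℝ y) y := by
  have hy2 : ‖y‖ ^ 2 ≠ 0 := pow_ne_zero _ (norm_ne_zero_iff.2 hy)
  have h := ((hasStrictFDerivAt_norm_sq y).hasFDerivAt.log hy2).const_mul (1 / 2 : ℝ)
  have e : (fun z : E => Real.log ‖z‖) = fun z => 1 / 2 * Real.log (‖z‖ ^ 2) := by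
    funext z
    rw [Real.log_pow]
    push_cast
    ring
  rw [e]
  have e2 : (1 / 2 : ℝ) • (‖y‖ ^ 2)⁻¹ • 2 • innerSL ℝ y = (‖y‖ ^ 2)⁻¹ • innerSL ℝ y := by
    rw [← ofNat_smul_eq_nsmul ℝ, smul_comm (‖y‖ ^ 2)⁻¹, smul_smul]
    norm_num
  rw [← e2]
  exact h

theorem trace_fderiv_log_norm_smul [FiniteDimensional ℝ E] {θ : ℝ → ℝ} {θ' : ℝ} {y : E}
    (hy : y ≠ 0) (hθ : HasDerivAt θ θ' (Real.log ‖y‖)) :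
    LinearMap.trace ℝ E (fderiv ℝ (fun z => θ (Real.log ‖z‖) • z) y) =
      Module.finrank ℝ E * θ (Real.log ‖y‖) + θ' := by
  have hψ : HasFDerivAt (fun z : E => θ (Real.log ‖z‖)) (θ' • ((‖y‖ ^ 2)⁻¹ • innerSL ℝ y)) y :=
    hθ.comp_hasFDerivAt y (hasFDerivAt_log_norm hy)
  have hs : HasFDerivAt (fun z : E => θ (Real.log ‖z‖) • z) _ y := hψ.smul (hasFDerivAt_id y)
  have hy2 : ‖y‖ ^ 2 ≠ 0 := pow_ne_zero _ (norm_ne_zero_iff.2 hy)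
  rw [hs.fderiv]
  have e : ((θ (Real.log ‖y‖) • ContinuousLinearMap.id ℝ E +
      (θ' • ((‖y‖ ^ 2)⁻¹ • innerSL ℝ y)).smulRight y : E →L[ℝ] E) : E →ₗ[ℝ] E) =
      θ (Real.log ‖y‖) • LinearMap.id +
      ((θ' • ((‖y‖ ^ 2)⁻¹ • innerSL ℝ y) : E →L[ℝ] ℝ) : E →ₗ[ℝ] ℝ).smulRight y := by
    ext z
    simp
  rw [e, map_add, map_smul, LinearMap.trace_id, LinearMap.trace_smulRight]
  simp only [smul_eq_mul, ContinuousLinearMap.coe_coe, _root_.smul_apply, innerSL_apply_apply,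
    real_inner_self_eq_norm_sq, inv_mul_cancel₀ hy2]
  ring

theorem contDiffOn_log_norm_smul {θ : ℝ → ℝ} (hθ : ContDiff ℝ 1 θ) :
    ContDiffOn ℝ 1 (fun z : E => θ (Real.log ‖z‖) • z) {0}ᶜ := by
  intro y hy
  have hy0 : y ≠ 0 := hy
  refine ContDiffAt.contDiffWithinAt ?_
  refine ContDiffAt.smul ?_ contDiffAt_id
  exact hθ.contDiffAt.comp y ((contDiffAt_norm ℝ hy0).log (norm_ne_zero_iff.2 hy0))

theorem norm_fderiv_log_norm_comp_le {f : E → E} {x : E} (hf : DifferentiableAt ℝ f x)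
    (h0 : f x ≠ 0) :
    HasFDerivAt (fun y => Real.log ‖f y‖) (fderiv ℝ (fun y => Real.log ‖f y‖) x) x ∧
      ‖fderiv ℝ (fun y => Real.log ‖f y‖) x‖ ≤ ‖fderiv ℝ f x‖ / ‖f x‖ := by
  have h : HasFDerivAt (fun y => Real.log ‖f y‖) _ x :=
    (hasFDerivAt_log_norm h0).comp x hf.hasFDerivAt
  refine ⟨h.differentiableAt.hasFDerivAt, ?_⟩
  rw [h.fderiv]
  refine (ContinuousLinearMap.opNorm_comp_le _ _).trans ?_
  have hp : 0 < ‖f x‖ := norm_pos_iff.2 h0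
  rw [norm_smul, innerSL_apply_norm, norm_inv, norm_pow, norm_norm]
  apply le_of_eq
  field_simp

end LogNorm

theorem exists_log_caccioppoli (E : Type*) [NormedAddCommGroup E]
    [InnerProductSpace ℝ E] [FiniteDimensional ℝ E] [MeasurableSpace E] [BorelSpace E]
    (μ : Measure E) [μ.IsAddHaarMeasure] (hE : 1 ≤ Module.finrank ℝ E) (K : ℝ) (hK : 0 ≤ K) :
    ∃ C : ℝ, 0 ≤ C ∧ ∀ (f : E → E) (U : Set E) (φ w : E → ℝ) (σ t : ℝ), IsOpen U →
      DifferentiableOn ℝ f U → (∀ x ∈ U, f x ≠ 0) →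
      (∀ᵐ x ∂(μ.restrict U), ‖fderiv ℝ f x‖ ^ Module.finrank ℝ E ≤
        K * (fderiv ℝ f x).det) →
      ContDiff ℝ 1 φ → HasCompactSupport φ → tsupport φ ⊆ U →
      (∀ x, 0 ≤ φ x) → (∀ x, φ x ≤ 1) → |σ| = 1 →
      (∀ x, w x = max (σ * Real.log ‖f x‖ - t) 0) →
      Integrable (fun x => φ x ^ Module.finrank ℝ E *
        (w x * (‖fderiv ℝ f x‖ / ‖f x‖) ^ Module.finrank ℝ E)) μ ∧
      Integrable (fun x => ‖fderiv ℝ φ x‖ ^ Module.finrank ℝ E *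
        (w x * w x ^ Module.finrank ℝ E)) μ ∧
      ∫ x, φ x ^ Module.finrank ℝ E *
        (w x * (‖fderiv ℝ f x‖ / ‖f x‖) ^ Module.finrank ℝ E) ∂μ ≤
      C * ∫ x, ‖fderiv ℝ φ x‖ ^ Module.finrank ℝ E * (w x * w x ^ Module.finrank ℝ E) ∂μ := by
  have hcE : CompleteSpace E := FiniteDimensional.complete ℝ E
  obtain ⟨C, hC, h⟩ := exists_caccioppoli E μ hE K hK
  set N := Module.finrank ℝ E with hN
  refine ⟨C, hC, ?_⟩
  intro f U φ w σ t hU hf hf0 hqr hφ hφc hφU hφ0 hφ1 hσ hw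
  have hi : LocallyIntegrableOn (fun x => ‖fderiv ℝ f x‖ ^ N) U μ :=
    locallyIntegrableOn_norm_fderiv_pow μ hE hK hU hf hqr
  have hnf : ContinuousOn (fun x => ‖f x‖) U := hf.continuousOn.norm
  have hnf0 : ∀ x ∈ U, ‖f x‖ ≠ 0 := fun x hx => norm_ne_zero_iff.2 (hf0 x hx)
  have hwc : ContinuousOn w U := by
    have : w = fun x => max (σ * Real.log ‖f x‖ - t) 0 := funext hw
    rw [this]
    exact (((hnf.log hnf0).const_mul σ).sub continuousOn_const).sup continuousOn_const
  have hw0 : ∀ x, 0 ≤ w x := fun x => by rw [hw]; exact le_max_right _ _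
  have hoff : ∀ x, x ∉ tsupport φ → φ x = 0 ∧ fderiv ℝ φ x = 0 := fun x hx => by
    have h1 := notMem_tsupport_iff_eventuallyEq.1 hx
    exact ⟨h1.eq_of_nhds, by rw [h1.fderiv_eq]; simp⟩
  have hSm : MeasurableSet (tsupport φ) := hφc.isCompact.measurableSet
  have hI1 : Integrable (fun x => φ x ^ N * (w x * (‖fderiv ℝ f x‖ / ‖f x‖) ^ N)) μ := by
    have hq : ContinuousOn (fun x => w x * (‖f x‖⁻¹) ^ N) (tsupport φ) :=
      (hwc.mul ((hnf.inv₀ hnf0).pow N)).mono hφU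
    obtain ⟨a, ha⟩ := hφc.isCompact.exists_bound_of_continuousOn hq
    have e : ∀ x, φ x ^ N * (w x * (‖fderiv ℝ f x‖ / ‖f x‖) ^ N) =
        φ x ^ N * (‖fderiv ℝ f x‖ ^ N * (w x * (‖f x‖⁻¹) ^ N)) := fun x => by
      rw [div_eq_mul_inv, mul_pow]; ring
    simp_rw [e]
    refine IsCompact.integrable_of_le_norm_fderiv_pow hi hφc.isCompact hφU (a := a) ?_ ?_ ?_
    · exact (hφ.continuous.pow N).aestronglyMeasurable.mul
        (((measurable_fderiv ℝ f).norm.pow_const _).aestronglyMeasurable.mul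
        (hq.aestronglyMeasurable hSm))
    · intro x hx
      have h2 : 0 ≤ ‖fderiv ℝ f x‖ ^ N := by positivity
      have ha0 : 0 ≤ a := (norm_nonneg _).trans (ha x hx)
      rw [norm_mul, norm_mul, Real.norm_of_nonneg (pow_nonneg (hφ0 x) _), Real.norm_of_nonneg h2]
      calc φ x ^ N * (‖fderiv ℝ f x‖ ^ N * ‖w x * (‖f x‖⁻¹) ^ N‖)
          ≤ 1 * (‖fderiv ℝ f x‖ ^ N * a) := mul_le_mul (pow_le_one₀ (hφ0 x) (hφ1 x))
            (mul_le_mul_of_nonneg_left (ha x hx) h2) (by positivity) zero_le_one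
        _ ≤ _ := by nlinarith
    · intro x hx
      rw [(hoff x hx).1, zero_pow (by lia), zero_mul]
  have hI2 : Integrable (fun x => ‖fderiv ℝ φ x‖ ^ N * (w x * w x ^ N)) μ := by
    have hq : ContinuousOn (fun x => ‖fderiv ℝ φ x‖ ^ N * (w x * w x ^ N)) (tsupport φ) :=
      ((hφ.continuous_fderiv one_ne_zero).norm.pow N).continuousOn.mul
        ((hwc.mul (hwc.pow N)).mono hφU)
    have hio := hq.integrableOn_compact (μ := μ) hφc.isCompact
    rw [← integrable_indicator_iff hSm] at hio
    refine hio.congr (Eventually.of_forall fun x => ?_)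
    by_cases hx : x ∈ tsupport φ
    · rw [indicator_of_mem hx]
    · rw [indicator_of_notMem hx]
      simp only [(hoff x hx).2, norm_zero, zero_pow (show N ≠ 0 by lia), zero_mul]
  refine ⟨hI1, hI2, ?_⟩
  let θ : ℝ → ℝ := fun s => max (σ * s - t) 0 ^ 2 * Real.exp (-(N * s))
  have hθ : ContDiff ℝ 1 θ := by
    refine (contDiff_max_zero_sq.comp ((contDiff_const.mul contDiff_id).sub contDiff_const)).mul ?_
    exact Real.contDiff_exp.comp (contDiff_const.mul contDiff_id).neg
  have hθd : ∀ s, HasDerivAt θ (2 * max (σ * s - t) 0 * σ * Real.exp (-(N * s)) - N * θ s) s := by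
    intro s
    have h1 : HasDerivAt (fun s => σ * s - t) σ s := by
      simpa using ((hasDerivAt_id s).const_mul σ).sub_const t
    have h2 : HasDerivAt (fun s : ℝ => max (σ * s - t) 0 ^ 2) (2 * max (σ * s - t) 0 * σ) s :=
      HasDerivAt.comp (h₂ := fun x : ℝ => max x 0 ^ 2) s (hasDerivAt_max_zero_sq (σ * s - t)) h1
    have h3 : HasDerivAt (fun s : ℝ => Real.exp (-(N * s))) (Real.exp (-(N * s)) * -(N : ℝ)) s := by
      simpa using ((hasDerivAt_id s).const_mul (N : ℝ)).neg.exp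
    have h4 : HasDerivAt θ _ s := h2.mul h3
    refine h4.congr_deriv ?_
    simp only [θ]
    ring
  have hexp : ∀ x ∈ U, Real.exp (-(N * Real.log ‖f x‖)) = (‖f x‖ ^ N)⁻¹ := fun x hx => by
    have hp : 0 < ‖f x‖ := norm_pos_iff.2 (hf0 x hx)
    rw [Real.exp_neg, mul_comm, Real.exp_mul, Real.exp_log hp, Real.rpow_natCast]
  have hσ2 : σ * σ = 1 := by
    rw [← abs_mul_abs_self, hσ, one_mul]
  refine h f U {0}ᶜ (fun z => θ (Real.log ‖z‖) • z) φ σ w (fun x => ‖fderiv ℝ f x‖ / ‖f x‖) w hU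
    isOpen_compl_singleton hf hi (contDiffOn_log_norm_smul hθ) (fun x hx => hf0 x hx) hφ hφc hφU
    hφ0 hσ (fun x _ => hw0 x) (fun x _ => by positivity) (fun x _ => hw0 x) ?_ ?_ hI1 hI2
  · filter_upwards [hqr, ae_restrict_mem hU.measurableSet] with x hx hxU
    rw [trace_fderiv_log_norm_smul (hf0 x hxU) (hθd _), hexp x hxU, add_sub_cancel, ← hw x, div_pow]
    have hp : 0 < ‖f x‖ ^ N := by have := norm_pos_iff.2 (hf0 x hxU); positivity
    have h2 : 0 ≤ ‖fderiv ℝ f x‖ ^ N := by positivity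
    have e : K * (σ * (2 * w x * σ * (‖f x‖ ^ N)⁻¹) * (fderiv ℝ f x).det) =
        2 * (w x * (K * (fderiv ℝ f x).det / ‖f x‖ ^ N)) := by
      rw [div_eq_mul_inv]
      linear_combination (2 * K * w x * (‖f x‖ ^ N)⁻¹ * (fderiv ℝ f x).det) * hσ2
    rw [e]
    have h3 : w x * (‖fderiv ℝ f x‖ ^ N / ‖f x‖ ^ N) ≤
        w x * (K * (fderiv ℝ f x).det / ‖f x‖ ^ N) :=
      mul_le_mul_of_nonneg_left (div_le_div_of_nonneg_right hx hp.le) (hw0 x)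
    have h4 : 0 ≤ w x * (‖fderiv ℝ f x‖ ^ N / ‖f x‖ ^ N) := mul_nonneg (hw0 x) (by positivity)
    linarith
  · intro x hx
    have hp : 0 < ‖f x‖ := norm_pos_iff.2 (hf0 x hx)
    simp only [θ]
    rw [hexp x hx, ← hw x, norm_smul, Real.norm_of_nonneg (by positivity), div_pow]
    apply le_of_eq
    obtain ⟨m, hm⟩ : ∃ m, N = m + 1 := ⟨N - 1, by lia⟩
    rw [hm, Nat.add_sub_cancel]
    field_simp
    ring

theorem le_pow_mul_pow_add_inv {X l : ℝ} (hX : 0 ≤ X) (hl : 0 < l) {N : ℕ} (hN : 1 ≤ N) :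
    X ≤ l ^ (N - 1) * X ^ N + l⁻¹ := by
  rcases le_total X l⁻¹ with h | h
  · have : 0 ≤ l ^ (N - 1) * X ^ N := by positivity
    linarith
  · have h1 : 1 ≤ l * X := by
      have := mul_le_mul_of_nonneg_left h hl.le
      rwa [mul_inv_cancel₀ hl.ne'] at this
    have h2 : 1 ≤ (l * X) ^ (N - 1) := one_le_pow₀ h1
    have h3 : l ^ (N - 1) * X ^ N = X * (l * X) ^ (N - 1) := by
      obtain ⟨m, rfl⟩ : ∃ m, N = m + 1 := ⟨N - 1, by lia⟩
      rw [Nat.add_sub_cancel, mul_pow]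
      ring
    have h4 : 0 < l⁻¹ := inv_pos.2 hl
    rw [h3]
    nlinarith

theorem ContinuousOn.measurableSet_inter_lt {E : Type*} [TopologicalSpace E] [MeasurableSpace E]
    [BorelSpace E] {S : Set E} {g : E → ℝ} (hg : ContinuousOn g S) (hS : MeasurableSet S) (t : ℝ) :
    MeasurableSet {x ∈ S | t < g x} := by
  obtain ⟨V, hV, h⟩ := continuousOn_iff'.1 hg (Ioi t) isOpen_Ioi
  have : {x ∈ S | t < g x} = V ∩ S := by
    rw [← h]
    ext x
    simp [and_comm]
  rw [this]
  exact hV.measurableSet.inter hS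

theorem exists_superlevel_gradient_bound (E : Type*) [NormedAddCommGroup E]
    [InnerProductSpace ℝ E] [FiniteDimensional ℝ E] [MeasurableSpace E] [BorelSpace E]
    (μ : Measure E) [μ.IsAddHaarMeasure] (hE : 1 ≤ Module.finrank ℝ E) (K : ℝ) (hK : 0 ≤ K) :
    ∃ C : ℝ, 0 ≤ C ∧ ∀ (f : E → E) (U : Set E) (x₀ : E) (r' r σ t L : ℝ), IsOpen U →
      DifferentiableOn ℝ f U → (∀ x ∈ U, f x ≠ 0) →
      (∀ᵐ x ∂(μ.restrict U), ‖fderiv ℝ f x‖ ^ Module.finrank ℝ E ≤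
        K * (fderiv ℝ f x).det) →
      0 ≤ r' → r' < r → 0 < L → closedBall x₀ r ⊆ U → |σ| = 1 →
      (∀ x ∈ closedBall x₀ r, σ * Real.log ‖f x‖ - t ≤ L) →
      ∃ g : E → ℝ, Differentiable ℝ g ∧ HasCompactSupport g ∧
        Integrable (fun x => ‖fderiv ℝ g x‖) μ ∧
        (∀ x ∈ closedBall x₀ r', g x = max (σ * Real.log ‖f x‖ - t) 0 ^ 2) ∧
        ∫ x, ‖fderiv ℝ g x‖ ∂μ ≤ C * (L ^ 2 / (r - r')) *
          μ.real {x ∈ closedBall x₀ r | t < σ * Real.log ‖f x‖} := by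
  have hcE : CompleteSpace E := FiniteDimensional.complete ℝ E
  obtain ⟨C, hC, h⟩ := exists_log_caccioppoli E μ hE K hK
  obtain ⟨B, hB0, hB⟩ := exists_radial_cutoff
  set N := Module.finrank ℝ E with hN
  refine ⟨2 * (C * B ^ N) + 2 + N * B, by positivity, ?_⟩
  intro f U x₀ r' r σ t L hU hf hf0 hqr hr'0 hr' hL hrU hσ hLe
  obtain ⟨φ, hφ, hφ0, hφ1, hφe, hφs, hφD⟩ := hB E x₀ r' r hr'0 hr'
  have hφc : HasCompactSupport φ :=
    HasCompactSupport.of_support_subset_isCompact (isCompact_closedBall _ _)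
      (subset_closure.trans hφs)
  have hφU : tsupport φ ⊆ U := hφs.trans hrU
  have hδ : 0 < r - r' := by linarith
  let w : E → ℝ := fun x => max (σ * Real.log ‖f x‖ - t) 0
  obtain ⟨hI1, hI2, hle⟩ := h f U φ w σ t hU hf hf0 hqr hφ hφc hφU hφ0 hφ1 hσ fun _ => rfl
  have hw0 : ∀ x, 0 ≤ w x := fun x => le_max_right _ _
  have hwL : ∀ x ∈ closedBall x₀ r, w x ≤ L := fun x hx => max_le (hLe x hx) hL.le
  have hoff : ∀ x, x ∉ tsupport φ → φ x = 0 ∧ fderiv ℝ φ x = 0 := fun x hx => by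
    have h1 := notMem_tsupport_iff_eventuallyEq.1 hx
    exact ⟨h1.eq_of_nhds, by rw [h1.fderiv_eq]; simp⟩
  set A : Set E := {x ∈ closedBall x₀ r | t < σ * Real.log ‖f x‖} with hA
  have hAm : MeasurableSet A := by
    refine ContinuousOn.measurableSet_inter_lt ?_ measurableSet_closedBall t
    exact ((hf.continuousOn.mono hrU).norm.log fun x hx =>
      norm_ne_zero_iff.2 (hf0 x (hrU hx))).const_mul σ
  have hAf : μ A ≠ ∞ := ((measure_mono fun x hx => hx.1).trans_lt
    (measure_closedBall_lt_top (x := x₀) (r := r))).ne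
  have hwA : ∀ x ∈ closedBall x₀ r, x ∉ A → w x = 0 := fun x hx hxA => by
    refine max_eq_right ?_
    by_contra! hlt
    exact hxA ⟨hx, by linarith⟩
  -- the derivative of the truncated square
  have hφd : Differentiable ℝ φ := hφ.differentiable one_ne_zero
  have hφN : Differentiable ℝ (fun x => φ x ^ N) := hφd.pow N
  have hsub : tsupport (fun x => φ x ^ N) ⊆ tsupport φ := closure_mono fun x hx => by
    rw [Function.mem_support] at hx ⊢
    exact fun h0 => hx (by rw [h0, zero_pow (by lia)])
  have hDφ : ∀ x, ‖fderiv ℝ (fun x => φ x ^ N) x‖ = N * φ x ^ (N - 1) * ‖fderiv ℝ φ x‖ := by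
    intro x
    have h1 : HasFDerivAt (fun x => φ x ^ N) _ x := (hφd x).hasFDerivAt.pow N
    rw [h1.fderiv, norm_smul, Real.norm_of_nonneg]
    · simp
    · have := hφ0 x
      positivity
  have hw2 : ∀ x ∈ U, HasFDerivAt (fun x => w x ^ 2)
      ((2 * w x) • (σ • fderiv ℝ (fun y => Real.log ‖f y‖) x)) x := by
    intro x hx
    have hfx := (hf x hx).differentiableAt (hU.mem_nhds hx)
    have h1 : HasFDerivAt (fun x => σ * Real.log ‖f x‖ - t)
        (σ • fderiv ℝ (fun y => Real.log ‖f y‖) x) x :=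
      ((norm_fderiv_log_norm_comp_le hfx (hf0 x hx)).1.const_mul σ).sub_const t
    exact HasDerivAt.comp_hasFDerivAt (h₂ := fun x : ℝ => max x 0 ^ 2) x
      (hasDerivAt_max_zero_sq _) h1
  have hw2d : DifferentiableOn ℝ (fun x => w x ^ 2) U := fun x hx =>
    (hw2 x hx).differentiableAt.differentiableWithinAt
  have hg : ∀ x, HasFDerivAt (fun x => φ x ^ N • w x ^ 2) _ x := fun x =>
    hasFDerivAt_mul_of_tsupport hU hw2d hφN (hsub.trans hφU) x
  let W : E → ℝ := fun x => ‖fderiv ℝ f x‖ / ‖f x‖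
  let l : ℝ := (r - r') / L
  have hl : 0 < l := div_pos hδ hL
  let G : E → ℝ := fun x => 2 * l ^ (N - 1) * (φ x ^ N * (w x * W x ^ N)) +
    A.indicator (fun _ => 2 * l⁻¹ * L + N * (B / (r - r')) * L ^ 2) x
  have hindI : Integrable (A.indicator
      (fun _ => 2 * l⁻¹ * L + N * (B / (r - r')) * L ^ 2)) μ :=
    (integrableOn_const (hs := hAf) (hC := enorm_ne_top)).integrable_indicator hAm
  have hGI : Integrable G μ := (hI1.const_mul _).add hindI
  have hbd : ∀ x, ‖fderiv ℝ (fun x => φ x ^ N • w x ^ 2) x‖ ≤ G x := by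
    intro x
    have hW0 : 0 ≤ W x := by positivity
    have hGx : 0 ≤ 2 * l ^ (N - 1) * (φ x ^ N * (w x * W x ^ N)) :=
      mul_nonneg (by positivity) (mul_nonneg (pow_nonneg (hφ0 x) _)
        (mul_nonneg (hw0 x) (by positivity)))
    rw [(hg x).fderiv]
    by_cases hx : x ∈ tsupport φ
    · have hxr := hφs hx
      have hxU := hφU hx
      have h1 : ‖φ x ^ N • fderiv ℝ (fun x => w x ^ 2) x +
          (fderiv ℝ (fun x => φ x ^ N) x).smulRight (w x ^ 2)‖ ≤
          φ x ^ N * (2 * w x * W x) + N * φ x ^ (N - 1) * ‖fderiv ℝ φ x‖ * w x ^ 2 := by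
        refine (norm_add_le _ _).trans (add_le_add ?_ ?_)
        · rw [norm_smul, Real.norm_of_nonneg (pow_nonneg (hφ0 x) _), (hw2 x hxU).fderiv, norm_smul,
            norm_smul, Real.norm_eq_abs σ, hσ, one_mul, Real.norm_of_nonneg (by linarith [hw0 x])]
          exact mul_le_mul_of_nonneg_left (mul_le_mul_of_nonneg_left
            (norm_fderiv_log_norm_comp_le ((hf x hxU).differentiableAt (hU.mem_nhds hxU))
              (hf0 x hxU)).2 (by linarith [hw0 x])) (pow_nonneg (hφ0 x) _)
        · rw [ContinuousLinearMap.norm_smulRight_apply, hDφ, Real.norm_of_nonneg (by positivity)]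
      refine h1.trans ?_
      by_cases hxA : x ∈ A
      · simp only [G]
        rw [indicator_of_mem hxA, ← add_assoc]
        have hφN1 : φ x ^ N ≤ 1 := pow_le_one₀ (hφ0 x) (hφ1 x)
        have hφN0 : 0 ≤ φ x ^ N := pow_nonneg (hφ0 x) _
        refine add_le_add ?_ ?_
        · have h2 := le_pow_mul_pow_add_inv hW0 hl hE
          have h3 : φ x ^ N * w x ≤ 1 * L :=
            mul_le_mul hφN1 (hwL x hxr) (hw0 x) zero_le_one
          have h4 := mul_le_mul_of_nonneg_left h2 (mul_nonneg hφN0 (hw0 x))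
          have h5 := mul_le_mul_of_nonneg_right h3 (inv_pos.2 hl).le
          nlinarith
        · have h2 : φ x ^ (N - 1) ≤ 1 := pow_le_one₀ (hφ0 x) (hφ1 x)
          have h3 : w x ^ 2 ≤ L ^ 2 := pow_le_pow_left₀ (hw0 x) (hwL x hxr) 2
          refine mul_le_mul ?_ h3 (by positivity) (by positivity)
          refine mul_le_mul ?_ (hφD x) (norm_nonneg _) (by positivity)
          exact mul_le_of_le_one_right (by positivity) h2
      · rw [hwA x hxr hxA]
        simp only [G]
        rw [indicator_of_notMem hxA]
        simpa using hGx
    · have h1 : fderiv ℝ (fun x => φ x ^ N) x = 0 := by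
        rw [← norm_eq_zero, hDφ, (hoff x hx).2, norm_zero, mul_zero]
      rw [h1, (hoff x hx).1, zero_pow (by lia), zero_smul, zero_add,
        ContinuousLinearMap.norm_smulRight_apply, norm_zero, zero_mul]
      exact add_nonneg hGx (indicator_nonneg (fun _ _ => by positivity) x)
  have hDI : Integrable (fun x => ‖fderiv ℝ (fun x => φ x ^ N • w x ^ 2) x‖) μ :=
    hGI.mono' (measurable_fderiv ℝ _).norm.aestronglyMeasurable
      (Eventually.of_forall fun x => by rw [norm_norm]; exact hbd x)
  refine ⟨fun x => φ x ^ N • w x ^ 2, fun x => (hg x).differentiableAt, ?_, hDI, ?_, ?_⟩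
  · refine HasCompactSupport.of_support_subset_isCompact hφc.isCompact fun x hx => ?_
    by_contra hxs
    exact hx (by simp only [(hoff x hxs).1, zero_pow (show N ≠ 0 by lia), zero_smul])
  · intro x hx
    simp only [hφe x hx, one_pow, one_smul]
    rfl
  · have hE2 : ∫ x, ‖fderiv ℝ φ x‖ ^ N * (w x * w x ^ N) ∂μ ≤
        (B / (r - r')) ^ N * (L * L ^ N) * μ.real A := by
      have hi2 : Integrable (A.indicator fun _ => (B / (r - r')) ^ N * (L * L ^ N)) μ :=
        (integrableOn_const (hs := hAf) (hC := enorm_ne_top)).integrable_indicator hAm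
      refine (integral_mono hI2 hi2 fun x => ?_).trans (le_of_eq ?_)
      · by_cases hxA : x ∈ A
        · rw [indicator_of_mem hxA]
          have h2 := hwL x hxA.1
          have h3 := hw0 x
          exact mul_le_mul (pow_le_pow_left₀ (norm_nonneg _) (hφD x) N)
            (mul_le_mul h2 (pow_le_pow_left₀ h3 h2 N) (by positivity) hL.le)
            (by positivity) (by positivity)
        · rw [indicator_of_notMem hxA]
          by_cases hx : x ∈ tsupport φ
          · simp [hwA x (hφs hx) hxA]
          · simp only [(hoff x hx).2, norm_zero, zero_pow (show N ≠ 0 by lia), zero_mul, le_refl]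
      · rw [integral_indicator hAm, setIntegral_const, smul_eq_mul, mul_comm]
    calc ∫ x, ‖fderiv ℝ (fun x => φ x ^ N • w x ^ 2) x‖ ∂μ ≤ ∫ x, G x ∂μ :=
          integral_mono hDI hGI hbd
      _ = 2 * l ^ (N - 1) * ∫ x, φ x ^ N * (w x * W x ^ N) ∂μ +
          (2 * l⁻¹ * L + N * (B / (r - r')) * L ^ 2) * μ.real A := by
        simp only [G]
        rw [integral_add (hI1.const_mul _) hindI, integral_const_mul, integral_indicator hAm,
          setIntegral_const, smul_eq_mul, mul_comm (μ.real A)]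
      _ ≤ 2 * l ^ (N - 1) * (C * ((B / (r - r')) ^ N * (L * L ^ N) * μ.real A)) +
          (2 * l⁻¹ * L + N * (B / (r - r')) * L ^ 2) * μ.real A := by
        gcongr
        exact hle.trans (mul_le_mul_of_nonneg_left hE2 hC)
      _ = _ := by
        obtain ⟨m, hm⟩ : ∃ m, N = m + 1 := ⟨N - 1, by lia⟩
        rw [hm, Nat.add_sub_cancel]
        simp only [l]
        generalize r - r' = δ at hδ
        rw [div_pow, div_pow]
        field_simp
        ring

/-- A weak-type form of the Gagliardo–Nirenberg–Sobolev inequality for everywhere differentiable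
functions. -/
theorem exists_measureReal_pow_le_integral_fderiv (E : Type*) [NormedAddCommGroup E]
    [NormedSpace ℝ E] [FiniteDimensional ℝ E] [MeasurableSpace E] [BorelSpace E]
    (μ : Measure E) [μ.IsAddHaarMeasure] (hE : 2 ≤ Module.finrank ℝ E) :
    ∃ C : ℝ, 0 ≤ C ∧ ∀ (g : E → ℝ) (A : Set E) (a : ℝ), Differentiable ℝ g →
      HasCompactSupport g → Integrable (fun x => ‖fderiv ℝ g x‖) μ → MeasurableSet A → 0 < a →
      (∀ x ∈ A, a ≤ g x) →
      μ.real A ^ (Module.finrank ℝ E - 1) ≤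
        (C * ((∫ x, ‖fderiv ℝ g x‖ ∂μ) / a)) ^ Module.finrank ℝ E := by
  set N := Module.finrank ℝ E with hN
  have hN1 : (1 : ℝ) < N := by exact_mod_cast (show 1 < N by lia)
  have hpq : Real.HolderConjugate (N : ℝ) (Real.conjExponent N) :=
    Real.HolderConjugate.conjExponent hN1
  set p : ℝ := Real.conjExponent N with hp
  have hp0 : 0 < p := hpq.symm.pos
  have hpN : p * ((N - 1 : ℕ) : ℝ) = N := by
    rw [hp, Real.conjExponent, Nat.cast_sub (by lia)]
    have : (N : ℝ) - 1 ≠ 0 := by linarith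
    push_cast
    field_simp
  let c : ℝ≥0 := lintegralPowLePowLIntegralFDerivConst μ p
  refine ⟨max 1 c, by positivity, ?_⟩
  intro g A a hg hgc hgi hAm ha hA
  obtain ⟨Fs, G, hFs, hFc, hFt, -, hFG, hGi, -, hGint⟩ :=
    exists_smooth_approx (μ := μ) hg hgc le_rfl (by simpa using hgi)
  simp only [pow_one] at hFG hGint
  set J := ∫ x, ‖fderiv ℝ g x‖ ∂μ with hJ
  have hJ0 : 0 ≤ J := integral_nonneg fun x => norm_nonneg _
  have hk : ∀ k, ∫⁻ x, ‖Fs k x‖ₑ ^ p ∂μ ≤ c * ENNReal.ofReal J ^ p := by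
    intro k
    refine (lintegral_pow_le_pow_lintegral_fderiv μ (hFs k) (hFc k) hpq).trans ?_
    gcongr
    rw [← hGint k, ofReal_integral_eq_lintegral_ofReal (hGi k)
      (Eventually.of_forall fun x => (norm_nonneg _).trans (hFG k x))]
    refine lintegral_mono fun x => ?_
    rw [← ofReal_norm]
    exact ENNReal.ofReal_le_ofReal (hFG k x)
  have hlim : ∫⁻ x, ‖g x‖ₑ ^ p ∂μ ≤ c * ENNReal.ofReal J ^ p := by
    calc ∫⁻ x, ‖g x‖ₑ ^ p ∂μ = ∫⁻ x, liminf (fun k => ‖Fs k x‖ₑ ^ p) atTop ∂μ := by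
          refine lintegral_congr fun x => ?_
          exact (((ENNReal.continuous_rpow_const (y := p)).tendsto _).comp
            (hFt x).enorm).liminf_eq.symm
      _ ≤ liminf (fun k => ∫⁻ x, ‖Fs k x‖ₑ ^ p ∂μ) atTop :=
          lintegral_liminf_le fun k =>
            ((hFs k).continuous.measurable.enorm).pow_const p
      _ ≤ c * ENNReal.ofReal J ^ p :=
          liminf_le_of_le (by isBoundedDefault) fun b hb =>
            let ⟨k, hk'⟩ := hb.exists
            hk'.trans (hk k)
  have hch : ENNReal.ofReal a ^ p * μ A ≤ c * ENNReal.ofReal J ^ p := by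
    refine le_trans ?_ hlim
    rw [← setLIntegral_const]
    refine (setLIntegral_mono' hAm fun x hx => ?_).trans (setLIntegral_le_lintegral A _)
    rw [← ofReal_norm]
    gcongr
    exact (hA x hx).trans (le_abs_self _)
  have hreal : a ^ p * μ.real A ≤ c * J ^ p := by
    have h1 := ENNReal.toReal_mono (ENNReal.mul_ne_top ENNReal.coe_ne_top
      (ENNReal.rpow_ne_top_of_nonneg hp0.le ENNReal.ofReal_ne_top)) hch
    rw [ENNReal.toReal_mul, ENNReal.toReal_mul, ← ENNReal.toReal_rpow, ← ENNReal.toReal_rpow,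
      ENNReal.toReal_ofReal ha.le, ENNReal.toReal_ofReal hJ0] at h1
    exact h1
  have h2 : μ.real A ≤ c * (J / a) ^ p := by
    rw [Real.div_rpow hJ0 ha.le, ← mul_div_assoc, le_div_iff₀ (Real.rpow_pos_of_pos ha p)]
    linarith
  have h3 : μ.real A ≤ (max 1 (c : ℝ) * (J / a)) ^ p := by
    rw [Real.mul_rpow (by positivity) (by positivity)]
    refine h2.trans (mul_le_mul_of_nonneg_right ?_ (by positivity))
    exact (le_max_right 1 _).trans (Real.self_le_rpow_of_one_le (le_max_left _ _) hpq.symm.lt.le)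
  calc μ.real A ^ (N - 1) ≤ ((max 1 (c : ℝ) * (J / a)) ^ p) ^ (N - 1) :=
        pow_le_pow_left₀ measureReal_nonneg h3 _
    _ = _ := by
      rw [← Real.rpow_natCast, ← Real.rpow_mul (by positivity), hpN, Real.rpow_natCast]

theorem exists_superlevel_measure_le (E : Type*) [NormedAddCommGroup E]
    [InnerProductSpace ℝ E] [FiniteDimensional ℝ E] [MeasurableSpace E] [BorelSpace E]
    (μ : Measure E) [μ.IsAddHaarMeasure] (hE : 2 ≤ Module.finrank ℝ E) (K : ℝ) (hK : 0 ≤ K) :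
    ∃ C : ℝ, 0 < C ∧ ∀ (f : E → E) (U : Set E) (x₀ : E) (r' r σ t s L : ℝ), IsOpen U →
      DifferentiableOn ℝ f U → (∀ x ∈ U, f x ≠ 0) →
      (∀ᵐ x ∂(μ.restrict U), ‖fderiv ℝ f x‖ ^ Module.finrank ℝ E ≤
        K * (fderiv ℝ f x).det) →
      0 ≤ r' → r' < r → 0 < s → 0 < L → closedBall x₀ r ⊆ U → |σ| = 1 →
      (∀ x ∈ closedBall x₀ r, σ * Real.log ‖f x‖ - t ≤ L) →
      μ.real {x ∈ closedBall x₀ r' | t + s < σ * Real.log ‖f x‖} ^ (Module.finrank ℝ E - 1) ≤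
        (C * (L ^ 2 / ((r - r') * s ^ 2)) *
          μ.real {x ∈ closedBall x₀ r | t < σ * Real.log ‖f x‖}) ^ Module.finrank ℝ E := by
  obtain ⟨C₁, hC₁, h₁⟩ := exists_superlevel_gradient_bound E μ (by lia) K hK
  obtain ⟨C₂, hC₂, h₂⟩ := exists_measureReal_pow_le_integral_fderiv E μ hE
  refine ⟨C₂ * C₁ + 1, by positivity, ?_⟩
  intro f U x₀ r' r σ t s L hU hf hf0 hqr hr'0 hr' hs hL hrU hσ hLe
  obtain ⟨g, hg, hgc, hgi, hge, hgle⟩ := h₁ f U x₀ r' r σ t L hU hf hf0 hqr hr'0 hr' hL hrU hσ hLe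
  have hδ : 0 < r - r' := by linarith
  have hsub : closedBall x₀ r' ⊆ U := (closedBall_subset_closedBall hr'.le).trans hrU
  refine (h₂ g {x ∈ closedBall x₀ r' | t + s < σ * Real.log ‖f x‖} (s ^ 2) hg hgc hgi ?_
    (by positivity) ?_).trans ?_
  · refine ContinuousOn.measurableSet_inter_lt ?_ measurableSet_closedBall _
    exact ((hf.continuousOn.mono hsub).norm.log fun x hx =>
      norm_ne_zero_iff.2 (hf0 x (hsub hx))).const_mul σ
  · intro x hx
    rw [hge x hx.1]
    exact pow_le_pow_left₀ hs.le (le_max_of_le_left (by linarith [hx.2])) 2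
  · have hm : 0 ≤ μ.real {x ∈ closedBall x₀ r | t < σ * Real.log ‖f x‖} := measureReal_nonneg
    refine pow_le_pow_left₀ (mul_nonneg hC₂ (div_nonneg (integral_nonneg fun x => norm_nonneg _)
      (by positivity))) ?_ _
    calc C₂ * ((∫ x, ‖fderiv ℝ g x‖ ∂μ) / s ^ 2)
        ≤ C₂ * ((C₁ * (L ^ 2 / (r - r')) *
          μ.real {x ∈ closedBall x₀ r | t < σ * Real.log ‖f x‖}) / s ^ 2) := by gcongr
      _ = C₂ * C₁ * (L ^ 2 / ((r - r') * s ^ 2)) *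
          μ.real {x ∈ closedBall x₀ r | t < σ * Real.log ‖f x‖} := by
        field_simp
      _ ≤ _ := by
        gcongr
        linarith

theorem le_mul_pow_of_pow_succ_le {a : ℕ → ℝ} {D : ℝ} {N : ℕ} (hN : 2 ≤ N) (hD : 0 < D)
    (ha : ∀ k, 0 ≤ a k) (hrec : ∀ k, a (k + 1) ^ (N - 1) ≤ (D * 8 ^ k * a k) ^ N)
    (h0 : a 0 ≤ ((1 / 8 : ℝ) ^ N) ^ (N - 1) / D ^ N) (k : ℕ) :
    a k ≤ ((1 / 8 : ℝ) ^ N) ^ (N - 1) / D ^ N * ((1 / 8 : ℝ) ^ N) ^ k := by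
  induction k with
  | zero => simpa using h0
  | succ k ih =>
    refine le_of_pow_le_pow_left₀ (n := N - 1) (by lia) (by positivity) ((hrec k).trans ?_)
    refine (pow_le_pow_left₀ (mul_nonneg (by positivity) (ha k))
      (mul_le_mul_of_nonneg_left ih (by positivity)) N).trans (le_of_eq ?_)
    obtain ⟨m, rfl⟩ : ∃ m, N = m + 1 := ⟨N - 1, by lia⟩
    rw [Nat.add_sub_cancel]
    set q : ℝ := (1 / 8 : ℝ) ^ (m + 1) with hq
    have e : (8 ^ k : ℝ) ^ (m + 1) * q ^ k = 1 := by
      rw [hq, ← pow_mul, ← pow_mul, mul_comm (m + 1) k, ← mul_pow]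
      norm_num
    have e2 : (D * 8 ^ k * (q ^ m / D ^ (m + 1) * q ^ k)) ^ (m + 1) =
        ((8 ^ k : ℝ) ^ (m + 1) * q ^ k) * ((q ^ m / D ^ (m + 1)) ^ m *
          (D ^ (m + 1) * (q ^ m / D ^ (m + 1))) * (q ^ k) ^ m) := by
      rw [mul_pow, mul_pow, mul_pow, pow_succ (q ^ m / D ^ (m + 1)) m, pow_succ (q ^ k) m]
      ring
    rw [e2, e, one_mul, mul_div_cancel₀ _ (by positivity), mul_pow, pow_succ q k, mul_pow]
    ring

theorem exists_log_norm_le_of_measure_superlevel_le (E : Type*) [NormedAddCommGroup E]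
    [InnerProductSpace ℝ E] [FiniteDimensional ℝ E] [MeasurableSpace E] [BorelSpace E]
    (μ : Measure E) [μ.IsAddHaarMeasure] (hE : 2 ≤ Module.finrank ℝ E) (K : ℝ) (hK : 0 ≤ K)
    (Λ : ℝ) (hΛ : 0 < Λ) :
    ∃ ε : ℝ, 0 < ε ∧ ∀ (f : E → E) (U : Set E) (x₀ : E) (ρ σ t M : ℝ), IsOpen U →
      DifferentiableOn ℝ f U → (∀ x ∈ U, f x ≠ 0) →
      (∀ᵐ x ∂(μ.restrict U), ‖fderiv ℝ f x‖ ^ Module.finrank ℝ E ≤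
        K * (fderiv ℝ f x).det) →
      0 < ρ → 0 < M → closedBall x₀ ρ ⊆ U → |σ| = 1 →
      (∀ x ∈ closedBall x₀ ρ, σ * Real.log ‖f x‖ - t ≤ Λ * M) →
      μ.real {x ∈ closedBall x₀ ρ | t < σ * Real.log ‖f x‖} ≤ ε * ρ ^ Module.finrank ℝ E →
      σ * Real.log ‖f x₀‖ ≤ t + M := by
  obtain ⟨C, hC, h⟩ := exists_superlevel_measure_le E μ hE K hK
  set N := Module.finrank ℝ E with hN
  set D : ℝ := 16 * C * Λ ^ 2 with hDdef
  have hD : 0 < D := by positivity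
  refine ⟨((1 / 8 : ℝ) ^ N) ^ (N - 1) / D ^ N, by positivity, ?_⟩
  intro f U x₀ ρ σ t M hU hf hf0 hqr hρ hM hρU hσ hLe hε
  let r : ℕ → ℝ := fun k => ρ / 2 * (1 + (1 / 2) ^ k)
  let τ : ℕ → ℝ := fun k => t + M * (1 - (1 / 2) ^ k)
  have hp0 : ∀ k : ℕ, (0 : ℝ) < (1 / 2) ^ k := fun k => by positivity
  have hp1 : ∀ k : ℕ, ((1 : ℝ) / 2) ^ k ≤ 1 := fun k => pow_le_one₀ (by norm_num) (by norm_num)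
  have hrρ : ∀ k, r k ≤ ρ := fun k => by
    have := mul_le_mul_of_nonneg_left (hp1 k) hρ.le
    simp only [r]; linarith
  let S : ℕ → Set E := fun k => {x ∈ closedBall x₀ (r k) | τ k < σ * Real.log ‖f x‖}
  let a : ℕ → ℝ := fun k => μ.real (S k) / ρ ^ N
  have ha : ∀ k, 0 ≤ a k := fun k => div_nonneg measureReal_nonneg (by positivity)
  have hrec : ∀ k, a (k + 1) ^ (N - 1) ≤ (D * 8 ^ k * a k) ^ N := by
    intro k
    have hr0 : 0 ≤ r (k + 1) := by have := hp0 (k + 1); simp only [r]; positivity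
    have hrd : r k - r (k + 1) = ρ / 4 * (1 / 2) ^ k := by simp only [r]; ring
    have hr1 : r (k + 1) < r k := by
      have : 0 < ρ / 4 * (1 / 2) ^ k := by positivity
      linarith
    have key := h f U x₀ (r (k + 1)) (r k) σ (τ k) (M * (1 / 2) ^ (k + 1)) (Λ * M) hU hf hf0 hqr
      hr0 hr1 (by positivity) (by positivity)
      ((closedBall_subset_closedBall (hrρ k)).trans hρU) hσ (fun x hx => by
        have h1 := hLe x (closedBall_subset_closedBall (hrρ k) hx)
        have h2 : 0 ≤ M * (1 - (1 / 2) ^ k) := mul_nonneg hM.le (by linarith [hp1 k])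
        simp only [τ]
        linarith)
    have et : τ k + M * (1 / 2) ^ (k + 1) = τ (k + 1) := by simp only [τ]; ring
    have e8 : ((8 : ℝ) ^ k) * ((1 / 2) ^ k) ^ 3 = 1 := by
      rw [← pow_mul, mul_comm k 3, pow_mul, ← mul_pow]
      norm_num
    have eC : C * ((Λ * M) ^ 2 / ((r k - r (k + 1)) * (M * (1 / 2) ^ (k + 1)) ^ 2)) =
        D * 8 ^ k / ρ := by
      rw [hrd, pow_succ (1 / 2 : ℝ) k]
      have hz := hp0 k
      generalize ((1 : ℝ) / 2) ^ k = z at hz e8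
      rw [hDdef]
      field_simp
      linear_combination (-(16 : ℝ)) * e8
    rw [et, eC] at key
    have hAk : ∀ j, μ.real (S j) = a j * ρ ^ N := fun j => by
      simp only [a]
      field_simp
    change μ.real (S (k + 1)) ^ (N - 1) ≤ (D * 8 ^ k / ρ * μ.real (S k)) ^ N at key
    rw [hAk, hAk] at key
    obtain ⟨m, hm⟩ : ∃ m, N = m + 1 := ⟨N - 1, by lia⟩
    rw [hm, Nat.add_sub_cancel] at key ⊢
    have e1 : D * 8 ^ k / ρ * (a k * ρ ^ (m + 1)) = D * 8 ^ k * a k * ρ ^ m := by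
      field_simp
      ring
    rw [e1, mul_pow, mul_pow _ (ρ ^ m), ← pow_mul, ← pow_mul, mul_comm (m + 1) m] at key
    exact le_of_mul_le_mul_right key (by positivity)
  have h0 : a 0 ≤ ((1 / 8 : ℝ) ^ N) ^ (N - 1) / D ^ N := by
    simp only [a]
    rw [div_le_iff₀ (by positivity)]
    have e : S 0 = {x ∈ closedBall x₀ ρ | t < σ * Real.log ‖f x‖} := by
      have e1 : r 0 = ρ := by simp only [r]; ring
      have e2 : τ 0 = t := by simp only [τ]; ring
      simp only [S, e1, e2]
    rw [e]
    exact hε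
  have hak := le_mul_pow_of_pow_succ_le hE hD ha hrec h0
  have hcont : ContinuousOn (fun x => σ * Real.log ‖f x‖) U :=
    (hf.continuousOn.norm.log fun x hx => norm_ne_zero_iff.2 (hf0 x hx)).const_mul σ
  by_contra! hlt
  have hx₀U : x₀ ∈ U := hρU (mem_closedBall_self hρ.le)
  let T : Set E := ball x₀ (ρ / 2) ∩ {x | t + M < σ * Real.log ‖f x‖}
  have hT : T ∈ 𝓝 x₀ := inter_mem (ball_mem_nhds x₀ (by positivity))
    ((hcont.continuousAt (hU.mem_nhds hx₀U)).eventually (lt_mem_nhds hlt))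
  have hTpos : 0 < μ T := Measure.measure_pos_of_mem_nhds μ hT
  have hTS : ∀ k, T ⊆ S k := fun k x hx => by
    refine ⟨ball_subset_closedBall (ball_subset_ball ?_ hx.1), lt_of_le_of_lt ?_ hx.2⟩
    · have := mul_pos hρ (hp0 k)
      simp only [r]; linarith
    · have := mul_pos hM (hp0 k)
      simp only [τ]; linarith
  have hSf : ∀ k, μ (S k) ≠ ∞ := fun k => ((measure_mono fun x hx => hx.1).trans_lt
    (measure_closedBall_lt_top (x := x₀) (r := r k))).ne
  have hTr : 0 < μ.real T := ENNReal.toReal_pos hTpos.ne' (ne_top_of_le_ne_top (hSf 0)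
    (measure_mono (hTS 0)))
  have hTk : ∀ k, μ.real T / ρ ^ N ≤
      ((1 / 8 : ℝ) ^ N) ^ (N - 1) / D ^ N * ((1 / 8 : ℝ) ^ N) ^ k := fun k =>
    (div_le_div_of_nonneg_right (measureReal_mono (hTS k) (hSf k)) (by positivity)).trans (hak k)
  have hlim : Tendsto (fun k => ((1 / 8 : ℝ) ^ N) ^ (N - 1) / D ^ N * ((1 / 8 : ℝ) ^ N) ^ k)
      atTop (𝓝 0) := by
    simpa using (tendsto_pow_atTop_nhds_zero_of_lt_one (by positivity)
      (pow_lt_one₀ (by norm_num) (by norm_num : (1 / 8 : ℝ) < 1) (show N ≠ 0 by lia))).const_mul _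
  have hle := ge_of_tendsto' hlim hTk
  have : 0 < μ.real T / ρ ^ N := by positivity
  linarith

theorem enorm_sub_le_mul_lintegral_fderiv {E : Type*} [NormedAddCommGroup E] [NormedSpace ℝ E]
    [FiniteDimensional ℝ E] [MeasurableSpace E] [BorelSpace E] {u : E → ℝ} {x y : E}
    (hu : ∀ s ∈ Icc (0 : ℝ) 1, DifferentiableAt ℝ u ((1 - s) • x + s • y)) :
    ‖u y - u x‖ₑ ≤
      ‖y - x‖ₑ * ∫⁻ s in Ioc (0 : ℝ) 1, ‖fderiv ℝ u ((1 - s) • x + s • y)‖ₑ := by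
  let γ : ℝ → E := fun s => (1 - s) • x + s • y
  let g : ℝ → ℝ := fun s => fderiv ℝ u (γ s) (y - x)
  have hγc : Continuous γ := by fun_prop
  have hγd : ∀ s, HasDerivAt γ (y - x) s := fun s => by
    have h1 : HasDerivAt (fun s : ℝ => (1 - s) • x) (-(1 : ℝ) • x) s :=
      ((hasDerivAt_id s).const_sub 1).smul_const x
    have h2 : HasDerivAt (fun s : ℝ => s • y) ((1 : ℝ) • y) s := (hasDerivAt_id s).smul_const y
    have h3 : HasDerivAt γ _ s := h1.add h2
    refine h3.congr_deriv ?_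
    rw [neg_smul, one_smul, one_smul, neg_add_eq_sub]
  have hgm : Measurable g := (measurable_fderiv_apply_const ℝ u (y - x)).comp hγc.measurable
  have hle : ∫⁻ s in Ioc (0 : ℝ) 1, ‖g s‖ₑ ≤
      ‖y - x‖ₑ * ∫⁻ s in Ioc (0 : ℝ) 1, ‖fderiv ℝ u (γ s)‖ₑ := by
    rw [← lintegral_const_mul' _ _ enorm_ne_top]
    refine lintegral_mono fun s => ?_
    rw [mul_comm]
    exact ContinuousLinearMap.le_opENorm _ _
  refine le_trans ?_ hle
  by_cases hi : IntegrableOn g (Ioc 0 1)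
  · have hftc : ∫ s in (0 : ℝ)..1, g s = u y - u x := by
      have h := intervalIntegral.integral_eq_sub_of_hasDerivAt (a := 0) (b := 1)
        (f := fun s => u (γ s)) (f' := g) (fun s hs => by
          rw [uIcc_of_le zero_le_one] at hs
          exact (hu s hs).hasFDerivAt.comp_hasDerivAt s (hγd s))
        ((intervalIntegrable_iff_integrableOn_Ioc_of_le zero_le_one).2 hi)
      rw [h]
      simp [γ]
    rw [← hftc, intervalIntegral.integral_of_le zero_le_one]
    exact enorm_integral_le_lintegral_enorm _
  · have : ∫⁻ s in Ioc (0 : ℝ) 1, ‖g s‖ₑ = ∞ := by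
      by_contra hne
      exact hi ⟨hgm.aestronglyMeasurable, lt_top_iff_ne_top.2 hne⟩
    rw [this]
    exact le_top

theorem setLIntegral_comp_convexCombo_le {E : Type*} [NormedAddCommGroup E] [NormedSpace ℝ E]
    [FiniteDimensional ℝ E] [MeasurableSpace E] [BorelSpace E] (μ : Measure E)
    [μ.IsAddHaarMeasure] {G : E → ℝ≥0∞} (hG : Measurable G) {D : Set E} (hD : MeasurableSet D)
    (hDc : Convex ℝ D) {a : E} (ha : a ∈ D) {s s' : ℝ} (hs : 1 / 2 ≤ s) (hs' : 0 ≤ s')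
    (hss : s' + s = 1) :
    ∫⁻ y in D, G (s' • a + s • y) ∂μ ≤ 2 ^ Module.finrank ℝ E * ∫⁻ y in D, G y ∂μ := by
  have hs0 : 0 < s := by linarith
  have hm : Measurable (D.indicator G) := hG.indicator hD
  calc ∫⁻ y in D, G (s' • a + s • y) ∂μ = ∫⁻ y in D, D.indicator G (s' • a + s • y) ∂μ := by
        refine setLIntegral_congr_fun hD fun y hy => ?_
        rw [indicator_of_mem (hDc ha hy hs' hs0.le hss)]
    _ ≤ ∫⁻ y, D.indicator G (s' • a + s • y) ∂μ := setLIntegral_le_lintegral _ _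
    _ = ∫⁻ z, D.indicator G (s' • a + z) ∂(μ.map (s • ·)) :=
        (lintegral_map (hm.comp (measurable_const_add _)) (measurable_const_smul s)).symm
    _ = ENNReal.ofReal |(s ^ Module.finrank ℝ E)⁻¹| * ∫⁻ z, D.indicator G (s' • a + z) ∂μ := by
        rw [Measure.map_addHaar_smul μ hs0.ne', lintegral_smul_measure, smul_eq_mul]
    _ = ENNReal.ofReal |(s ^ Module.finrank ℝ E)⁻¹| * ∫⁻ y in D, G y ∂μ := by
        rw [lintegral_add_left_eq_self (D.indicator G), lintegral_indicator hD]
    _ ≤ _ := by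
        gcongr
        rw [abs_of_pos (by positivity), ← inv_pow]
        calc ENNReal.ofReal (s⁻¹ ^ Module.finrank ℝ E)
            ≤ ENNReal.ofReal (2 ^ Module.finrank ℝ E) := by
              gcongr
              rw [inv_le_comm₀ hs0 two_pos]
              linarith
          _ = _ := by rw [ENNReal.ofReal_pow zero_le_two, ENNReal.ofReal_ofNat]

/-- A Poincaré inequality on balls, with the mean replaced by the value at a suitable point. -/
theorem exists_setLIntegral_enorm_sub_le {E : Type*} [NormedAddCommGroup E] [NormedSpace ℝ E]
    [FiniteDimensional ℝ E] [MeasurableSpace E] [BorelSpace E] (μ : Measure E)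
    [μ.IsAddHaarMeasure] {u : E → ℝ} {p : E} {R : ℝ} (hR : 0 < R)
    (hu : DifferentiableOn ℝ u (ball p R)) :
    ∃ x ∈ ball p R, ∫⁻ y in ball p R, ‖u y - u x‖ₑ ∂μ ≤
      ENNReal.ofReal (2 * R) * 2 ^ Module.finrank ℝ E * ∫⁻ y in ball p R, ‖fderiv ℝ u y‖ₑ ∂μ := by
  set D := ball p R with hDdef
  have hDm : MeasurableSet D := measurableSet_ball
  have hDc : Convex ℝ D := convex_ball p R
  let G : E → ℝ≥0∞ := fun x => ‖fderiv ℝ u x‖ₑ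
  have hG : Measurable G := (measurable_fderiv ℝ u).enorm
  obtain ⟨J, hJ⟩ : ∃ J, 2 ^ Module.finrank ℝ E * ∫⁻ y in D, G y ∂μ = J := ⟨_, rfl⟩
  let F : (E × E) × ℝ → ℝ≥0∞ := fun q => G ((1 - q.2) • q.1.1 + q.2 • q.1.2)
  have hF : Measurable F := hG.comp (by fun_prop)
  let I : Set ℝ := Ioc 0 1
  let H : E → ℝ≥0∞ := fun x => ∫⁻ y in D, (∫⁻ s in I, F ((x, y), s)) ∂μ
  have hF1 : Measurable fun q : E × E => ∫⁻ s in I, F (q, s) := hF.lintegral_prod_right'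
  have hH : Measurable H := hF1.lintegral_prod_right'
  have hs : ∀ s ∈ I, ∫⁻ x in D, ∫⁻ y in D, F ((x, y), s) ∂μ ∂μ ≤ μ D * J := by
    intro s hs
    rcases le_total (1 / 2) s with h | h
    · have h1 : ∀ x ∈ D, ∫⁻ y in D, F ((x, y), s) ∂μ ≤ J := fun x hx => by
        have h2 := setLIntegral_comp_convexCombo_le μ hG hDm hDc hx h (sub_nonneg.2 hs.2)
          (sub_add_cancel 1 s)
        rw [← hJ]
        exact h2
      refine (setLIntegral_mono' hDm h1).trans (le_of_eq ?_)
      rw [setLIntegral_const, mul_comm]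
    · rw [lintegral_lintegral_swap (f := fun x y => F ((x, y), s))
        (hF.comp (f := fun q : E × E => (q, s)) (by fun_prop)).aemeasurable]
      have h1 : ∀ y ∈ D, ∫⁻ x in D, F ((x, y), s) ∂μ ≤ J := fun y hy => by
        have h2 := setLIntegral_comp_convexCombo_le μ hG hDm hDc hy (s := 1 - s) (s' := s)
          (by linarith) hs.1.le (add_sub_cancel s 1)
        simp_rw [add_comm (s • y)] at h2
        rw [← hJ]
        exact h2
      refine (setLIntegral_mono' hDm h1).trans (le_of_eq ?_)
      rw [setLIntegral_const, mul_comm]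
  have hHint : ∫⁻ x in D, H x ∂μ ≤ μ D * J := by
    calc ∫⁻ x in D, H x ∂μ
        = ∫⁻ x in D, (∫⁻ s in I, ∫⁻ y in D, F ((x, y), s) ∂μ) ∂μ := by
          refine lintegral_congr fun x => ?_
          exact lintegral_lintegral_swap (f := fun y s => F ((x, y), s))
            (hF.comp (f := fun q : E × ℝ => ((x, q.1), q.2)) (by fun_prop)).aemeasurable
      _ = ∫⁻ s in I, ∫⁻ x in D, ∫⁻ y in D, F ((x, y), s) ∂μ ∂μ := by
          refine lintegral_lintegral_swap (f := fun x s => ∫⁻ y in D, F ((x, y), s) ∂μ) ?_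
          have h2 : Measurable fun q : (E × ℝ) × E => F ((q.1.1, q.2), q.1.2) :=
            hF.comp (by fun_prop)
          exact (h2.lintegral_prod_right' (ν := μ.restrict D)).aemeasurable
      _ ≤ ∫⁻ s in I, μ D * J := setLIntegral_mono' measurableSet_Ioc hs
      _ = μ D * J := by
          rw [setLIntegral_const, Real.volume_Ioc]
          simp
  have hD0 : μ D ≠ 0 := (measure_ball_pos μ p hR).ne'
  have hDt : μ D ≠ ∞ := measure_ball_lt_top.ne
  obtain ⟨x, hx, hxle⟩ := exists_le_setLAverage hD0 hDt hH.aemeasurable.restrict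
  refine ⟨x, hx, ?_⟩
  have hHx : H x ≤ J := by
    refine hxle.trans ?_
    rw [setLAverage_eq]
    exact ENNReal.div_le_of_le_mul' hHint
  calc ∫⁻ y in D, ‖u y - u x‖ₑ ∂μ
      ≤ ∫⁻ y in D, ENNReal.ofReal (2 * R) * (∫⁻ s in I, F ((x, y), s)) ∂μ := by
        refine setLIntegral_mono' hDm fun y hy => ?_
        refine (enorm_sub_le_mul_lintegral_fderiv fun s hs => ?_).trans ?_
        · exact (hu _ (hDc hx hy (by linarith [hs.2]) hs.1 (by ring))).differentiableAt
            (isOpen_ball.mem_nhds (hDc hx hy (by linarith [hs.2]) hs.1 (by ring)))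
        · gcongr
          rw [← ofReal_norm]
          refine ENNReal.ofReal_le_ofReal ?_
          rw [← dist_eq_norm]
          have h1 := dist_triangle_right y x p
          have h2 : dist y p < R := hy
          have h3 : dist x p < R := hx
          linarith
    _ = ENNReal.ofReal (2 * R) * H x := lintegral_const_mul' _ _ ENNReal.ofReal_ne_top
    _ ≤ _ := by
        rw [mul_assoc]
        exact mul_le_mul_right (hHx.trans hJ.ge) _

theorem exists_log_norm_sub_le_of_lintegral_le (E : Type*) [NormedAddCommGroup E]
    [InnerProductSpace ℝ E] [FiniteDimensional ℝ E] [MeasurableSpace E] [BorelSpace E]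
    (μ : Measure E) [μ.IsAddHaarMeasure] (hE : 2 ≤ Module.finrank ℝ E) (K : ℝ) (hK : 0 ≤ K)
    (A : ℝ) (hA : 0 ≤ A) :
    ∃ C : ℝ, 0 ≤ C ∧ ∀ (f : E → E) (p : E) (R c σ : ℝ), 0 < R →
      DifferentiableOn ℝ f (ball p R) → (∀ x ∈ ball p R, f x ≠ 0) →
      (∀ᵐ x ∂(μ.restrict (ball p R)),
        ‖fderiv ℝ f x‖ ^ Module.finrank ℝ E ≤ K * (fderiv ℝ f x).det) → |σ| = 1 →
      ∫⁻ y in ball p R, ‖Real.log ‖f y‖ - c‖ₑ ∂μ ≤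
        ENNReal.ofReal (A * R ^ Module.finrank ℝ E) →
      ∀ y ∈ ball p (R / 2), σ * (Real.log ‖f y‖ - c) ≤ C := by
  set N := Module.finrank ℝ E with hN
  obtain ⟨ε, hε, hmain⟩ := exists_log_norm_le_of_measure_superlevel_le E μ hE K hK
    (2 ^ (N + 1)) (by positivity)
  refine ⟨4 * 2 ^ N * 4 ^ N * A / ε, by positivity, ?_⟩
  intro f p R c σ hR hf h0 hqr hσ h_int y hy
  rcases le_or_gt (σ * (Real.log ‖f y‖ - c)) 0 with hneg | hpos
  · exact hneg.trans (by positivity)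
  let w : E → ℝ := fun x => σ * (Real.log ‖f x‖ - c)
  let v : E → ℝ := fun x => (3 * R / 4 - dist x p) ^ N * w x
  have hsub : closedBall p (3 * R / 4) ⊆ ball p R := closedBall_subset_ball (by linarith)
  have huc : ContinuousOn (fun x => Real.log ‖f x‖) (ball p R) :=
    hf.continuousOn.norm.log fun x hx => norm_ne_zero_iff.2 (h0 x hx)
  have hwc : ContinuousOn w (ball p R) := continuousOn_const.mul (huc.sub continuousOn_const)
  have hvc : ContinuousOn v (closedBall p (3 * R / 4)) :=
    ContinuousOn.mul (Continuous.continuousOn (by fun_prop)) (hwc.mono hsub)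
  have hyd : dist y p < R / 2 := hy
  have hy' : y ∈ closedBall p (3 * R / 4) := mem_closedBall.2 (by linarith)
  obtain ⟨x₀, hx₀, hmax⟩ := (isCompact_closedBall p (3 * R / 4)).exists_isMaxOn ⟨y, hy'⟩ hvc
  have hvy : (R / 4) ^ N * w y ≤ v y :=
    mul_le_mul_of_nonneg_right (pow_le_pow_left₀ (by positivity) (by linarith) N) hpos.le
  have hvx₀ : v y ≤ v x₀ := hmax hy'
  have hvpos : 0 < v x₀ := lt_of_lt_of_le (by positivity) (hvy.trans hvx₀)
  obtain ⟨τ, hτ⟩ : ∃ τ, 3 * R / 4 - dist x₀ p = τ := ⟨_, rfl⟩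
  have hτ0 : 0 ≤ τ := by
    have := mem_closedBall.1 hx₀
    linarith
  have hv : v x₀ = τ ^ N * w x₀ := by rw [← hτ]
  rw [hv] at hvpos hvx₀
  have hw₀ : 0 < w x₀ := pos_of_mul_pos_right hvpos (by positivity)
  have hτpos : 0 < τ := hτ0.lt_of_ne' fun h => by
    rw [h, zero_pow (by lia), zero_mul] at hvpos
    exact hvpos.false
  have hsub₀ : closedBall x₀ (τ / 2) ⊆ closedBall p (3 * R / 4) :=
    closedBall_subset_closedBall' (by linarith)
  have hw : ∀ x ∈ closedBall x₀ (τ / 2), w x ≤ 2 ^ N * w x₀ := by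
    intro x hx
    rcases le_or_gt (w x) 0 with h | h
    · exact h.trans (by positivity)
    have h1 : v x ≤ τ ^ N * w x₀ := (hmax (hsub₀ hx)).trans hv.le
    have h2 : (τ / 2) ^ N * w x ≤ v x := by
      refine mul_le_mul_of_nonneg_right (pow_le_pow_left₀ (by positivity) ?_ N) h.le
      have := dist_triangle x x₀ p
      have := mem_closedBall.1 hx
      linarith
    rw [div_pow, div_mul_eq_mul_div] at h2
    have h3 := (div_le_iff₀ (by positivity)).1 (h2.trans h1)
    have h4 : τ ^ N * w x ≤ τ ^ N * (2 ^ N * w x₀) := by linarith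
    exact le_of_mul_le_mul_left h4 (by positivity)
  let S := {x ∈ closedBall x₀ (τ / 2) | σ * c + w x₀ / 4 < σ * Real.log ‖f x‖}
  have hSR : S ⊆ ball p R := fun x hx => hsub (hsub₀ hx.1)
  have hSm : MeasurableSet S :=
    ContinuousOn.measurableSet_inter_lt
      (continuousOn_const.mul (huc.mono (hsub₀.trans hsub))) isClosed_closedBall.measurableSet _
  have hS : ε * (τ / 2) ^ N < μ.real S := by
    by_contra! hle
    have := hmain f (ball p R) x₀ (τ / 2) σ (σ * c + w x₀ / 4) (w x₀ / 2) isOpen_ball hf h0 hqr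
      (by positivity) (by positivity) (hsub₀.trans hsub) hσ (fun x hx => ?_) hle
    · have e : w x₀ = σ * Real.log ‖f x₀‖ - σ * c := mul_sub _ _ _
      linarith
    · have e : w x = σ * Real.log ‖f x‖ - σ * c := mul_sub _ _ _
      have := hw x hx
      rw [pow_succ]
      linarith
  have hcheb : w x₀ / 4 * μ.real S ≤ A * R ^ N := by
    have hSt : μ S ≠ ∞ := (measure_mono hSR).trans_lt measure_ball_lt_top |>.ne
    have h1 : ENNReal.ofReal (w x₀ / 4) * μ S ≤ ENNReal.ofReal (A * R ^ N) := by
      rw [← setLIntegral_const]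
      refine (setLIntegral_mono' hSm fun x hx => ?_).trans ((lintegral_mono_set hSR).trans h_int)
      rw [← ofReal_norm]
      refine ENNReal.ofReal_le_ofReal ?_
      have h2 : w x₀ / 4 < w x := by
        have e : w x = σ * Real.log ‖f x‖ - σ * c := mul_sub _ _ _
        have := hx.2
        linarith
      refine h2.le.trans ((le_abs_self _).trans (le_of_eq ?_))
      rw [abs_mul, hσ, one_mul, Real.norm_eq_abs]
    rw [← ofReal_measureReal hSt, ← ENNReal.ofReal_mul (by positivity)] at h1
    exact (ENNReal.ofReal_le_ofReal_iff (by positivity)).1 h1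
  have h1 : w x₀ / 4 * (ε * (τ / 2) ^ N) ≤ A * R ^ N :=
    (mul_le_mul_of_nonneg_left hS.le (by positivity)).trans hcheb
  have h2 : (R / 4) ^ N * w y ≤ τ ^ N * w x₀ := hvy.trans hvx₀
  rw [div_pow] at h1 h2
  have h3 : ε * (τ ^ N * w x₀) ≤ 4 * 2 ^ N * (A * R ^ N) := by
    have e : w x₀ / 4 * (ε * (τ ^ N / 2 ^ N)) * (4 * 2 ^ N) = ε * (τ ^ N * w x₀) := by
      field_simp
    rw [← e, mul_comm (4 * 2 ^ N)]
    exact mul_le_mul_of_nonneg_right h1 (by positivity)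
  rw [le_div_iff₀ hε]
  have h4 : R ^ N * (w y * ε) ≤ R ^ N * (4 * 2 ^ N * 4 ^ N * A) := by
    calc R ^ N * (w y * ε) = 4 ^ N * (ε * (R ^ N / 4 ^ N * w y)) := by field_simp
      _ ≤ 4 ^ N * (4 * 2 ^ N * (A * R ^ N)) := by
        exact mul_le_mul_of_nonneg_left ((mul_le_mul_of_nonneg_left h2 hε.le).trans h3)
          (by positivity)
      _ = _ := by ring
  exact le_of_mul_le_mul_left h4 (by positivity)

/-- Oscillation of `log ‖f‖` on a ball, for a nonvanishing quasiregular map `f` such that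
`∇ log ‖f‖` has controlled mass on the doubled ball. -/
theorem exists_log_norm_sub_log_norm_le (E : Type*) [NormedAddCommGroup E]
    [InnerProductSpace ℝ E] [FiniteDimensional ℝ E] [MeasurableSpace E] [BorelSpace E]
    (μ : Measure E) [μ.IsAddHaarMeasure] (hE : 2 ≤ Module.finrank ℝ E) (K : ℝ) (hK : 0 ≤ K)
    (A : ℝ) (hA : 0 ≤ A) :
    ∃ C : ℝ, ∀ (f : E → E) (p : E) (R : ℝ), 0 < R →
      DifferentiableOn ℝ f (ball p R) → (∀ x ∈ ball p R, f x ≠ 0) →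
      (∀ᵐ x ∂(μ.restrict (ball p R)),
        ‖fderiv ℝ f x‖ ^ Module.finrank ℝ E ≤ K * (fderiv ℝ f x).det) →
      ∫⁻ y in ball p R, ‖fderiv ℝ (fun y => Real.log ‖f y‖) y‖ₑ ∂μ ≤
        ENNReal.ofReal (A * R ^ (Module.finrank ℝ E - 1)) →
      ∀ y ∈ ball p (R / 2), ∀ z ∈ ball p (R / 2), Real.log ‖f y‖ - Real.log ‖f z‖ ≤ C := by
  set N := Module.finrank ℝ E with hN
  obtain ⟨C, -, hC⟩ := exists_log_norm_sub_le_of_lintegral_le E μ hE K hK (2 * 2 ^ N * A)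
    (by positivity)
  refine ⟨C + C, ?_⟩
  intro f p R hR hf h0 hqr h_int y hy z hz
  have hu : DifferentiableOn ℝ (fun y => Real.log ‖f y‖) (ball p R) := fun x hx =>
    (norm_fderiv_log_norm_comp_le (hf.differentiableAt (isOpen_ball.mem_nhds hx))
      (h0 x hx)).1.differentiableAt.differentiableWithinAt
  obtain ⟨x, -, hx⟩ := exists_setLIntegral_enorm_sub_le μ hR hu
  have hle : ∫⁻ y in ball p R, ‖Real.log ‖f y‖ - Real.log ‖f x‖‖ₑ ∂μ ≤
      ENNReal.ofReal (2 * 2 ^ N * A * R ^ N) := by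
    refine hx.trans ((mul_le_mul_right h_int _).trans (le_of_eq ?_))
    have e : (2 : ℝ≥0∞) ^ N = ENNReal.ofReal (2 ^ N) := by
      rw [ENNReal.ofReal_pow zero_le_two, ENNReal.ofReal_ofNat]
    rw [← hN, e, ← ENNReal.ofReal_mul (by positivity), ← ENNReal.ofReal_mul (by positivity)]
    congr 1
    obtain ⟨m, hm⟩ : ∃ m, N = m + 1 := ⟨N - 1, by lia⟩
    rw [hm, Nat.add_sub_cancel, pow_succ R]
    ring
  have h1 := hC f p R _ 1 hR hf h0 hqr abs_one hle y hy
  have h2 := hC f p R _ (-1) hR hf h0 hqr (by simp) hle z hz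
  linarith

theorem exists_mem_unitSphere_ball_subset {n : ℕ} (hn : 2 ≤ n) {x : Vec n}
    (hx : x ∈ unitBall n) :
    ∃ ω ∈ unitSphere n, ball x (1 - ‖x‖) ⊆ unitBall n ∩ ball ω (2 * (1 - ‖x‖)) := by
  have hx1 : ‖x‖ < 1 := mem_ball_zero_iff.1 hx
  obtain ⟨ω, hω, hxω⟩ : ∃ ω : Vec n, ‖ω‖ = 1 ∧ ‖x‖ • ω = x := by
    by_cases h : x = 0
    · exact ⟨EuclideanSpace.single ⟨0, by lia⟩ 1, by simp, by simp [h]⟩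
    · have h' : ‖x‖ ≠ 0 := norm_ne_zero_iff.2 h
      exact ⟨‖x‖⁻¹ • x, by rw [norm_smul, norm_inv, norm_norm, inv_mul_cancel₀ h'],
        smul_inv_smul₀ h' x⟩
  refine ⟨ω, mem_sphere_zero_iff_norm.2 hω,
    subset_inter (ball_subset_ball' ?_) (ball_subset_ball' ?_)⟩
  · rw [dist_zero_right]
    linarith
  · have h : x - ω = (‖x‖ - 1) • ω := by rw [sub_smul, one_smul, hxω]
    rw [dist_eq_norm, h, norm_smul, hω, mul_one, Real.norm_eq_abs, abs_of_neg (by linarith)]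
    linarith

theorem IsCarleson.setLIntegral_ball_le {n : ℕ} (hn : 2 ≤ n) {c : ℝ} (hc : 0 ≤ c)
    {g : Vec n → ℝ≥0∞} (hg : IsCarleson n c ((volume.restrict (unitBall n)).withDensity g))
    {x : Vec n} (hx : x ∈ unitBall n) :
    ∫⁻ y in ball x (1 - ‖x‖), g y ≤
      ENNReal.ofReal (c * 2 ^ (n - 1) * (1 - ‖x‖) ^ (n - 1)) := by
  have hR : 0 < 1 - ‖x‖ := sub_pos.2 (mem_ball_zero_iff.1 hx)
  obtain ⟨ω, hω, hsub⟩ := exists_mem_unitSphere_ball_subset hn hx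
  have h := (measure_mono hsub).trans (hg ω hω (2 * (1 - ‖x‖)) (by positivity))
  rw [withDensity_apply _ measurableSet_ball, Measure.restrict_restrict measurableSet_ball,
    inter_eq_left.2 (hsub.trans inter_subset_left)] at h
  refine h.trans (le_of_eq ?_)
  have e : (n : ℝ) - 1 = ((n - 1 : ℕ) : ℝ) := by
    rw [Nat.cast_sub (by lia), Nat.cast_one]
  rw [e, ENNReal.rpow_natCast, ← ENNReal.ofReal_pow (by positivity), ← ENNReal.ofReal_mul hc,
    mul_pow, mul_assoc]

theorem harnack_from_carleson (n : ℕ) (hn : 2 ≤ n) (K Γc k : ℝ) (hK : 1 ≤ K)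
    (hΓ : 0 < Γc) (hk0 : 0 < k) (hk : k ≤ 1 / 2) :
    ∃ C : ℝ, 0 < C ∧ ∀ f : Vec n → Vec n,
      IsQR n K f → (∀ x ∈ unitBall n, f x ≠ 0) →
      IsCarleson n Γc ((volume.restrict (unitBall n)).withDensity
        (fun x => ENNReal.ofReal ‖fderiv ℝ (fun y => Real.log ‖f y‖) x‖)) →
      ∀ x ∈ unitBall n, ∀ y ∈ Metric.ball x (k * (1 - ‖x‖)),
        ∀ z ∈ Metric.ball x (k * (1 - ‖x‖)), ‖f y‖ / ‖f z‖ ≤ C := by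
  have hdim : Module.finrank ℝ (Vec n) = n := finrank_euclideanSpace_fin
  obtain ⟨C, hC⟩ := exists_log_norm_sub_log_norm_le (Vec n) volume (by rw [hdim]; exact hn) K
    (by positivity) (Γc * 2 ^ (n - 1)) (by positivity)
  rw [hdim] at hC
  refine ⟨Real.exp C, Real.exp_pos C, ?_⟩
  rintro f ⟨-, hdiff, hqr⟩ h0 hcar x hx y hy z hz
  have hR : 0 < 1 - ‖x‖ := sub_pos.2 (mem_ball_zero_iff.1 hx)
  have hsub : ball x (1 - ‖x‖) ⊆ unitBall n := ball_subset_ball' (by simp)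
  have hksub : ball x (k * (1 - ‖x‖)) ⊆ ball x ((1 - ‖x‖) / 2) := by
    refine ball_subset_ball ?_
    have := mul_le_mul_of_nonneg_right hk hR.le
    linarith
  have h_int := hcar.setLIntegral_ball_le hn hΓ.le hx
  simp_rw [ofReal_norm] at h_int
  have h := hC f x (1 - ‖x‖) hR (fun a ha => (hdiff a (hsub ha)).differentiableWithinAt)
    (fun a ha => h0 a (hsub ha)) (ae_restrict_of_ae_restrict_of_subset hsub hqr) h_int
    y (hksub hy) z (hksub hz)
  have hball : ball x ((1 - ‖x‖) / 2) ⊆ unitBall n :=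
    (ball_subset_ball (by linarith)).trans hsub
  have hy0 : 0 < ‖f y‖ := norm_pos_iff.2 (h0 y (hball (hksub hy)))
  have hz0 : 0 < ‖f z‖ := norm_pos_iff.2 (h0 z (hball (hksub hz)))
  rw [← Real.log_div hy0.ne' hz0.ne'] at h
  exact (Real.log_le_iff_le_exp (div_pos hy0 hz0)).1 h

end
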